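/- Embedding inequality for configurations with regular jump set (core estimate of Theorem 2.5). Let d ≥ 2 and let Q ⊂ ℝ^d be an open cube. There is a constant C > 0 depending only on Q and d such that every u ∈ W(Q) with jump set Γ_u satisfies ∫_Q |∇u(x)| dx ≤ C·‖e(u)‖_{L²(Q)} + C·‖u‖_{L^∞(Q)}·(H^{d−1}(Γ_u) + 1). -/

import Mathlib

open MeasureTheory Set
open scoped ENNReal NNReal

noncomputable section

/-- `d`-dimensional Euclidean space. -/
abbrev Ed (d : ℕ) := EuclideanSpace ℝ (Fin d)

/-- The open axis-parallel cube with corner `a` and sidelength `l`. -/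
def cube {d : ℕ} (a : Ed d) (l : ℝ) : Set (Ed d) := {x | ∀ i : Fin d, x i ∈ Ioo (a i) (a i + l)}

/-- Frobenius norm of a `d × d` real matrix. -/
def matNormD {d : ℕ} (A : Matrix (Fin d) (Fin d) ℝ) : ℝ :=
  Real.sqrt (∑ i : Fin d, ∑ j : Fin d, (A i j) ^ 2)

/-- The (a.e.) gradient of `u` as a matrix, defined via `fderiv`
(it vanishes at points of non-differentiability). -/
def mgradD {d : ℕ} (u : Ed d → Ed d) (x : Ed d) : Matrix (Fin d) (Fin d) ℝ :=
  fun i j => fderiv ℝ u x (EuclideanSpace.single j (1 : ℝ)) i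

/-- The symmetrized gradient `e(u) = (∇u + (∇u)ᵀ)/2`. -/
def symGradD {d : ℕ} (u : Ed d → Ed d) (x : Ed d) : Matrix (Fin d) (Fin d) ℝ :=
  fun i j => (mgradD u x i j + mgradD u x j i) / 2

/-- The Euclidean norm of the gradient of the `i`-th component of `u`. -/
def rowGradNorm {d : ℕ} (u : Ed d → Ed d) (i : Fin d) (x : Ed d) : ℝ :=
  Real.sqrt (∑ j : Fin d, (mgradD u x i j) ^ 2)

/-- `Γ` is a finite union of closed `(d-1)`-dimensional simplices. -/
def FinSimplexUnion (d : ℕ) (Γ : Set (Ed d)) : Prop :=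
  ∃ (n : ℕ) (f : Fin n → Fin d → Ed d),
    (∀ k, AffineIndependent ℝ (f k)) ∧ Γ = ⋃ k : Fin n, convexHull ℝ (Set.range (f k))

/-- `u ∈ W(Q)` with jump set `Γ`: `u` is bounded on `Q`, `Γ` is a finite union of
closed `(d-1)`-simplices, and `u` is locally Lipschitz on `Q \ Γ` with essentially
bounded a.e. gradient there. -/
def IsWd (d : ℕ) (Q : Set (Ed d)) (u : Ed d → Ed d) (Γ : Set (Ed d)) : Prop :=
  (∃ M : ℝ, ∀ x ∈ Q, ‖u x‖ ≤ M) ∧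
  FinSimplexUnion d Γ ∧
  (∀ x ∈ Q \ Γ, ∃ t ∈ nhds x, ∃ L : ℝ≥0, LipschitzOnWith L u t) ∧
  (∃ K : ℝ, ∀ᵐ x ∂volume, x ∈ Q \ Γ → matNormD (mgradD u x) ≤ K)

open scoped Topology ComplexConjugate Pointwise

/-- Planar displacement data: `Γ` is a closed jump set, `u` is locally Lipschitz off `Γ`, and `f`
dominates the symmetrized gradient of `u`, with `f = ⊤` on `Γ` and where `u` is not
differentiable. -/
structure PlanarData (Γ : Set ℂ) (u : ℂ → ℂ) (f : ℂ → ℝ≥0∞) : Prop where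
  isClosed : IsClosed Γ
  lip : ∀ y ∉ Γ, ∃ t ∈ 𝓝 y, ∃ L : ℝ≥0, LipschitzOnWith L u t
  measurable : Measurable f
  eq_top : ∀ y ∈ Γ, f y = ⊤
  differentiableAt : ∀ y, f y ≠ ⊤ → DifferentiableAt ℝ u y
  strain_le : ∀ y, f y ≠ ⊤ → ∀ ζ : ℂ,
    |(fderiv ℝ u y ζ * conj ζ).re| ≤ (f y).toReal * ‖ζ‖ ^ 2

/-- The segment from `y` to `z` avoids `Γ` and `f` has average at most `A` on it. -/
def Sees (Γ : Set ℂ) (f : ℂ → ℝ≥0∞) (A : ℝ) (y z : ℂ) : Prop :=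
  (∀ t ∈ Icc (0 : ℝ) 1, y + t * (z - y) ∉ Γ) ∧
    ∫⁻ t in Icc (0 : ℝ) 1, f (y + t * (z - y)) ≤ ENNReal.ofReal A

theorem PlanarData.abs_re_le {Γ : Set ℂ} {u : ℂ → ℂ} {f : ℂ → ℝ≥0∞} (hP : PlanarData Γ u f)
    {A : ℝ} (hA : 0 ≤ A) {y z : ℂ} (h : Sees Γ f A y z) :
    |((u z - u y) * conj (z - y)).re| ≤ A * ‖z - y‖ ^ 2 := by
  obtain ⟨h1, h2⟩ := h
  set c : ℝ → ℂ := fun t => y + t * (z - y) with hc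
  have hcont : Continuous c := by fun_prop
  have hcl : LipschitzWith ‖z - y‖₊ c := by
    refine LipschitzWith.of_dist_le_mul fun s t => ?_
    simp only [hc, dist_eq_norm]
    have : y + s * (z - y) - (y + t * (z - y)) = ((s - t : ℝ) : ℂ) * (z - y) := by
      push_cast; ring
    rw [this, norm_mul, Complex.norm_real, mul_comm]; rfl
  let g : ℝ → ℝ := fun t => (u (c t) * conj (z - y)).re
  have hgl : LocallyLipschitzOn (Icc (0:ℝ) 1) g := by
    intro t ht
    obtain ⟨T, hT, L, hL⟩ := hP.lip (c t) (h1 t ht)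
    refine ⟨‖z - y‖₊ * (L * ‖z - y‖₊), c ⁻¹' T,
      mem_nhdsWithin_of_mem_nhds (hcont.continuousAt hT), ?_⟩
    refine LipschitzOnWith.of_dist_le_mul fun s hs t ht => ?_
    have e1 := hL.dist_le_mul _ hs _ ht
    have e2 := hcl.dist_le_mul s t
    simp only [g, Real.dist_eq, ← Complex.sub_re, ← sub_mul]
    refine (Complex.abs_re_le_norm _).trans ?_
    rw [norm_mul, RCLike.norm_conj, mul_comm, ← dist_eq_norm (u _)]
    push_cast
    rw [mul_assoc]
    refine mul_le_mul_of_nonneg_left (e1.trans ?_) (norm_nonneg _)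
    rw [mul_assoc]
    exact mul_le_mul_of_nonneg_left e2 L.2
  obtain ⟨K, hK⟩ := hgl.exists_lipschitzOnWith_of_compact isCompact_Icc
  have hac : AbsolutelyContinuousOnInterval g 0 1 :=
    LipschitzOnWith.absolutelyContinuousOnInterval (K := K) (by rwa [uIcc_of_le zero_le_one])
  have hint := hac.integral_deriv_eq_sub
  have hfin : ∀ᵐ t ∂(volume.restrict (Icc (0:ℝ) 1)), f (c t) < ⊤ :=
    ae_lt_top (hP.measurable.comp hcont.measurable) (h2.trans_lt ENNReal.ofReal_lt_top).ne
  have hb : ∀ᵐ t ∂(volume.restrict (Icc (0:ℝ) 1)), ‖deriv g t‖ ≤ (f (c t)).toReal * ‖z - y‖ ^ 2 := by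
    filter_upwards [hfin] with t ht
    have hd := (hP.differentiableAt _ ht.ne).hasFDerivAt
    have hcd : HasDerivAt c (z - y) t := by
      have := ((Complex.ofRealCLM.hasDerivAt (x := t)).mul_const (z - y)).const_add y
      simpa [hc] using this
    have hud := hd.comp_hasDerivAt t hcd
    have hgd : HasDerivAt g (fderiv ℝ u (c t) (z - y) * conj (z - y)).re t := by
      have := (hud.mul_const (conj (z - y)))
      exact (Complex.reCLM.hasFDerivAt (x := u (c t) * conj (z - y))).comp_hasDerivAt t this
    rw [hgd.deriv]
    exact hP.strain_le _ ht.ne _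
  have hend : g 1 - g 0 = ((u z - u y) * conj (z - y)).re := by
    simp [g, hc, sub_mul]
  rw [← hend, ← hint, ← Real.norm_eq_abs, intervalIntegral.integral_of_le zero_le_one,
    ← integral_Icc_eq_integral_Ioc]
  have hfi : Integrable (fun t => (f (c t)).toReal) (volume.restrict (Icc (0:ℝ) 1)) :=
    integrable_toReal_of_lintegral_ne_top (hP.measurable.comp hcont.measurable).aemeasurable
      (h2.trans_lt ENNReal.ofReal_lt_top).ne
  refine (norm_integral_le_of_norm_le (hfi.mul_const _) hb).trans ?_
  rw [integral_mul_const, integral_toReal (f := fun t => f (c t))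
    (hP.measurable.comp hcont.measurable).aemeasurable hfin]
  exact mul_le_mul_of_nonneg_right (ENNReal.toReal_le_of_le_ofReal hA h2) (by positivity)

theorem lintegral_comp_homothety {g : ℂ → ℝ≥0∞} (hg : Measurable g) (y : ℂ) {t : ℝ} (ht : 0 < t) :
    ∫⁻ z, g (y + t * (z - y)) = ENNReal.ofReal ((t ^ 2)⁻¹) * ∫⁻ z, g z := by
  have e1 : ∫⁻ z, g (y + t * (z - y)) = ∫⁻ z : ℂ, g (y + t * z) :=
    lintegral_sub_right_eq_self (fun z : ℂ => g (y + t * z)) y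
  have e2 : ∫⁻ z : ℂ, g (y + z) = ∫⁻ z, g z := lintegral_add_left_eq_self g y
  have hm := Measure.map_addHaar_smul (volume : Measure ℂ) ht.ne'
  rw [Complex.finrank_real_complex] at hm
  have e3 : ∫⁻ z : ℂ, g (y + t * z) = ∫⁻ z, g (y + z) ∂(Measure.map (t • ·) (volume : Measure ℂ)) := by
    rw [lintegral_map (by fun_prop) (measurable_const_smul t)]
    simp
  rw [e1, e3, hm, lintegral_smul_measure, e2, abs_of_pos (by positivity), smul_eq_mul]

theorem volume_image_homothety (S : Set ℂ) (y : ℂ) {r : ℝ} (hr : 0 < r) :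
    volume ((fun v : ℂ => y + r * v) '' S) = ENNReal.ofReal (r ^ 2) * volume S := by
  have : (fun v : ℂ => y + r * v) '' S = (fun x => y + x) '' (r • S) := by
    rw [← image_smul, image_image]; simp
  rw [this, image_add_left, measure_preimage_add, Measure.addHaar_smul, Complex.finrank_real_complex,
    abs_of_pos (by positivity)]

/-- The ray from `y` in direction `v` meets `Γ` before time `h`. -/
def Hit (Γ : Set ℂ) (h : ℝ) (v y : ℂ) : Prop := ∃ t ∈ Icc (0 : ℝ) h, y + t * v ∈ Γ

/-- Measure of the directions in the unit disc in which `Γ` is met from `y` before time `h`. -/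
def hitMeas (Γ : Set ℂ) (h : ℝ) (y : ℂ) : ℝ≥0∞ :=
  volume {v | v ∈ Metric.ball (0 : ℂ) 1 ∧ Hit Γ h v y}

/-- Measure of the directions `v` such that `Γ` is met from `y` before time `h` in both directions
`v` and `-v`. -/
def twoHitMeas (Γ : Set ℂ) (h : ℝ) (y : ℂ) : ℝ≥0∞ :=
  volume {v | v ∈ Metric.ball (0 : ℂ) 1 ∧ Hit Γ h v y ∧ Hit Γ h (-v) y}

theorem isClosed_hit {Γ : Set ℂ} (hΓ : IsClosed Γ) (h : ℝ) :
    IsClosed {p : ℂ × ℂ | Hit Γ h p.2 p.1} := by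
  have : {p : ℂ × ℂ | Hit Γ h p.2 p.1} =
      Prod.snd '' {q : Icc (0:ℝ) h × (ℂ × ℂ) | q.2.1 + (q.1 : ℝ) * q.2.2 ∈ Γ} := by
    ext p
    constructor
    · rintro ⟨t, ht, hp⟩
      exact ⟨(⟨t, ht⟩, p), hp, rfl⟩
    · rintro ⟨⟨t, p⟩, hq, rfl⟩
      exact ⟨t, t.2, hq⟩
  rw [this]
  refine isClosedMap_snd_of_compactSpace _ (hΓ.preimage ?_)
  fun_prop

theorem lintegral_segment_le {f : ℂ → ℝ≥0∞} (hf : Measurable f) {y : ℂ} {e R : ℝ}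
    (hy : ∀ r ∈ Ioo (0:ℝ) R, ∫⁻ z in Metric.ball y r, f z ≤ ENNReal.ofReal (e * r ^ 2))
    {r : ℝ} (hr : 0 < r) (hrR : r ≤ R) :
    ∫⁻ z in Metric.ball y r, (∫⁻ t in Icc (0:ℝ) 1, f (y + t * (z - y))) ≤
      ENNReal.ofReal (e * r ^ 2) := by
  rw [lintegral_lintegral_swap]
  swap
  · exact (hf.comp (by fun_prop)).aemeasurable
  calc ∫⁻ t in Icc (0:ℝ) 1, (∫⁻ z in Metric.ball y r, f (y + t * (z - y)))
      ≤ ∫⁻ t in Icc (0:ℝ) 1, ENNReal.ofReal (e * r ^ 2) := by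
        rw [← restrict_Ioo_eq_restrict_Icc]
        refine setLIntegral_mono_ae' measurableSet_Ioo (ae_of_all _ fun t ht => ?_)
        have h1 := lintegral_comp_homothety (g := (Metric.ball y (t * r)).indicator f)
          (hf.indicator measurableSet_ball) y ht.1
        have h2 : ∀ z, (Metric.ball y (t * r)).indicator f (y + t * (z - y)) =
            (Metric.ball y r).indicator (fun z => f (y + t * (z - y))) z := by
          intro z
          have : y + t * (z - y) ∈ Metric.ball y (t * r) ↔ z ∈ Metric.ball y r := by
            simp only [mem_ball_iff_norm, add_sub_cancel_left, norm_mul, Complex.norm_real,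
              Real.norm_eq_abs, abs_of_pos ht.1]
            exact mul_lt_mul_iff_right₀ ht.1
          by_cases hz : z ∈ Metric.ball y r
          · rw [indicator_of_mem hz, indicator_of_mem (this.2 hz)]
          · rw [indicator_of_notMem hz, indicator_of_notMem (fun h => hz (this.1 h))]
        simp_rw [h2] at h1
        rw [lintegral_indicator measurableSet_ball, lintegral_indicator measurableSet_ball] at h1
        rw [h1]
        have h3 := hy (t * r) ⟨mul_pos ht.1 hr, by nlinarith [ht.2]⟩
        refine (mul_le_mul_right h3 _).trans ?_
        rw [← ENNReal.ofReal_mul (by positivity)]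
        refine ENNReal.ofReal_le_ofReal (le_of_eq ?_)
        have := ht.1.ne'
        field_simp
    _ = _ := by simp

theorem volume_not_sees_le {Γ : Set ℂ} {f : ℂ → ℝ≥0∞} (hf : Measurable f) {y : ℂ} {e R h τ : ℝ}
    (he : 0 < e) (hτ : 0 < τ)
    (hy : ∀ r ∈ Ioo (0:ℝ) R, ∫⁻ z in Metric.ball y r, f z ≤ ENNReal.ofReal (e * r ^ 2))
    (hhit : hitMeas Γ h y ≤ ENNReal.ofReal τ) {r : ℝ} (hr : 0 < r) (hrh : r ≤ h) (hrR : r ≤ R) :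
    volume {z | z ∈ Metric.ball y r ∧ ¬ Sees Γ f (e / τ) y z} ≤ ENNReal.ofReal (2 * τ * r ^ 2) := by
  have h1 : volume ((fun v : ℂ => y + r * v) '' {v | v ∈ Metric.ball (0 : ℂ) 1 ∧ Hit Γ h v y}) ≤
      ENNReal.ofReal (τ * r ^ 2) := by
    rw [volume_image_homothety _ _ hr, mul_comm τ, ENNReal.ofReal_mul (by positivity)]
    exact mul_le_mul_right hhit _
  have h2 : volume {z | z ∈ Metric.ball y r ∧
      ENNReal.ofReal (e / τ) < ∫⁻ t in Icc (0:ℝ) 1, f (y + t * (z - y))} ≤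
      ENNReal.ofReal (τ * r ^ 2) := by
    have hm : Measurable fun z : ℂ => ∫⁻ t in Icc (0:ℝ) 1, f (y + t * (z - y)) := by
      refine Measurable.lintegral_prod_right' (f := fun p : ℂ × ℝ => f (y + p.2 * (p.1 - y))) ?_
      exact hf.comp (by fun_prop)
    have := meas_ge_le_lintegral_div (μ := volume.restrict (Metric.ball y r)) hm.aemeasurable
      (ε := ENNReal.ofReal (e / τ)) (by simpa using by positivity) ENNReal.ofReal_ne_top
    rw [Measure.restrict_apply (measurableSet_le measurable_const hm)] at this
    refine (measure_mono ?_).trans (this.trans ?_)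
    · rintro z ⟨hz, hz'⟩
      exact ⟨hz'.le, hz⟩
    · refine (ENNReal.div_le_div_right (lintegral_segment_le hf hy hr hrR) _).trans ?_
      rw [← ENNReal.ofReal_div_of_pos (by positivity)]
      refine ENNReal.ofReal_le_ofReal (le_of_eq ?_)
      field_simp
  have hsub : {z | z ∈ Metric.ball y r ∧ ¬ Sees Γ f (e / τ) y z} ⊆
      ((fun v : ℂ => y + r * v) '' {v | v ∈ Metric.ball (0 : ℂ) 1 ∧ Hit Γ h v y}) ∪
      {z | z ∈ Metric.ball y r ∧
      ENNReal.ofReal (e / τ) < ∫⁻ t in Icc (0:ℝ) 1, f (y + t * (z - y))} := by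
    rintro z ⟨hz, hns⟩
    by_cases hlt : ENNReal.ofReal (e / τ) < ∫⁻ t in Icc (0:ℝ) 1, f (y + t * (z - y))
    · exact Or.inr ⟨hz, hlt⟩
    · left
      have : ∃ t ∈ Icc (0 : ℝ) 1, y + t * (z - y) ∈ Γ := by
        by_contra hcon
        push Not at hcon
        exact hns ⟨hcon, not_lt.1 hlt⟩
      obtain ⟨t, ht, htΓ⟩ := this
      have hrc : (r : ℂ) ≠ 0 := by exact_mod_cast hr.ne'
      refine ⟨(z - y) / r, ⟨?_, t * r, ⟨by have := ht.1; positivity, ?_⟩, ?_⟩, ?_⟩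
      · rw [mem_ball_zero_iff, norm_div, Complex.norm_real, Real.norm_eq_abs, abs_of_pos hr,
          div_lt_one hr]
        simpa [dist_eq_norm] using hz
      · nlinarith [ht.2]
      · convert htΓ using 2
        push_cast; field_simp
      · simp only; field_simp; ring
  refine (measure_mono hsub).trans ((measure_union_le _ _).trans ((add_le_add h1 h2).trans ?_))
  rw [← ENNReal.ofReal_add (by positivity) (by positivity)]
  exact ENNReal.ofReal_le_ofReal (by linarith)

/-- Points from which few directions meet `Γ` before time `h`, and where `f` and its averages at
scales below `R` are at most `e`. -/
structure GoodPt (Γ : Set ℂ) (f : ℂ → ℝ≥0∞) (e h R : ℝ) (y : ℂ) : Prop where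
  hit_le : hitMeas Γ h y ≤ ENNReal.ofReal (1 / 2000)
  le : f y ≤ ENNReal.ofReal e
  avg_le : ∀ r ∈ Ioo (0 : ℝ) R, ∫⁻ z in Metric.ball y r, f z ≤ ENNReal.ofReal (e * r ^ 2)

/-- Good points around which most points are good at all scales below `h`. -/
structure VeryGoodPt (Γ : Set ℂ) (f : ℂ → ℝ≥0∞) (e h R : ℝ) (y : ℂ) : Prop where
  good : GoodPt Γ f e h R y
  most : ∀ r ∈ Ioo (0 : ℝ) h, volume {z | z ∈ Metric.ball y r ∧ ¬ GoodPt Γ f e h R z} ≤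
    ENNReal.ofReal (1 / 2000 * r ^ 2)

theorem GoodPt.volume_not_sees_le {Γ : Set ℂ} {f : ℂ → ℝ≥0∞} (hf : Measurable f) {e h R : ℝ}
    (he : 0 < e) (hhR : h ≤ R) {y : ℂ} (hy : GoodPt Γ f e h R y) {r : ℝ} (hr : 0 < r)
    (hrh : r ≤ h) :
    volume {z | z ∈ Metric.ball y r ∧ ¬ Sees Γ f (2000 * e) y z} ≤
      ENNReal.ofReal (1 / 1000 * r ^ 2) := by
  have := _root_.volume_not_sees_le hf he (τ := 1 / 2000) (by norm_num) hy.avg_le hy.hit_le hr hrh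
    (hrh.trans hhR)
  rw [show e / (1 / 2000) = 2000 * e by ring] at this
  exact this.trans (ENNReal.ofReal_le_ofReal (le_of_eq (by ring)))

theorem ofReal_mul_sq_le_volume_ball (c : ℂ) {r : ℝ} (hr : 0 ≤ r) :
    ENNReal.ofReal (3 * r ^ 2) ≤ volume (Metric.ball c r) := by
  rw [Complex.volume_ball, ← ENNReal.ofReal_pow hr, mul_comm, ENNReal.ofReal_mul (by positivity)]
  gcongr
  rw [← ENNReal.ofReal_coe_nnreal]
  exact ENNReal.ofReal_le_ofReal Real.pi_gt_three.le

theorem volume_ball_le_ofReal (c : ℂ) {r : ℝ} (hr : 0 ≤ r) :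
    volume (Metric.ball c r) ≤ ENNReal.ofReal (3.2 * r ^ 2) := by
  rw [Complex.volume_ball, ← ENNReal.ofReal_pow hr, mul_comm, ENNReal.ofReal_mul (by positivity)]
  gcongr
  rw [← ENNReal.ofReal_coe_nnreal]
  refine ENNReal.ofReal_le_ofReal ?_
  have := Real.pi_lt_d2
  simp only [NNReal.coe_real_pi]; linarith

theorem exists_mem_ball_of_volume_le {P Q S : ℂ → Prop} {c : ℂ} {r a₁ a₂ a₃ : ℝ} (hr : 0 < r)
    (h₁ : volume {z | z ∈ Metric.ball c r ∧ ¬ P z} ≤ ENNReal.ofReal a₁)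
    (h₂ : volume {z | z ∈ Metric.ball c r ∧ ¬ Q z} ≤ ENNReal.ofReal a₂)
    (h₃ : volume {z | z ∈ Metric.ball c r ∧ ¬ S z} ≤ ENNReal.ofReal a₃)
    (n₁ : 0 ≤ a₁) (n₂ : 0 ≤ a₂) (n₃ : 0 ≤ a₃) (h : a₁ + a₂ + a₃ < 3 * r ^ 2) :
    ∃ z ∈ Metric.ball c r, P z ∧ Q z ∧ S z := by
  by_contra hcon
  push Not at hcon
  have hsub : Metric.ball c r ⊆ ({z | z ∈ Metric.ball c r ∧ ¬ P z} ∪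
      {z | z ∈ Metric.ball c r ∧ ¬ Q z}) ∪ {z | z ∈ Metric.ball c r ∧ ¬ S z} := by
    intro z hz
    have := hcon z hz
    by_cases hp : P z <;> by_cases hq : Q z <;> simp_all
  have h1 := (ofReal_mul_sq_le_volume_ball c hr.le).trans (measure_mono hsub)
  have h2 := h1.trans ((measure_union_le _ _).trans (add_le_add ((measure_union_le _ _).trans
    (add_le_add h₁ h₂)) h₃))
  rw [← ENNReal.ofReal_add n₁ n₂, ← ENNReal.ofReal_add (by positivity) n₃,
    ENNReal.ofReal_le_ofReal_iff (by positivity)] at h2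
  linarith

theorem strain_identity (u₀ u₁ u₂ u₃ w : ℂ) (a₁ b₁ a₂ b₂ : ℝ) :
    ((-b₂) * (1 - a₁) + b₁ * (1 - a₂)) * ((-b₂) * a₁ + b₁ * a₂) * ((u₁ - u₀) * conj w).re =
      ((-b₂) * (1 - a₁) + b₁ * (1 - a₂)) * (-b₂) *
          ((u₂ - u₀) * conj ((a₁ + b₁ * Complex.I) * w)).re +
      ((-b₂) * (1 - a₁) + b₁ * (1 - a₂)) * b₁ *
          ((u₃ - u₀) * conj ((a₂ + b₂ * Complex.I) * w)).re +
      ((-b₂) * a₁ + b₁ * a₂) * (-b₂) *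
          ((u₂ - u₁) * conj ((a₁ + b₁ * Complex.I - 1) * w)).re +
      ((-b₂) * a₁ + b₁ * a₂) * b₁ *
          ((u₃ - u₁) * conj ((a₂ + b₂ * Complex.I - 1) * w)).re -
      (-b₂) * b₁ *
        ((u₃ - u₂) * conj (((a₂ + b₂ * Complex.I) - (a₁ + b₁ * Complex.I)) * w)).re := by
  simp [Complex.mul_re, Complex.mul_im]
  ring

theorem abs_le_of_tetrahedron_identity {a₁ b₁ a₂ b₂ B X X₁ X₂ X₃ X₄ X₅ : ℝ}
    (ha₁ : |a₁ - 1 / 2| ≤ 1 / 10) (ha₂ : |a₂ - 1 / 2| ≤ 1 / 10)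
    (hb₁ : |b₁ - 1| ≤ 1 / 10) (hb₂ : |b₂ + 1| ≤ 1 / 10) (hB0 : 0 ≤ B)
    (h₁ : |X₁| ≤ 1.6 * B) (h₂ : |X₂| ≤ 1.6 * B) (h₃ : |X₃| ≤ 1.6 * B) (h₄ : |X₄| ≤ 1.6 * B)
    (h₅ : |X₅| ≤ 4.9 * B)
    (key : ((-b₂) * (1 - a₁) + b₁ * (1 - a₂)) * ((-b₂) * a₁ + b₁ * a₂) * X =
      ((-b₂) * (1 - a₁) + b₁ * (1 - a₂)) * (-b₂) * X₁ +
      ((-b₂) * (1 - a₁) + b₁ * (1 - a₂)) * b₁ * X₂ +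
      ((-b₂) * a₁ + b₁ * a₂) * (-b₂) * X₃ + ((-b₂) * a₁ + b₁ * a₂) * b₁ * X₄ -
      (-b₂) * b₁ * X₅) :
    |X| ≤ 40 * B := by
  rw [abs_le] at ha₁ ha₂ hb₁ hb₂
  have hpq : ∀ p q : ℝ, 0.9 ≤ p → p ≤ 1.1 → 0.4 ≤ q → q ≤ 0.6 → 0.36 ≤ p * q ∧ p * q ≤ 0.66 := by
    intro p q h1 h2 h3 h4
    exact ⟨by nlinarith only [h1, h3], by nlinarith only [h1, h2, h3, h4]⟩
  obtain ⟨q1, q1'⟩ := hpq (-b₂) (1 - a₁) (by linarith) (by linarith) (by linarith) (by linarith)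
  obtain ⟨q2, q2'⟩ := hpq b₁ (1 - a₂) (by linarith) (by linarith) (by linarith) (by linarith)
  obtain ⟨q3, q3'⟩ := hpq (-b₂) a₁ (by linarith) (by linarith) (by linarith) (by linarith)
  obtain ⟨q4, q4'⟩ := hpq b₁ a₂ (by linarith) (by linarith) (by linarith) (by linarith)
  generalize hs : (-b₂) * (1 - a₁) + b₁ * (1 - a₂) = s at key
  generalize ht : (-b₂) * a₁ + b₁ * a₂ = t at key
  have hs1 : 0.72 ≤ s := by linarith only [hs, q1, q2]
  have hs2 : s ≤ 1.32 := by linarith only [hs, q1', q2']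
  have ht1 : 0.72 ≤ t := by linarith only [ht, q3, q4]
  have ht2 : t ≤ 1.32 := by linarith only [ht, q3', q4']
  have hm : ∀ p q X c : ℝ, 0 ≤ p → p ≤ 1.32 → 0 ≤ q → q ≤ 1.1 → |X| ≤ c * B → 0 ≤ c →
      |p * q * X| ≤ 1.46 * (c * B) := by
    intro p q X c h1 h2 h3 h4 h5 h6
    rw [abs_mul, abs_of_nonneg (by positivity : 0 ≤ p * q)]
    have : p * q ≤ 1.46 := by nlinarith only [h1, h2, h3, h4]
    exact mul_le_mul this h5 (abs_nonneg _) (by norm_num)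
  have m1 := hm s (-b₂) _ _ (by linarith) hs2 (by linarith) (by linarith) h₁ (by norm_num)
  have m2 := hm s b₁ _ _ (by linarith) hs2 (by linarith) (by linarith) h₂ (by norm_num)
  have m3 := hm t (-b₂) _ _ (by linarith) ht2 (by linarith) (by linarith) h₃ (by norm_num)
  have m4 := hm t b₁ _ _ (by linarith) ht2 (by linarith) (by linarith) h₄ (by norm_num)
  have m5 := hm (-b₂) b₁ _ _ (by linarith) (by linarith) (by linarith) (by linarith) h₅
    (by norm_num)
  have hst : 0.5 ≤ s * t := by nlinarith only [hs1, ht1]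
  have hfin : |s * t * X| ≤ 17 * B := by
    rw [key]
    refine (abs_sub _ _).trans ?_
    refine (add_le_add_left ((abs_add_le _ _).trans (add_le_add_left ((abs_add_le _ _).trans
      (add_le_add_left (abs_add_le _ _) _)) _)) _).trans ?_
    linarith only [m1, m2, m3, m4, m5, hB0]
  rw [abs_mul, abs_of_nonneg (by linarith)] at hfin
  have := mul_le_mul_of_nonneg_right hst (abs_nonneg X)
  linarith only [this, hfin, hB0]

theorem abs_re_le_of_tetrahedron {u₀ u₁ u₂ u₃ w : ℂ} {a₁ b₁ a₂ b₂ A : ℝ} (hA : 0 ≤ A)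
    (ha₁ : |a₁ - 1 / 2| ≤ 1 / 10) (ha₂ : |a₂ - 1 / 2| ≤ 1 / 10)
    (hb₁ : |b₁ - 1| ≤ 1 / 10) (hb₂ : |b₂ + 1| ≤ 1 / 10)
    (h02 : |((u₂ - u₀) * conj ((a₁ + b₁ * Complex.I) * w)).re| ≤
      A * ‖(a₁ + b₁ * Complex.I) * w‖ ^ 2)
    (h03 : |((u₃ - u₀) * conj ((a₂ + b₂ * Complex.I) * w)).re| ≤
      A * ‖(a₂ + b₂ * Complex.I) * w‖ ^ 2)
    (h12 : |((u₂ - u₁) * conj ((a₁ + b₁ * Complex.I - 1) * w)).re| ≤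
      A * ‖(a₁ + b₁ * Complex.I - 1) * w‖ ^ 2)
    (h13 : |((u₃ - u₁) * conj ((a₂ + b₂ * Complex.I - 1) * w)).re| ≤
      A * ‖(a₂ + b₂ * Complex.I - 1) * w‖ ^ 2)
    (h23 : |((u₃ - u₂) * conj (((a₂ + b₂ * Complex.I) - (a₁ + b₁ * Complex.I)) * w)).re| ≤
      A * ‖((a₂ + b₂ * Complex.I) - (a₁ + b₁ * Complex.I)) * w‖ ^ 2) :
    |((u₁ - u₀) * conj w).re| ≤ 40 * A * ‖w‖ ^ 2 := by
  have hB0 : 0 ≤ A * ‖w‖ ^ 2 := by positivity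
  have hn : ∀ a b c : ℝ, a ^ 2 + b ^ 2 ≤ c → ∀ q : ℂ, q = a + b * Complex.I →
      A * ‖q * w‖ ^ 2 ≤ c * (A * ‖w‖ ^ 2) := by
    intro a b c hc q hq
    have : ‖q‖ ^ 2 = a ^ 2 + b ^ 2 := by
      rw [hq, ← Complex.normSq_eq_norm_sq, Complex.normSq_add_mul_I]
    rw [norm_mul, mul_pow, this]
    have : 0 ≤ A * ‖w‖ ^ 2 * (c - (a ^ 2 + b ^ 2)) := mul_nonneg hB0 (by linarith)
    linarith
  have hsq : ∀ x y c : ℝ, |x| ≤ y → y ^ 2 ≤ c → x ^ 2 ≤ c := fun x y c h1 h2 =>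
    (sq_le_sq.2 (h1.trans (le_abs_self _))).trans h2
  have ha₁' := abs_le.1 ha₁
  have ha₂' := abs_le.1 ha₂
  have hb₁' := abs_le.1 hb₁
  have hb₂' := abs_le.1 hb₂
  have e1 : a₁ ^ 2 ≤ 0.36 := hsq _ 0.6 _ (abs_le.2 ⟨by linarith, by linarith⟩) (by norm_num)
  have e2 : a₂ ^ 2 ≤ 0.36 := hsq _ 0.6 _ (abs_le.2 ⟨by linarith, by linarith⟩) (by norm_num)
  have e3 : (a₁ - 1) ^ 2 ≤ 0.36 := hsq _ 0.6 _ (abs_le.2 ⟨by linarith, by linarith⟩) (by norm_num)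
  have e4 : (a₂ - 1) ^ 2 ≤ 0.36 := hsq _ 0.6 _ (abs_le.2 ⟨by linarith, by linarith⟩) (by norm_num)
  have e5 : b₁ ^ 2 ≤ 1.21 := hsq _ 1.1 _ (abs_le.2 ⟨by linarith, by linarith⟩) (by norm_num)
  have e6 : b₂ ^ 2 ≤ 1.21 := hsq _ 1.1 _ (abs_le.2 ⟨by linarith, by linarith⟩) (by norm_num)
  have e7 : (a₂ - a₁) ^ 2 ≤ 0.04 := hsq _ 0.2 _ (abs_le.2 ⟨by linarith, by linarith⟩) (by norm_num)
  have e8 : (b₂ - b₁) ^ 2 ≤ 4.84 := hsq _ 2.2 _ (abs_le.2 ⟨by linarith, by linarith⟩) (by norm_num)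
  rw [mul_assoc]
  refine abs_le_of_tetrahedron_identity ha₁ ha₂ hb₁ hb₂ hB0
    (h02.trans (hn a₁ b₁ 1.6 (by linarith) _ rfl)) (h03.trans (hn a₂ b₂ 1.6 (by linarith) _ rfl))
    (h12.trans (hn (a₁ - 1) b₁ 1.6 (by linarith) _ (by push_cast; ring)))
    (h13.trans (hn (a₂ - 1) b₂ 1.6 (by linarith) _ (by push_cast; ring)))
    (h23.trans (hn (a₂ - a₁) (b₂ - b₁) 4.9 (by linarith) _ (by push_cast; ring)))
    (strain_identity u₀ u₁ u₂ u₃ w a₁ b₁ a₂ b₂)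

theorem VeryGoodPt.abs_re_le {Γ : Set ℂ} {u : ℂ → ℂ} {f : ℂ → ℝ≥0∞} (hP : PlanarData Γ u f)
    {e h R : ℝ} (he : 0 < e) (hhR : h ≤ R) {y y' : ℂ} (hy : VeryGoodPt Γ f e h R y)
    (hy' : VeryGoodPt Γ f e h R y') (hd : ‖y' - y‖ ≤ h / 4) :
    |((u y' - u y) * conj (y' - y)).re| ≤ 80000 * e * ‖y' - y‖ ^ 2 := by
  rcases eq_or_ne y' y with rfl | hne
  · simp
  set w := y' - y with hw
  have hw0 : w ≠ 0 := sub_ne_zero.2 hne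
  set r := ‖w‖ with hr
  have hr0 : 0 < r := norm_pos_iff.2 hw0
  have hf := hP.measurable
  -- points near `y + (1/2 ± I) w`
  have hsub : ∀ s : ℝ, |s| = 1 → Metric.ball (y + (1 / 2 + s * Complex.I) * w) (r / 10) ⊆
      Metric.ball y (2 * r) ∩ Metric.ball y' (2 * r) := by
    intro s hs z hz
    rw [mem_ball_iff_norm] at hz
    have hn : ∀ a : ℝ, |a| = 1 / 2 → ‖((a : ℂ) + s * Complex.I) * w‖ ≤ 1.5 * r := by
      intro a ha
      rw [norm_mul]
      refine mul_le_mul_of_nonneg_right ((norm_add_le _ _).trans ?_) hr0.le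
      rw [norm_mul, Complex.norm_real, Complex.norm_real, Complex.norm_I, Real.norm_eq_abs,
        Real.norm_eq_abs, hs, ha]
      norm_num
    constructor <;> rw [mem_ball_iff_norm]
    · have : z - y = (z - (y + (1 / 2 + s * Complex.I) * w)) + (((1 / 2 : ℝ) : ℂ) + s * Complex.I) * w := by
        push_cast; ring
      rw [this]
      have := hn (1 / 2) (by norm_num)
      refine (norm_add_le _ _).trans_lt ?_
      linarith
    · have : z - y' = (z - (y + (1 / 2 + s * Complex.I) * w)) +
          (((-1 / 2 : ℝ) : ℂ) + s * Complex.I) * w := by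
        rw [hw]; push_cast; ring
      rw [this]
      have := hn (-1 / 2) (by rw [abs_of_neg] <;> norm_num)
      refine (norm_add_le _ _).trans_lt ?_
      linarith
  have hmono : ∀ {B B' : Set ℂ} {P : ℂ → Prop} {a : ℝ}, B ⊆ B' →
      volume {z | z ∈ B' ∧ P z} ≤ ENNReal.ofReal a → volume {z | z ∈ B ∧ P z} ≤ ENNReal.ofReal a :=
    fun {B B' P a} hB h => (measure_mono fun z (hz : z ∈ B ∧ P z) =>
      (⟨hB hz.1, hz.2⟩ : z ∈ B' ∧ P z)).trans h
  have h2r : 0 < 2 * r := by linarith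
  have h1 : |(1 : ℝ)| = 1 := abs_one
  have h1' : |(-1 : ℝ)| = 1 := by norm_num
  obtain ⟨z₁, hz₁, hg₁, hs₁, hs₁'⟩ := exists_mem_ball_of_volume_le (r := r / 10) (by positivity)
    (hmono (fun z hz => (hsub 1 h1 hz).1) (hy.most (2 * r) ⟨h2r, by linarith⟩))
    (hmono (fun z hz => (hsub 1 h1 hz).1) (hy.good.volume_not_sees_le hf he hhR h2r (by linarith)))
    (hmono (fun z hz => (hsub 1 h1 hz).2) (hy'.good.volume_not_sees_le hf he hhR h2r (by linarith)))
    (by positivity) (by positivity) (by positivity) (by nlinarith)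
  have hsub2 : Metric.ball (y + (1 / 2 + (-1 : ℝ) * Complex.I) * w) (r / 10) ⊆
      Metric.ball z₁ (4 * r) := by
    intro z hz
    have e1 := (hsub (-1) h1' hz).1
    have e2 := (hsub 1 h1 hz₁).1
    have := Metric.ball_subset_ball' (x := y) (y := z₁) (ε₁ := 2 * r) (ε₂ := 4 * r) (by
      rw [Metric.mem_ball, dist_comm] at e2; linarith)
    exact this e1
  obtain ⟨z₂, hz₂, hs₂, hs₂', hs₁₂⟩ := exists_mem_ball_of_volume_le (r := r / 10) (by positivity)
    (hmono (fun z hz => (hsub (-1) h1' hz).1)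
      (hy.good.volume_not_sees_le hf he hhR h2r (by linarith)))
    (hmono (fun z hz => (hsub (-1) h1' hz).2)
      (hy'.good.volume_not_sees_le hf he hhR h2r (by linarith)))
    (hmono hsub2 (hg₁.volume_not_sees_le (r := 4 * r) hf he hhR (by positivity) (by linarith)))
    (by positivity) (by positivity) (by positivity) (by nlinarith)
  have hcoord : ∀ (s : ℝ) (z : ℂ), z ∈ Metric.ball (y + (1 / 2 + s * Complex.I) * w) (r / 10) →
      ∃ a b : ℝ, z - y = (a + b * Complex.I) * w ∧ |a - 1 / 2| ≤ 1 / 10 ∧ |b - s| ≤ 1 / 10 := by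
    intro s z hz
    set q := (z - y) / w with hq
    have hqw : z - y = q * w := by rw [hq]; field_simp
    have hn : ‖q - (1 / 2 + s * Complex.I)‖ ≤ 1 / 10 := by
      rw [mem_ball_iff_norm] at hz
      have : z - (y + (1 / 2 + s * Complex.I) * w) = (q - (1 / 2 + s * Complex.I)) * w := by
        rw [sub_mul, ← hqw]; ring
      rw [this, norm_mul] at hz
      exact (lt_of_mul_lt_mul_right (by linarith : _ < 1 / 10 * ‖w‖) (norm_nonneg _)).le
    refine ⟨q.re, q.im, by rw [Complex.re_add_im, hqw], ?_, ?_⟩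
    · have := (Complex.abs_re_le_norm _).trans hn
      simpa using this
    · have := (Complex.abs_im_le_norm _).trans hn
      simpa using this
  obtain ⟨a₁, b₁, e₁, ha₁, hb₁⟩ := hcoord 1 z₁ hz₁
  obtain ⟨a₂, b₂, e₂, ha₂, hb₂⟩ := hcoord (-1) z₂ hz₂
  have hA : 0 ≤ 2000 * e := by positivity
  have e₁' : z₁ - y' = (a₁ + b₁ * Complex.I - 1) * w := by rw [sub_mul, ← e₁, hw]; ring
  have e₂' : z₂ - y' = (a₂ + b₂ * Complex.I - 1) * w := by rw [sub_mul, ← e₂, hw]; ring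
  have e₁₂ : z₂ - z₁ = ((a₂ + b₂ * Complex.I) - (a₁ + b₁ * Complex.I)) * w := by
    rw [sub_mul, ← e₁, ← e₂]; ring
  have k02 := hP.abs_re_le hA hs₁
  have k12 := hP.abs_re_le hA hs₁'
  have k03 := hP.abs_re_le hA hs₂
  have k13 := hP.abs_re_le hA hs₂'
  have k23 := hP.abs_re_le hA hs₁₂
  rw [e₁] at k02
  rw [e₂] at k03
  rw [e₁'] at k12
  rw [e₂'] at k13
  rw [e₁₂] at k23
  have := abs_re_le_of_tetrahedron (u₀ := u y) (u₁ := u y') (w := w) hA ha₁ ha₂ hb₁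
    (by simpa using hb₂) k02 k03 k12 k13 k23
  rw [show 80000 * e = 40 * (2000 * e) by ring]
  exact this

theorem norm_mul_det_le {v P Q : ℂ} {α β : ℝ} (h1 : |(v * conj P).re| ≤ α)
    (h2 : |(v * conj Q).re| ≤ β) :
    ‖v‖ * |(conj P * Q).im| ≤ α * ‖Q‖ + β * ‖P‖ := by
  have key : v * ((conj P * Q).im : ℂ) =
      -Complex.I * ((v * conj P).re * Q) + Complex.I * ((v * conj Q).re * P) := by
    apply Complex.ext <;> simp <;> ring
  have e1 : ‖v‖ * |(conj P * Q).im| = ‖v * ((conj P * Q).im : ℂ)‖ := by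
    rw [norm_mul, Complex.norm_real, Real.norm_eq_abs]
  rw [e1, key]
  refine (norm_add_le _ _).trans ?_
  rw [norm_mul, norm_mul, norm_mul, norm_mul, norm_neg, Complex.norm_I, one_mul, one_mul,
    Complex.norm_real, Complex.norm_real, Real.norm_eq_abs, Real.norm_eq_abs]
  exact add_le_add (mul_le_mul_of_nonneg_right h1 (norm_nonneg _))
    (mul_le_mul_of_nonneg_right h2 (norm_nonneg _))

theorem exists_rigid_fit_of_triangle {u : ℂ → ℂ} {L σ : ℝ} {z₀ p q : ℂ} (hL : 0 ≤ L) (hσ : 0 < σ)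
    (hp : p ∈ Metric.ball (z₀ + 2 * σ * (-1 - Complex.I)) (σ / 10))
    (hq : q ∈ Metric.ball (z₀ + 2 * σ * (1 - Complex.I)) (σ / 10))
    (hpq : |((u q - u p) * conj (q - p)).re| ≤ L * ‖q - p‖ ^ 2) :
    ∃ (κ : ℝ) (b : ℂ), ∀ z ∈ Metric.ball z₀ σ,
      |((u z - u p) * conj (z - p)).re| ≤ L * ‖z - p‖ ^ 2 →
      |((u z - u q) * conj (z - q)).re| ≤ L * ‖z - q‖ ^ 2 →
      ‖u z - b - κ * Complex.I * z‖ ≤ 100 * L * σ := by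
  rw [mem_ball_iff_norm] at hp hq
  set p' := p - (z₀ + 2 * σ * (-1 - Complex.I)) with hp'
  set q' := q - (z₀ + 2 * σ * (1 - Complex.I)) with hq'
  have hp1 := abs_lt.1 ((Complex.abs_re_le_norm _).trans_lt hp)
  have hp2 := abs_lt.1 ((Complex.abs_im_le_norm _).trans_lt hp)
  have hq1 := abs_lt.1 ((Complex.abs_re_le_norm _).trans_lt hq)
  have hq2 := abs_lt.1 ((Complex.abs_im_le_norm _).trans_lt hq)
  have hnc : ∀ s : ℝ, |s| = 1 → ‖(2 * σ * (s - Complex.I) : ℂ)‖ ≤ 2.83 * σ := by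
    intro s hs
    rw [← abs_of_nonneg (norm_nonneg _), ← abs_of_nonneg (by positivity : 0 ≤ 2.83 * σ), ← sq_le_sq,
      ← Complex.normSq_eq_norm_sq, Complex.normSq_apply]
    have : s ^ 2 = 1 := by rw [← sq_abs, hs]; norm_num
    simp
    nlinarith
  set W := q - p with hW
  have hWe : W = 4 * σ + (q' - p') := by rw [hW, hp', hq']; ring
  have hWr : 3.8 * σ ≤ W.re := by rw [hWe]; simp; linarith [hp1.1, hp1.2, hq1.1, hq1.2]
  have hWi : |W.im| ≤ 0.2 * σ := by
    rw [hWe, abs_le]; simp; constructor <;> linarith [hp2.1, hp2.2, hq2.1, hq2.2]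
  have hWn : ‖W‖ ≤ 4.2 * σ := by
    rw [hWe]
    refine (norm_add_le _ _).trans ?_
    have := norm_sub_le q' p'
    rw [norm_mul, Complex.norm_real, Real.norm_eq_abs, abs_of_pos hσ]
    simp
    linarith
  have hW0 : 0 < ‖W‖ := lt_of_lt_of_le (by linarith) ((le_abs_self _).trans (Complex.abs_re_le_norm W))
  set κ : ℝ := ((u q - u p) * conj (Complex.I * W)).re / ‖W‖ ^ 2 with hκ
  set v : ℂ → ℂ := fun z => u z - (u p - κ * Complex.I * p) - κ * Complex.I * z with hv
  have hvq : ‖v q‖ ≤ L * ‖W‖ := by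
    have e0 : v q = (u q - u p) - κ * Complex.I * W := by simp only [hv, hW]; ring
    have hWW : Complex.normSq W = ‖W‖ ^ 2 := Complex.normSq_eq_norm_sq W
    have e1 : (v q * conj (Complex.I * W)).re = 0 := by
      have : (κ * Complex.I * W * conj (Complex.I * W)).re = κ * ‖W‖ ^ 2 := by
        rw [← hWW, Complex.normSq_apply]; simp; ring
      rw [e0, sub_mul, Complex.sub_re, this, hκ]
      field_simp
      ring
    have e2 : (v q * conj W).re = ((u q - u p) * conj W).re := by
      rw [e0, sub_mul, Complex.sub_re]
      have : (κ * Complex.I * W * conj W).re = 0 := by simp; ring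
      rw [this, sub_zero]
    have e3 := norm_mul_det_le (v := v q) (P := W) (Q := Complex.I * W) (α := L * ‖W‖ ^ 2) (β := 0)
      (e2 ▸ hpq) (by rw [e1, abs_zero])
    have e4 : (conj W * (Complex.I * W)).im = ‖W‖ ^ 2 := by
      rw [← hWW, Complex.normSq_apply]; simp
    rw [e4, abs_of_nonneg (by positivity), norm_mul, Complex.norm_I, one_mul] at e3
    have : 0 < ‖W‖ ^ 2 := by positivity
    exact le_of_mul_le_mul_right (by linarith) this
  refine ⟨κ, u p - κ * Complex.I * p, fun z hz h1 h2 => ?_⟩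
  change ‖v z‖ ≤ _
  rw [mem_ball_iff_norm] at hz
  have hz1 := abs_lt.1 ((Complex.abs_re_le_norm _).trans_lt hz)
  have hz2 := abs_lt.1 ((Complex.abs_im_le_norm _).trans_lt hz)
  have hrot : ∀ x : ℂ, (κ * Complex.I * x * conj x).re = 0 := fun x => by simp; ring
  have a1 : (v z * conj (z - p)).re = ((u z - u p) * conj (z - p)).re := by
    have : v z = (u z - u p) - κ * Complex.I * (z - p) := by simp only [hv]; ring
    rw [this, sub_mul, Complex.sub_re, hrot, sub_zero]
  have a2 : (v z * conj (z - q)).re = ((u z - u q) * conj (z - q)).re + (v q * conj (z - q)).re := by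
    have : v z = (u z - u q) - κ * Complex.I * (z - q) + v q := by simp only [hv]; ring
    rw [this, add_mul, sub_mul, Complex.add_re, Complex.sub_re, hrot, sub_zero]
  have dp : z - p = (z - z₀) - 2 * σ * ((-1 : ℝ) - Complex.I) - p' := by rw [hp']; push_cast; ring
  have dq : z - q = (z - z₀) - 2 * σ * ((1 : ℝ) - Complex.I) - q' := by rw [hq']; push_cast; ring
  have np : ‖z - p‖ ≤ 4 * σ := by
    rw [dp]
    refine (norm_sub_le _ _).trans ((add_le_add_left (norm_sub_le _ _) _).trans ?_)
    linarith [hnc (-1) (by norm_num)]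
  have nq : ‖z - q‖ ≤ 4 * σ := by
    rw [dq]
    refine (norm_sub_le _ _).trans ((add_le_add_left (norm_sub_le _ _) _).trans ?_)
    linarith [hnc 1 (by norm_num)]
  have hα : |(v z * conj (z - p)).re| ≤ 16 * L * σ ^ 2 := by
    rw [a1]
    refine h1.trans ?_
    have : ‖z - p‖ ^ 2 ≤ (4 * σ) ^ 2 := pow_le_pow_left₀ (norm_nonneg _) np 2
    nlinarith
  have hβ : |(v z * conj (z - q)).re| ≤ 33 * L * σ ^ 2 := by
    rw [a2]
    refine (abs_add_le _ _).trans ?_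
    have e1 : ‖z - q‖ ^ 2 ≤ (4 * σ) ^ 2 := pow_le_pow_left₀ (norm_nonneg _) nq 2
    have e2 : |(v q * conj (z - q)).re| ≤ (L * (4.2 * σ)) * (4 * σ) := by
      refine (Complex.abs_re_le_norm _).trans ?_
      rw [norm_mul, RCLike.norm_conj]
      exact mul_le_mul (hvq.trans (mul_le_mul_of_nonneg_left hWn hL)) nq (norm_nonneg _)
        (by positivity)
    nlinarith
  have hdet : 2.8 * σ ^ 2 ≤ |(conj (z - p) * (z - q)).im| := by
    have e1 : (conj (z - p) * (z - q)).im = (z - p).im * W.re - (z - p).re * W.im := by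
      have : z - q = (z - p) - W := by rw [hW]; ring
      rw [this]; simp; ring
    have i1 : 0.9 * σ ≤ (z - p).im := by
      rw [dp]; simp; simp at hz2; linarith [hz2.1, hp2.2]
    have i2 : |(z - p).re| ≤ 3.1 * σ := by
      rw [dp, abs_le]; simp; simp at hz1; constructor <;> linarith [hz1.1, hz1.2, hp1.1, hp1.2]
    have i3 : |(z - p).re * W.im| ≤ 3.1 * σ * (0.2 * σ) := by
      rw [abs_mul]; exact mul_le_mul i2 hWi (abs_nonneg _) (by positivity)
    have i4 : 0.9 * σ * (3.8 * σ) ≤ (z - p).im * W.re :=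
      mul_le_mul i1 hWr (by positivity) (by linarith)
    rw [e1]
    refine le_trans ?_ (le_abs_self _)
    linarith [le_abs_self ((z - p).re * W.im)]
  have := norm_mul_det_le hα hβ
  have t1 : 16 * L * σ ^ 2 * ‖z - q‖ ≤ 16 * L * σ ^ 2 * (4 * σ) :=
    mul_le_mul_of_nonneg_left nq (by positivity)
  have t2 : 33 * L * σ ^ 2 * ‖z - p‖ ≤ 33 * L * σ ^ 2 * (4 * σ) :=
    mul_le_mul_of_nonneg_left np (by positivity)
  have t3 := mul_le_mul_of_nonneg_left hdet (norm_nonneg (v z))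
  have hs2 : 0 < σ ^ 2 := by positivity
  have hLs : 0 ≤ L * σ ^ 2 * σ := by positivity
  refine le_of_mul_le_mul_right ?_ (by positivity : 0 < 2.8 * σ ^ 2)
  linarith

theorem exists_rigid_fit {Γ : Set ℂ} {u : ℂ → ℂ} {f : ℂ → ℝ≥0∞} (hP : PlanarData Γ u f)
    {e h R σ : ℝ} (he : 0 < e) (hhR : h ≤ R) (hσ : 0 < σ) (hσh : σ ≤ h / 32) {z₀ : ℂ}
    (hz₀ : volume {z | z ∈ Metric.ball z₀ (4 * σ) ∧ ¬ VeryGoodPt Γ f e h R z} ≤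
      ENNReal.ofReal (1 / 100 * σ ^ 2)) :
    ∃ (κ : ℝ) (b : ℂ), ∀ z ∈ Metric.ball z₀ σ, VeryGoodPt Γ f e h R z →
      ‖u z - b - κ * Complex.I * z‖ ≤ 8000000 * e * σ := by
  have hsub : ∀ s : ℝ, |s| = 1 → Metric.ball (z₀ + 2 * σ * (s - Complex.I)) (σ / 10) ⊆
      Metric.ball z₀ (3 * σ) := by
    intro s hs
    refine Metric.ball_subset_ball' ?_
    rw [dist_eq_norm, add_sub_cancel_left]
    have : ‖(2 * σ * (s - Complex.I) : ℂ)‖ ≤ 2.83 * σ := by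
      rw [← abs_of_nonneg (norm_nonneg _), ← abs_of_nonneg (by positivity : 0 ≤ 2.83 * σ),
        ← sq_le_sq, ← Complex.normSq_eq_norm_sq, Complex.normSq_apply]
      have : s ^ 2 = 1 := by rw [← sq_abs, hs]; norm_num
      simp
      nlinarith
    linarith
  have hex : ∀ s : ℝ, |s| = 1 → ∃ z ∈ Metric.ball (z₀ + 2 * σ * (s - Complex.I)) (σ / 10),
      VeryGoodPt Γ f e h R z := by
    intro s hs
    have h0 : volume {z | z ∈ Metric.ball (z₀ + 2 * σ * (s - Complex.I)) (σ / 10) ∧ ¬ True} ≤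
        ENNReal.ofReal 0 := by simp
    obtain ⟨z, h1, h2, -⟩ := exists_mem_ball_of_volume_le (by positivity)
      ((measure_mono fun z (hz : z ∈ Metric.ball (z₀ + 2 * σ * (s - Complex.I)) (σ / 10) ∧
        ¬ VeryGoodPt Γ f e h R z) => (⟨Metric.ball_subset_ball (by linarith) (hsub s hs hz.1), hz.2⟩ :
          z ∈ Metric.ball z₀ (4 * σ) ∧ ¬ VeryGoodPt Γ f e h R z)).trans hz₀) h0 h0 (by positivity)
      le_rfl le_rfl (by nlinarith [sq_pos_of_pos hσ])
    exact ⟨z, h1, h2⟩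
  obtain ⟨p, hp, hpV⟩ := hex (-1) (by norm_num)
  obtain ⟨q, hq, hqV⟩ := hex 1 (by norm_num)
  have hdist : ∀ x ∈ Metric.ball z₀ (3 * σ), ∀ y ∈ Metric.ball z₀ (3 * σ), ‖x - y‖ ≤ h / 4 := by
    intro x hx y hy
    rw [← dist_eq_norm]
    have := dist_triangle_right x y z₀
    rw [Metric.mem_ball] at hx hy
    linarith
  have hp3 := hsub _ (by norm_num) hp
  have hq3 := hsub _ (by norm_num) hq
  push_cast at hp hq
  obtain ⟨κ, b, hfit⟩ := exists_rigid_fit_of_triangle (u := u) (L := 80000 * e) (by positivity) hσ hp hq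
    (hpV.abs_re_le hP he hhR hqV (hdist _ hq3 _ hp3))
  refine ⟨κ, b, fun z hz hzV => ?_⟩
  have hz3 := Metric.ball_subset_ball (by linarith : σ ≤ 3 * σ) hz
  refine (hfit z hz (hpV.abs_re_le hP he hhR hzV (hdist _ hz3 _ hp3))
    (hqV.abs_re_le hP he hhR hzV (hdist _ hz3 _ hq3))).trans (le_of_eq (by ring))

/-- The infinitesimal rotation of a planar field. -/
def rot (u : ℂ → ℂ) (y : ℂ) : ℝ :=
  ((fderiv ℝ u y 1).im - (fderiv ℝ u y Complex.I).re) / 2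

theorem measurable_rot (u : ℂ → ℂ) : Measurable (rot u) := by
  unfold rot
  have h1 := (Complex.measurable_im.comp (measurable_fderiv_apply_const ℝ u 1))
  have h2 := (Complex.measurable_re.comp (measurable_fderiv_apply_const ℝ u Complex.I))
  exact (h1.sub h2).div_const 2

theorem det_complex_clm (T : ℂ →L[ℝ] ℂ) :
    T.det = (T 1).re * (T Complex.I).im - (T Complex.I).re * (T 1).im := by
  rw [ContinuousLinearMap.det, ← LinearMap.det_toMatrix Complex.basisOneI, Matrix.det_fin_two]
  simp [LinearMap.toMatrix_apply]

theorem sq_rot_sub_le_det {T : ℂ →L[ℝ] ℂ} {e L κ : ℝ} (hL : 2 * e ≤ L)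
    (hT : ∀ ζ : ℂ, |(T ζ * conj ζ).re| ≤ e * ‖ζ‖ ^ 2) :
    (((T 1).im - (T Complex.I).re) / 2 - κ) ^ 2 ≤
      ((3 * L) • ContinuousLinearMap.id ℝ ℂ + T -
        κ • (Complex.I • ContinuousLinearMap.id ℝ ℂ)).det := by
  rw [det_complex_clm]
  have h1 := hT 1
  have h2 := hT Complex.I
  have h3 := hT (1 + Complex.I)
  have hn : ‖(1 + Complex.I : ℂ)‖ ^ 2 = 2 := by
    rw [← Complex.normSq_eq_norm_sq, Complex.normSq_apply]; norm_num
  rw [hn] at h3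
  simp [abs_le, map_add] at h1 h2 h3 ⊢
  nlinarith

theorem lintegral_sq_rot_sub_le {Γ : Set ℂ} {u : ℂ → ℂ} {f : ℂ → ℝ≥0∞} (hP : PlanarData Γ u f)
    {e h R σ δ κ : ℝ} (he : 0 < e) (hhR : h ≤ R) (hσ : 0 < σ) (hσh : σ ≤ h / 32) {z₀ b : ℂ}
    {W : Set ℂ} (hWm : MeasurableSet W) (hWb : W ⊆ Metric.ball z₀ σ)
    (hWV : ∀ z ∈ W, VeryGoodPt Γ f e h R z) (hδ : 0 ≤ δ)
    (hfit : ∀ z ∈ W, ‖u z - b - κ * Complex.I * z‖ ≤ δ) :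
    ∫⁻ z in W, ENNReal.ofReal ((rot u z - κ) ^ 2) ≤
      ENNReal.ofReal (3.2 * (240000 * e * σ + δ) ^ 2) := by
  set L := 80000 * e with hL
  have hL0 : 0 < L := by positivity
  let Φ : ℂ → ℂ := fun z => (3 * L) • (z - z₀) + (u z - b - κ • (Complex.I • z))
  let D : ℂ → ℂ →L[ℝ] ℂ := fun z => (3 * L) • ContinuousLinearMap.id ℝ ℂ + fderiv ℝ u z -
        κ • (Complex.I • ContinuousLinearMap.id ℝ ℂ)
  have hfin : ∀ z ∈ W, f z ≠ ⊤ := fun z hz =>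
    ((hWV z hz).good.le.trans_lt ENNReal.ofReal_lt_top).ne
  have hD : ∀ z ∈ W, HasFDerivWithinAt Φ (D z) W z := by
    intro z hz
    have h1 : HasFDerivAt (fun z : ℂ => (3 * L) • (z - z₀)) ((3 * L) • ContinuousLinearMap.id ℝ ℂ) z :=
      ((hasFDerivAt_id z).sub_const z₀).const_smul (3 * L)
    have h2 := (hP.differentiableAt z (hfin z hz)).hasFDerivAt
    have h3 : HasFDerivAt (fun z : ℂ => κ • (Complex.I • z))
        (κ • (Complex.I • ContinuousLinearMap.id ℝ ℂ)) z :=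
      ((hasFDerivAt_id z).const_smul Complex.I).const_smul κ
    have := (h1.add ((h2.sub_const b).sub h3)).hasFDerivWithinAt (s := W)
    convert! this using 1
    simp only [D]; abel
  have hinj : InjOn Φ W := by
    intro z hz z' hz' heq
    by_contra hne
    have hd : ‖z - z'‖ ≤ h / 4 := by
      rw [← dist_eq_norm]
      have := dist_triangle_right z z' z₀
      have h1 := hWb hz
      have h2 := hWb hz'
      rw [Metric.mem_ball] at h1 h2
      linarith
    have hk := (abs_le.1 ((hWV z' hz').abs_re_le hP he hhR (hWV z hz) hd)).1
    have h0 : (u z - u z') = -((3 * L : ℝ) * (z - z')) + (κ : ℂ) * Complex.I * (z - z') := by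
      simp only [Φ, Complex.real_smul, smul_eq_mul] at heq
      linear_combination heq
    have h1 : ((u z - u z') * conj (z - z')).re = -(3 * L) * ‖z - z'‖ ^ 2 := by
      rw [h0, ← Complex.normSq_eq_norm_sq, Complex.normSq_apply]
      simp; ring
    rw [h1] at hk
    have : 0 < ‖z - z'‖ := norm_pos_iff.2 (sub_ne_zero.2 hne)
    have : 0 < L * ‖z - z'‖ ^ 2 := by positivity
    linarith
  have hsub : Φ '' W ⊆ Metric.closedBall 0 (240000 * e * σ + δ) := by
    rintro _ ⟨z, hz, rfl⟩
    rw [mem_closedBall_zero_iff]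
    refine (norm_add_le _ _).trans (add_le_add ?_ ?_)
    · rw [norm_smul, Real.norm_eq_abs, abs_of_pos (by positivity)]
      have := hWb hz
      rw [mem_ball_iff_norm] at this
      calc 3 * L * ‖z - z₀‖ ≤ 3 * L * σ := mul_le_mul_of_nonneg_left this.le (by positivity)
        _ = _ := by rw [hL]; ring
    · have := hfit z hz
      rwa [mul_assoc] at this
  calc ∫⁻ z in W, ENNReal.ofReal ((rot u z - κ) ^ 2)
      ≤ ∫⁻ z in W, ENNReal.ofReal |(D z).det| := by
        refine setLIntegral_mono' hWm fun z hz => ENNReal.ofReal_le_ofReal ?_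
        refine (sq_rot_sub_le_det (e := e) (L := L) (by linarith) fun ζ => ?_).trans (le_abs_self _)
        refine (hP.strain_le z (hfin z hz) ζ).trans ?_
        exact mul_le_mul_of_nonneg_right (ENNReal.toReal_le_of_le_ofReal he.le (hWV z hz).good.le)
          (by positivity)
    _ = volume (Φ '' W) := lintegral_abs_det_fderiv_eq_addHaar_image volume hWm hD hinj
    _ ≤ volume (Metric.closedBall (0 : ℂ) (240000 * e * σ + δ)) := measure_mono hsub
    _ ≤ _ := by
        rw [Measure.addHaar_closedBall_eq_addHaar_ball]
        exact volume_ball_le_ofReal _ (by positivity)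

theorem measurableSet_hit {Γ : Set ℂ} (hΓ : IsClosed Γ) (h : ℝ) :
    MeasurableSet {p : ℂ × ℂ | Hit Γ h p.2 p.1} := (isClosed_hit hΓ h).measurableSet

theorem measurableSet_two_hit {Γ : Set ℂ} (hΓ : IsClosed Γ) (h : ℝ) :
    MeasurableSet {p : ℂ × ℂ | Hit Γ h p.2 p.1 ∧ Hit Γ h (-p.2) p.1} :=
  (measurableSet_hit hΓ h).inter
    ((measurableSet_hit hΓ h).preimage (by fun_prop : Measurable fun p : ℂ × ℂ => (p.1, -p.2)))

theorem lintegral_volume_section {P : ℂ → ℂ → Prop} (hP : MeasurableSet {p : ℂ × ℂ | P p.1 p.2})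
    (A B : Set ℂ) :
    ∫⁻ y in A, volume {v | v ∈ B ∧ P y v} = ∫⁻ v in B, volume {y | y ∈ A ∧ P y v} := by
  have hs : MeasurableSet {p : ℂ × ℂ | P p.1 p.2} := hP
  have h1 := Measure.prod_apply (μ := volume.restrict A) (ν := volume.restrict B) hs
  have h2 := Measure.prod_apply_symm (μ := volume.restrict A) (ν := volume.restrict B) hs
  rw [h1] at h2
  convert h2 using 3 with y v
  · rw [Measure.restrict_apply (measurable_prodMk_left hs)]
    congr 1; ext v; exact and_comm
  · rw [Measure.restrict_apply (measurable_prodMk_right hs)]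
    congr 1; ext y; exact and_comm

theorem measurable_volume_section {P : ℂ → ℂ → Prop} (hP : MeasurableSet {p : ℂ × ℂ | P p.1 p.2})
    {B : Set ℂ} (hB : MeasurableSet B) : Measurable fun y => volume {v | v ∈ B ∧ P y v} :=
  measurable_measure_prodMk_left (ν := (volume : Measure ℂ))
    (s := {p : ℂ × ℂ | p.2 ∈ B ∧ P p.1 p.2}) ((measurable_snd hB).inter hP)

theorem measurable_hitMeas {Γ : Set ℂ} (hΓ : IsClosed Γ) (h : ℝ) : Measurable (hitMeas Γ h) :=
  measurable_volume_section (P := fun y v => Hit Γ h v y) (measurableSet_hit hΓ h)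
    measurableSet_ball

theorem measurable_twoHitMeas {Γ : Set ℂ} (hΓ : IsClosed Γ) (h : ℝ) :
    Measurable (twoHitMeas Γ h) :=
  measurable_volume_section (P := fun y v => Hit Γ h v y ∧ Hit Γ h (-v) y)
    (measurableSet_two_hit hΓ h) measurableSet_ball

theorem measurableSet_hit_left {Γ : Set ℂ} (hΓ : IsClosed Γ) (h : ℝ) (v : ℂ) :
    MeasurableSet {y | Hit Γ h v y} :=
  (measurableSet_hit hΓ h).preimage (by fun_prop : Measurable fun y : ℂ => (y, v))

theorem volume_two_hit_add {Γ : Set ℂ} (hΓ : IsClosed Γ) {R : ℝ} (hR : 0 ≤ R) (v : ℂ) :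
    volume {y | Hit Γ R v y ∧ Hit Γ R (-v) y} + volume {y | Hit Γ (2 * R) v y} =
      2 * volume {y | Hit Γ R v y} := by
  set F := {y | Hit Γ R v y} with hF
  have hB : MeasurableSet ((fun y : ℂ => y + R * v) ⁻¹' F) :=
    (measurableSet_hit_left hΓ R v).preimage (by fun_prop)
  have h1 := measure_union_add_inter (μ := volume) F hB
  have hv : volume ((fun y : ℂ => y + R * v) ⁻¹' F) = volume F := measure_preimage_add_right _ _ _
  have hu : F ∪ ((fun y : ℂ => y + R * v) ⁻¹' F) = {y | Hit Γ (2 * R) v y} := by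
    ext y
    constructor
    · rintro (⟨t, ht, hy⟩ | ⟨t, ht, hy⟩)
      · exact ⟨t, ⟨ht.1, by linarith [ht.2]⟩, hy⟩
      · refine ⟨R + t, ⟨by linarith [ht.1], by linarith [ht.2]⟩, ?_⟩
        convert hy using 1; push_cast; ring
    · rintro ⟨t, ht, hy⟩
      rcases le_total t R with h | h
      · exact Or.inl ⟨t, ⟨ht.1, h⟩, hy⟩
      · refine Or.inr ⟨t - R, ⟨by linarith, by linarith [ht.2]⟩, ?_⟩
        convert hy using 1; push_cast; ring
  have hi : F ∩ ((fun y : ℂ => y + R * v) ⁻¹' F) =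
      (fun y : ℂ => y + R * v) ⁻¹' {y | Hit Γ R v y ∧ Hit Γ R (-v) y} := by
    ext y
    have : Hit Γ R (-v) (y + R * v) ↔ Hit Γ R v y := by
      constructor
      · rintro ⟨t, ht, hy⟩
        refine ⟨R - t, ⟨by linarith [ht.2], by linarith [ht.1]⟩, ?_⟩
        convert hy using 1; push_cast; ring
      · rintro ⟨t, ht, hy⟩
        refine ⟨R - t, ⟨by linarith [ht.2], by linarith [ht.1]⟩, ?_⟩
        convert hy using 1; push_cast; ring
    simp only [hF, mem_inter_iff, mem_preimage, mem_ofPred_eq, this, and_comm]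
  have hvi : volume ((fun y : ℂ => y + R * v) ⁻¹' {y | Hit Γ R v y ∧ Hit Γ R (-v) y}) =
      volume {y | Hit Γ R v y ∧ Hit Γ R (-v) y} := measure_preimage_add_right _ _ _
  rw [hu, hi, hv, hvi] at h1
  rw [add_comm, h1, two_mul]

theorem lintegral_twoHitMeas_add {Γ : Set ℂ} (hΓ : IsClosed Γ) {R : ℝ} (hR : 0 ≤ R) :
    (∫⁻ y, twoHitMeas Γ R y) + ∫⁻ y, hitMeas Γ (2 * R) y = 2 * ∫⁻ y, hitMeas Γ R y := by
  have e1 := lintegral_volume_section (P := fun y v => Hit Γ R v y ∧ Hit Γ R (-v) y)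
    (measurableSet_two_hit hΓ R) univ (Metric.ball (0 : ℂ) 1)
  have e2 := fun r => lintegral_volume_section (P := fun y v => Hit Γ r v y)
    (measurableSet_hit hΓ r) univ (Metric.ball (0 : ℂ) 1)
  simp only [Measure.restrict_univ, mem_univ, true_and] at e1 e2
  unfold hitMeas twoHitMeas
  rw [e1, e2, e2, ← lintegral_const_mul', ← lintegral_add_right]
  · exact lintegral_congr fun v => volume_two_hit_add hΓ hR v
  · exact measurable_measure_prodMk_right (measurableSet_hit hΓ _)
  · simp

theorem nat_mul_volume_le_of_disjoint_translates {S B : Set ℂ} (hS : MeasurableSet S) (a : ℂ)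
    (n : ℕ) (hdisj : ∀ y ∈ S, ∀ j : ℕ, 0 < j → j < n → y + j * a ∉ S)
    (hB : ∀ y ∈ S, ∀ j : ℕ, j < n → y - j * a ∈ B) :
    n * volume S ≤ volume B := by
  have hpre : ∀ j : ℕ, volume ((fun y : ℂ => y + j * a) ⁻¹' S) = volume S :=
    fun j => measure_preimage_add_right _ _ _
  have h1 : volume (⋃ j ∈ Finset.range n, (fun y : ℂ => y + j * a) ⁻¹' S) =
      ∑ j ∈ Finset.range n, volume ((fun y : ℂ => y + j * a) ⁻¹' S) := by
    refine measure_biUnion_finset ?_ fun j _ => hS.preimage (by fun_prop)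
    have key : ∀ i j : ℕ, j < n → i < j →
        Disjoint ((fun y : ℂ => y + i * a) ⁻¹' S) ((fun y : ℂ => y + j * a) ⁻¹' S) := by
      intro i j hj hij
      rw [Set.disjoint_left]
      intro y hy hy'
      refine hdisj _ hy (j - i) (by omega) (by omega) ?_
      have : y + i * a + ((j - i : ℕ) : ℂ) * a = y + j * a := by
        rw [Nat.cast_sub hij.le]; ring
      rw [this]; exact hy'
    intro i hi j hj hij
    simp only [Finset.coe_range, mem_Iio] at hi hj
    rcases lt_or_gt_of_ne hij with h | h
    · exact key i j hj h
    · exact (key j i hi h).symm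
  simp only [hpre, Finset.sum_const, Finset.card_range, nsmul_eq_mul] at h1
  rw [← h1]
  refine measure_mono (iUnion₂_subset fun j hj y hy => ?_)
  have := hB _ hy j (Finset.mem_range.1 hj)
  simpa using this

theorem lintegral_hitMeas_le {Γ : Set ℂ} (hΓ : IsClosed Γ) {R h : ℝ} (hR : 0 < R) {n : ℕ}
    (hn : 0 < n) (hh : h = R / (2 * n)) (x : ℂ) :
    ∫⁻ y in Metric.ball x (12 * R), hitMeas Γ h y ≤
      (∫⁻ y in Metric.ball x (12 * R), twoHitMeas Γ R y) + ENNReal.ofReal (1800 / n * R ^ 2) := by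
  have hn' : (0 : ℝ) < n := by exact_mod_cast hn
  have hh0 : 0 < h := by rw [hh]; positivity
  have hnh : 2 * n * h = R := by rw [hh]; field_simp
  have hhR : h ≤ R := by
    have : (1 : ℝ) ≤ n := by exact_mod_cast hn
    nlinarith
  unfold hitMeas twoHitMeas
  rw [lintegral_volume_section (P := fun y v => Hit Γ h v y) (measurableSet_hit hΓ h) _ _,
    lintegral_volume_section (P := fun y v => Hit Γ R v y ∧ Hit Γ R (-v) y)
    (measurableSet_two_hit hΓ R) _ _]
  have key : ∀ v ∈ Metric.ball (0 : ℂ) 1,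
      volume {y | y ∈ Metric.ball x (12 * R) ∧ Hit Γ h v y} ≤
      volume {y | y ∈ Metric.ball x (12 * R) ∧ Hit Γ R v y ∧ Hit Γ R (-v) y} +
        ENNReal.ofReal (3.2 * 169 / n * R ^ 2) := by
    intro v hv
    rw [mem_ball_zero_iff] at hv
    set T := {y | y ∈ Metric.ball x (12 * R) ∧ Hit Γ h v y ∧ ¬ Hit Γ R (-v) y} with hT
    have hTm : MeasurableSet T := measurableSet_ball.inter
      ((measurableSet_hit_left hΓ h v).inter (measurableSet_hit_left hΓ R (-v)).compl)
    have h1 : {y | y ∈ Metric.ball x (12 * R) ∧ Hit Γ h v y} ⊆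
        {y | y ∈ Metric.ball x (12 * R) ∧ Hit Γ R v y ∧ Hit Γ R (-v) y} ∪ T := by
      rintro y ⟨hy, t, ht, hyt⟩
      by_cases hb : Hit Γ R (-v) y
      · exact Or.inl ⟨hy, ⟨t, ⟨ht.1, ht.2.trans hhR⟩, hyt⟩, hb⟩
      · exact Or.inr ⟨hy, ⟨t, ht, hyt⟩, hb⟩
    refine (measure_mono h1).trans ((measure_union_le _ _).trans (add_le_add le_rfl ?_))
    have h2 : (n : ℝ≥0∞) * volume T ≤ volume (Metric.ball x (13 * R)) := by
      refine nat_mul_volume_le_of_disjoint_translates hTm (2 * h * v) n ?_ ?_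
      · rintro y ⟨-, ⟨t, ht, hyt⟩, -⟩ j hj hjn ⟨-, -, hno⟩
        refine hno ⟨j * (2 * h) - t, ⟨?_, ?_⟩, ?_⟩
        · have : (1 : ℝ) ≤ j := by exact_mod_cast hj
          nlinarith [ht.2]
        · have : (j : ℝ) ≤ n := by exact_mod_cast hjn.le
          nlinarith [ht.1]
        · convert hyt using 1; push_cast; ring
      · rintro y ⟨hy, -⟩ j hj
        rw [mem_ball_iff_norm] at hy ⊢
        have e1 : ‖(j * (2 * h * v) : ℂ)‖ ≤ R := by
          rw [norm_mul, norm_mul, norm_mul, Complex.norm_natCast, Complex.norm_real,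
            Real.norm_eq_abs, abs_of_pos hh0]
          have : (j : ℝ) ≤ n := by exact_mod_cast hj.le
          have h3 : (j : ℝ) * (2 * h * ‖v‖) ≤ n * (2 * h * 1) := by gcongr
          simp
          linarith
        have : y - j * (2 * h * v) - x = (y - x) - j * (2 * h * v) := by ring
        rw [this]
        refine (norm_sub_le _ _).trans_lt ?_
        linarith
    have h3 := h2.trans (volume_ball_le_ofReal x (by positivity))
    have h4 : volume T ≤ ENNReal.ofReal (3.2 * (13 * R) ^ 2) / n := by
      rw [ENNReal.le_div_iff_mul_le (by left; exact_mod_cast hn.ne') (by left; simp), mul_comm]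
      exact h3
    refine h4.trans (le_of_eq ?_)
    rw [← ENNReal.ofReal_natCast, ← ENNReal.ofReal_div_of_pos hn']
    congr 1; ring
  refine (setLIntegral_mono' measurableSet_ball key).trans ?_
  rw [lintegral_add_right _ measurable_const]
  refine add_le_add le_rfl ?_
  rw [setLIntegral_const]
  refine (mul_le_mul_right (volume_ball_le_ofReal (0 : ℂ) zero_le_one) _).trans ?_
  rw [← ENNReal.ofReal_mul (by positivity)]
  refine ENNReal.ofReal_le_ofReal ?_
  have : 0 ≤ R ^ 2 / n := by positivity
  calc _ = 3.2 * 169 * 3.2 * (R ^ 2 / n) := by ring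
    _ ≤ 1800 * (R ^ 2 / n) := by gcongr; norm_num
    _ = _ := by ring

theorem exists_countable_disjoint_closedBall (Y : Set ℂ) (r : ℂ → ℝ) (R : ℝ)
    (hr : ∀ y ∈ Y, 0 < r y) (hR : ∀ y ∈ Y, r y ≤ R) :
    ∃ u ⊆ Y, u.Countable ∧ (u.PairwiseDisjoint fun y => Metric.closedBall y (r y)) ∧
      ∀ a ∈ Y, ∃ b ∈ u, dist a b ≤ r a + r b ∧ r a ≤ 2 * r b := by
  obtain ⟨u, hu, hd, hc⟩ := Vitali.exists_disjoint_subfamily_covering_enlargement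
    (fun y : ℂ => Metric.closedBall y (r y)) Y r 2 one_lt_two (fun y hy => (hr y hy).le) R hR
    (fun y hy => Metric.nonempty_closedBall.2 (hr y hy).le)
  refine ⟨u, hu, hd.countable_of_nonempty_interior fun y hy => ?_, hd, fun a ha => ?_⟩
  · exact ⟨y, Metric.ball_subset_interior_closedBall (Metric.mem_ball_self (hr y (hu hy)))⟩
  · obtain ⟨b, hb, ⟨z, hz1, hz2⟩, h2⟩ := hc a ha
    refine ⟨b, hb, ?_, h2⟩
    rw [Metric.mem_closedBall] at hz1 hz2
    exact (dist_triangle_left a b z).trans (add_le_add hz1 hz2)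

theorem volume_le_of_lt_measure_ball (μ : Measure ℂ) {Y B : Set ℂ} {t R : ℝ} (ht : 0 < t)
    (hY : ∀ y ∈ Y, ∃ r ∈ Ioo (0 : ℝ) R, ENNReal.ofReal (t * r ^ 2) < μ (Metric.ball y r))
    (hB : ∀ y ∈ Y, Metric.ball y R ⊆ B) :
    volume Y ≤ ENNReal.ofReal (80 / t) * μ B := by
  choose! r hr hμ using hY
  obtain ⟨u, hu, huc, hd, hcov⟩ := exists_countable_disjoint_closedBall Y r R
    (fun y hy => (hr y hy).1) (fun y hy => (hr y hy).2.le)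
  have hsub : Y ⊆ ⋃ b ∈ u, Metric.ball b (5 * r b) := by
    intro a ha
    obtain ⟨b, hb, h1, h2⟩ := hcov a ha
    refine mem_iUnion₂.2 ⟨b, hb, ?_⟩
    rw [Metric.mem_ball]
    have := (hr b (hu hb)).1
    linarith
  calc volume Y ≤ ∑' b : u, volume (Metric.ball (b : ℂ) (5 * r b)) :=
        (measure_mono hsub).trans (measure_biUnion_le _ huc _)
    _ ≤ ∑' b : u, ENNReal.ofReal (80 / t) * μ (Metric.closedBall (b : ℂ) (r b)) := by
        refine ENNReal.tsum_le_tsum fun b => ?_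
        have hb := hr b (hu b.2)
        refine (volume_ball_le_ofReal _ (by linarith [hb.1])).trans ?_
        refine le_trans ?_ (mul_le_mul_right ((hμ b (hu b.2)).le.trans
          (measure_mono Metric.ball_subset_closedBall)) _)
        rw [← ENNReal.ofReal_mul (by positivity)]
        refine ENNReal.ofReal_le_ofReal (le_of_eq ?_)
        field_simp; ring
    _ = ENNReal.ofReal (80 / t) * μ (⋃ b ∈ u, Metric.closedBall b (r b)) := by
        rw [ENNReal.tsum_mul_left, measure_biUnion huc hd fun b _ => measurableSet_closedBall]
    _ ≤ _ := by
        refine mul_le_mul_right (measure_mono (iUnion₂_subset fun b hb => ?_)) _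
        exact (Metric.closedBall_subset_ball (hr b (hu hb)).2).trans (hB b (hu hb))

theorem isOpen_setOf_lt_measure_ball (μ : Measure ℂ) (r : ℝ) (c : ℝ≥0∞) :
    IsOpen {y | c < μ (Metric.ball y r)} := by
  refine isOpen_iff_mem_nhds.2 fun y hy => ?_
  rw [mem_ofPred_eq] at hy
  have hU : Metric.ball y r = ⋃ n : ℕ, Metric.ball y (r - 1 / ((n : ℝ) + 1)) := by
    refine subset_antisymm (fun z hz => ?_) (iUnion_subset fun n => ?_)
    · rw [Metric.mem_ball] at hz
      obtain ⟨n, hn⟩ := exists_nat_one_div_lt (sub_pos.2 hz)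
      exact mem_iUnion.2 ⟨n, by rw [Metric.mem_ball]; linarith⟩
    · exact Metric.ball_subset_ball (by have : (0 : ℝ) ≤ 1 / ((n : ℝ) + 1) := by positivity
                                        linarith)
  have hmono : Monotone fun n : ℕ => Metric.ball y (r - 1 / ((n : ℝ) + 1)) := by
    intro m n hmn
    exact Metric.ball_subset_ball (by
      have := one_div_le_one_div_of_le (by positivity) (add_le_add_left (Nat.cast_le (α := ℝ).2 hmn) 1)
      linarith)
  rw [hU, hmono.measure_iUnion] at hy
  obtain ⟨n, hn⟩ := lt_iSup_iff.1 hy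
  filter_upwards [Metric.ball_mem_nhds y (show (0 : ℝ) < 1 / ((n : ℝ) + 1) by positivity)] with z hz
  refine hn.trans_le (measure_mono (Metric.ball_subset_ball' ?_))
  rw [Metric.mem_ball, dist_comm] at hz
  linarith

theorem isClosed_setOf_measure_ball_le (μ : Measure ℂ) (t R : ℝ) :
    IsClosed {y | ∀ r ∈ Ioo (0 : ℝ) R, μ (Metric.ball y r) ≤ ENNReal.ofReal (t * r ^ 2)} := by
  simp only [Set.ofPred_forall]
  refine isClosed_iInter fun r => isClosed_iInter fun _ => ?_
  simpa only [compl_ofPred, not_lt] using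
    (isOpen_setOf_lt_measure_ball μ r (ENNReal.ofReal (t * r ^ 2))).isClosed_compl

theorem measurableSet_goodPt {Γ : Set ℂ} (hΓ : IsClosed Γ) {f : ℂ → ℝ≥0∞} (hf : Measurable f)
    (e h R : ℝ) : MeasurableSet {y | GoodPt Γ f e h R y} := by
  have : {y | GoodPt Γ f e h R y} = ({y | hitMeas Γ h y ≤ ENNReal.ofReal (1 / 2000)} ∩
      {y | f y ≤ ENNReal.ofReal e}) ∩ {y | ∀ r ∈ Ioo (0 : ℝ) R,
        volume.withDensity f (Metric.ball y r) ≤ ENNReal.ofReal (e * r ^ 2)} := by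
    ext y
    simp only [mem_ofPred_eq, mem_inter_iff, withDensity_apply f measurableSet_ball]
    exact ⟨fun H => ⟨⟨H.1, H.2⟩, H.3⟩, fun H => ⟨H.1.1, H.1.2, H.2⟩⟩
  rw [this]
  exact ((measurableSet_le (measurable_hitMeas hΓ h) measurable_const).inter
    (measurableSet_le hf measurable_const)).inter
    (isClosed_setOf_measure_ball_le _ _ _).measurableSet

theorem measurableSet_veryGoodPt {Γ : Set ℂ} (hΓ : IsClosed Γ) {f : ℂ → ℝ≥0∞} (hf : Measurable f)
    (e h R : ℝ) : MeasurableSet {y | VeryGoodPt Γ f e h R y} := by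
  have : {y | VeryGoodPt Γ f e h R y} = {y | GoodPt Γ f e h R y} ∩ {y | ∀ r ∈ Ioo (0 : ℝ) h,
        volume.restrict {z | ¬ GoodPt Γ f e h R z} (Metric.ball y r) ≤
          ENNReal.ofReal (1 / 2000 * r ^ 2)} := by
    ext y
    simp only [mem_ofPred_eq, mem_inter_iff, Measure.restrict_apply measurableSet_ball]
    exact ⟨fun H => ⟨H.1, H.2⟩, fun H => ⟨H.1, H.2⟩⟩
  rw [this]
  exact (measurableSet_goodPt hΓ hf e h R).inter (isClosed_setOf_measure_ball_le _ _ _).measurableSet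

theorem volume_ge_le_of_setLIntegral_le {g : ℂ → ℝ≥0∞} (hg : Measurable g) {B : Set ℂ} {a b : ℝ}
    (ha : 0 < a) (h : ∫⁻ y in B, g y ≤ ENNReal.ofReal b) :
    volume {y | y ∈ B ∧ ENNReal.ofReal a ≤ g y} ≤ ENNReal.ofReal (b / a) := by
  have hm := meas_ge_le_lintegral_div (μ := volume.restrict B) hg.aemeasurable
    (ε := ENNReal.ofReal a) (by simpa using ha) ENNReal.ofReal_ne_top
  rw [Measure.restrict_apply (measurableSet_le measurable_const hg), inter_comm] at hm
  rw [ENNReal.ofReal_div_of_pos ha]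
  exact hm.trans (ENNReal.div_le_div_right h _)

theorem volume_not_goodPt_le {Γ : Set ℂ} (hΓ : IsClosed Γ) {f : ℂ → ℝ≥0∞} (hf : Measurable f)
    {e h R c g : ℝ} {n : ℕ} (he : 0 < e) (hR : 0 < R) (hn : 0 < n) (hh : h = R / (2 * n))
    (hc : 0 ≤ c) (hg : 0 ≤ g) {x : ℂ}
    (htwo : ∫⁻ y in Metric.ball x (12 * R), twoHitMeas Γ R y ≤ ENNReal.ofReal (c * R ^ 2))
    (hint : ∫⁻ y in Metric.ball x (12 * R), f y ≤ ENNReal.ofReal (g * R ^ 2)) :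
    volume {y | y ∈ Metric.ball x (11 * R) ∧ ¬ GoodPt Γ f e h R y} ≤
      ENNReal.ofReal ((2000 * (c + 1800 / n) + 81 * (g / e)) * R ^ 2) := by
  set B := Metric.ball x (12 * R) with hB
  have h1 : volume {y | y ∈ B ∧ ENNReal.ofReal (1 / 2000) ≤ hitMeas Γ h y} ≤
      ENNReal.ofReal (2000 * (c + 1800 / n) * R ^ 2) := by
    have hb := (lintegral_hitMeas_le hΓ hR hn hh x).trans (add_le_add_left htwo _)
    rw [← ENNReal.ofReal_add (by positivity) (by positivity)] at hb
    exact (volume_ge_le_of_setLIntegral_le (measurable_hitMeas hΓ h) (by norm_num) hb).trans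
      (ENNReal.ofReal_le_ofReal (le_of_eq (by ring)))
  have h2 : volume {y | y ∈ B ∧ ENNReal.ofReal e ≤ f y} ≤ ENNReal.ofReal (g / e * R ^ 2) :=
    (volume_ge_le_of_setLIntegral_le hf he hint).trans
      (ENNReal.ofReal_le_ofReal (le_of_eq (by ring)))
  have h3 : volume {y | y ∈ Metric.ball x (11 * R) ∧ ∃ r ∈ Ioo (0 : ℝ) R,
      ENNReal.ofReal (e * r ^ 2) < ∫⁻ z in Metric.ball y r, f z} ≤
      ENNReal.ofReal (80 * (g / e) * R ^ 2) := by
    refine (volume_le_of_lt_measure_ball (volume.withDensity f) (B := B) (R := R) he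
      (fun y hy => ?_) (fun y hy => ?_)).trans ?_
    · obtain ⟨r, hr, hlt⟩ := hy.2
      exact ⟨r, hr, by rwa [withDensity_apply f measurableSet_ball]⟩
    · refine Metric.ball_subset_ball' ?_
      have := hy.1
      rw [Metric.mem_ball] at this
      linarith
    · rw [withDensity_apply f measurableSet_ball]
      refine (mul_le_mul_right hint _).trans ?_
      rw [← ENNReal.ofReal_mul (by positivity)]
      exact ENNReal.ofReal_le_ofReal (le_of_eq (by ring))
  have hsub : {y | y ∈ Metric.ball x (11 * R) ∧ ¬ GoodPt Γ f e h R y} ⊆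
      ({y | y ∈ B ∧ ENNReal.ofReal (1 / 2000) ≤ hitMeas Γ h y} ∪
      {y | y ∈ B ∧ ENNReal.ofReal e ≤ f y}) ∪ {y | y ∈ Metric.ball x (11 * R) ∧ ∃ r ∈ Ioo (0 : ℝ) R,
      ENNReal.ofReal (e * r ^ 2) < ∫⁻ z in Metric.ball y r, f z} := by
    rintro y ⟨hy, hng⟩
    have hyB : y ∈ B := Metric.ball_subset_ball (by linarith) hy
    by_contra hcon
    simp only [mem_union, mem_ofPred_eq, not_or, not_and, not_exists, not_le, not_lt] at hcon
    exact hng ⟨(hcon.1.1 hyB).le, (hcon.1.2 hyB).le, fun r hr => hcon.2 hy r hr⟩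
  refine (measure_mono hsub).trans ((measure_union_le _ _).trans
    ((add_le_add ((measure_union_le _ _).trans (add_le_add h1 h2)) h3).trans ?_))
  rw [← ENNReal.ofReal_add (by positivity) (by positivity),
    ← ENNReal.ofReal_add (by positivity) (by positivity)]
  exact ENNReal.ofReal_le_ofReal (le_of_eq (by ring))

theorem volume_not_veryGoodPt_le {Γ : Set ℂ} {f : ℂ → ℝ≥0∞} 
    {e h R ε : ℝ} (hR : 0 < R) (hhR : h ≤ R) (hε : 0 ≤ ε) {x : ℂ}
    (hG : volume {y | y ∈ Metric.ball x (11 * R) ∧ ¬ GoodPt Γ f e h R y} ≤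
      ENNReal.ofReal (ε * R ^ 2)) :
    volume {y | y ∈ Metric.ball x (10 * R) ∧ ¬ VeryGoodPt Γ f e h R y} ≤
      ENNReal.ofReal (160001 * ε * R ^ 2) := by
  have h3 : volume {y | y ∈ Metric.ball x (10 * R) ∧ ∃ r ∈ Ioo (0 : ℝ) h,
      ENNReal.ofReal (1 / 2000 * r ^ 2) < volume {z | z ∈ Metric.ball y r ∧ ¬ GoodPt Γ f e h R z}} ≤
      ENNReal.ofReal (160000 * ε * R ^ 2) := by
    refine (volume_le_of_lt_measure_ball (volume.restrict {z | ¬ GoodPt Γ f e h R z})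
      (B := Metric.ball x (11 * R)) (R := h) (t := 1 / 2000) (by norm_num)
      (fun y hy => ?_) (fun y hy => ?_)).trans ?_
    · obtain ⟨r, hr, hlt⟩ := hy.2
      exact ⟨r, hr, by rwa [Measure.restrict_apply measurableSet_ball]⟩
    · refine Metric.ball_subset_ball' ?_
      have := hy.1
      rw [Metric.mem_ball] at this
      linarith
    · rw [Measure.restrict_apply measurableSet_ball]
      refine (mul_le_mul_right hG _).trans ?_
      rw [← ENNReal.ofReal_mul (by positivity)]
      exact ENNReal.ofReal_le_ofReal (le_of_eq (by ring))
  have hsub : {y | y ∈ Metric.ball x (10 * R) ∧ ¬ VeryGoodPt Γ f e h R y} ⊆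
      {y | y ∈ Metric.ball x (11 * R) ∧ ¬ GoodPt Γ f e h R y} ∪
      {y | y ∈ Metric.ball x (10 * R) ∧ ∃ r ∈ Ioo (0 : ℝ) h,
      ENNReal.ofReal (1 / 2000 * r ^ 2) < volume {z | z ∈ Metric.ball y r ∧ ¬ GoodPt Γ f e h R z}} := by
    rintro y ⟨hy, hng⟩
    have hyB : y ∈ Metric.ball x (11 * R) := Metric.ball_subset_ball (by linarith) hy
    by_contra hcon
    simp only [mem_union, mem_ofPred_eq, not_or, not_and, not_exists, not_not, not_lt] at hcon
    exact hng ⟨hcon.1 hyB, fun r hr => hcon.2 hy r hr⟩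
  refine (measure_mono hsub).trans ((measure_union_le _ _).trans ((add_le_add hG h3).trans ?_))
  rw [← ENNReal.ofReal_add (by positivity) (by positivity)]
  exact ENNReal.ofReal_le_ofReal (le_of_eq (by ring))

theorem lintegral_volume_ball_inter (A S : Set ℂ) (σ : ℝ) :
    ∫⁻ z in A, volume {v | v ∈ S ∧ v ∈ Metric.ball z σ} =
      ∫⁻ v in S, volume {z | z ∈ A ∧ z ∈ Metric.ball v σ} := by
  have hP : MeasurableSet {p : ℂ × ℂ | p.2 ∈ Metric.ball p.1 σ} := by
    simp only [Metric.mem_ball]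
    exact measurableSet_lt (by fun_prop) measurable_const
  rw [lintegral_volume_section (P := fun z v => v ∈ Metric.ball z σ) hP]
  simp only [Metric.mem_ball_comm]

theorem measurable_volume_ball_inter {S : Set ℂ} (hS : MeasurableSet S) (σ : ℝ) :
    Measurable fun z => volume {v | v ∈ S ∧ v ∈ Metric.ball z σ} := by
  have hP : MeasurableSet {p : ℂ × ℂ | p.2 ∈ Metric.ball p.1 σ} := by
    simp only [Metric.mem_ball]
    exact measurableSet_lt (by fun_prop) measurable_const
  exact measurable_volume_section (P := fun z v => v ∈ Metric.ball z σ) hP hS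

theorem lintegral_volume_ball_inter_le (A S : Set ℂ) {σ : ℝ} (hσ : 0 ≤ σ) :
    ∫⁻ z in A, volume {v | v ∈ S ∧ v ∈ Metric.ball z σ} ≤
      ENNReal.ofReal (3.2 * σ ^ 2) * volume S := by
  rw [lintegral_volume_ball_inter, ← setLIntegral_const]
  exact lintegral_mono fun v => (measure_mono fun z hz => hz.2).trans (volume_ball_le_ofReal v hσ)

theorem le_lintegral_volume_ball_inter {A S : Set ℂ} (hS : MeasurableSet S) {σ : ℝ} (hσ : 0 ≤ σ)
    (hSA : ∀ v ∈ S, Metric.ball v σ ⊆ A) :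
    ENNReal.ofReal (3 * σ ^ 2) * volume S ≤
      ∫⁻ z in A, volume {v | v ∈ S ∧ v ∈ Metric.ball z σ} := by
  rw [lintegral_volume_ball_inter, ← setLIntegral_const]
  refine setLIntegral_mono' hS fun v hv => ?_
  exact (ofReal_mul_sq_le_volume_ball v hσ).trans (measure_mono fun z hz => ⟨hSA v hv hz, hz⟩)

/-- Centers around which most points are very good at scale `4 * σ`. -/
def GoodCenter (Γ : Set ℂ) (f : ℂ → ℝ≥0∞) (e h R σ : ℝ) (z₀ : ℂ) : Prop :=
  volume {z | z ∈ Metric.ball z₀ (4 * σ) ∧ ¬ VeryGoodPt Γ f e h R z} ≤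
    ENNReal.ofReal (1 / 100 * σ ^ 2)

/-- The infinitesimal rigid motion `b + κ * I * z` approximates `u` at the very good points near
`z₀`. -/
def IsFit (Γ : Set ℂ) (u : ℂ → ℂ) (f : ℂ → ℝ≥0∞) (e h R σ : ℝ) (z₀ : ℂ) (κ : ℝ) (b : ℂ) : Prop :=
  ∀ z ∈ Metric.ball z₀ σ, VeryGoodPt Γ f e h R z →
    ‖u z - b - κ * Complex.I * z‖ ≤ 8000000 * e * σ

theorem volume_not_goodCenter_le {Γ : Set ℂ} (hΓ : IsClosed Γ) {f : ℂ → ℝ≥0∞} (hf : Measurable f)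
    {e h R σ ε : ℝ} (hσ : 0 < σ) (hσR : 4 * σ ≤ R) {x : ℂ}
    (hV : volume {y | y ∈ Metric.ball x (10 * R) ∧ ¬ VeryGoodPt Γ f e h R y} ≤
      ENNReal.ofReal (ε * R ^ 2)) :
    volume {y | y ∈ Metric.ball x (9 * R) ∧ ¬ GoodCenter Γ f e h R σ y} ≤
      ENNReal.ofReal (5120 * ε * R ^ 2) := by
  set S := {y | y ∈ Metric.ball x (10 * R) ∧ ¬ VeryGoodPt Γ f e h R y} with hS
  have hSm : MeasurableSet S :=
    measurableSet_ball.inter (measurableSet_veryGoodPt hΓ hf e h R).compl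
  have h1 := (lintegral_volume_ball_inter_le (Metric.ball x (9 * R)) S
    (σ := 4 * σ) (by positivity)).trans (mul_le_mul_right hV _)
  rw [← ENNReal.ofReal_mul (by positivity)] at h1
  have h2 := volume_ge_le_of_setLIntegral_le (measurable_volume_ball_inter hSm (4 * σ))
    (a := 1 / 100 * σ ^ 2) (by positivity) h1
  refine (measure_mono ?_).trans (h2.trans (ENNReal.ofReal_le_ofReal (le_of_eq ?_)))
  · intro y hy
    refine ⟨hy.1, (lt_of_not_ge hy.2).le.trans (measure_mono fun z hz => ⟨⟨?_, hz.2⟩, hz.1⟩)⟩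
    refine Metric.ball_subset_ball' ?_ hz.1
    have := hy.1
    rw [Metric.mem_ball] at this
    linarith
  · field_simp; ring

theorem measurableSet_goodCenter {Γ : Set ℂ} (hΓ : IsClosed Γ) {f : ℂ → ℝ≥0∞} (hf : Measurable f)
    (e h R σ : ℝ) : MeasurableSet {z | GoodCenter Γ f e h R σ z} := by
  refine measurableSet_le ?_ measurable_const
  simp only [and_comm]
  exact measurable_volume_ball_inter (S := {z | ¬ VeryGoodPt Γ f e h R z})
    (measurableSet_veryGoodPt hΓ hf e h R).compl (4 * σ)

theorem volume_lt_rot_le {Γ : Set ℂ} {u : ℂ → ℂ} {f : ℂ → ℝ≥0∞} (hP : PlanarData Γ u f)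
    {h R σ ε γ s s₁ r : ℝ} (hγ : 0 < γ) (hs : 0 < s) (hhR : h ≤ R) (hσ : 0 < σ) (hσh : σ ≤ h / 32)
    (hε : 0 ≤ ε) (hr8 : r ≤ 8) {x : ℂ}
    (hV : volume {y | y ∈ Metric.ball x (10 * R) ∧ ¬ VeryGoodPt Γ f (γ * s) h R y} ≤
      ENNReal.ofReal (ε * R ^ 2))
    (hκ : ∀ z₀ ∈ Metric.ball x ((r + 1) * R), GoodCenter Γ f (γ * s) h R σ z₀ →
      ∀ κ b, IsFit Γ u f (γ * s) h R σ z₀ κ b → |κ| ≤ s₁) :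
    volume {y | y ∈ Metric.ball x (r * R) ∧ s₁ + s / 4 < |rot u y|} ≤
      ENNReal.ofReal ((310000000000000000 * γ ^ 2 + 5463 * ε) * R ^ 2) := by
  have hR : 0 < R := by linarith
  set S := {y | (y ∈ Metric.ball x (r * R) ∧ s₁ + s / 4 < |rot u y|) ∧
    VeryGoodPt Γ f (γ * s) h R y} with hSdef
  have hSm : MeasurableSet S :=
    (measurableSet_ball.inter (measurableSet_lt measurable_const
      (measurable_rot u).abs)).inter (measurableSet_veryGoodPt hP.isClosed hP.measurable _ h R)
  set A := Metric.ball x ((r + 1) * R) with hA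
  set N := {y | y ∈ Metric.ball x (9 * R) ∧ ¬ GoodCenter Γ f (γ * s) h R σ y} with hN
  have hNm : MeasurableSet N :=
    measurableSet_ball.inter (measurableSet_goodCenter hP.isClosed hP.measurable _ h R σ).compl
  have hNv : volume N ≤ ENNReal.ofReal (5120 * ε * R ^ 2) :=
    volume_not_goodCenter_le hP.isClosed hP.measurable hσ (by linarith) hV
  have hloc : ∀ z ∈ A, volume {v | v ∈ S ∧ v ∈ Metric.ball z σ} ≤
      ENNReal.ofReal (3480000000000000 * γ ^ 2 * σ ^ 2) +
        N.indicator (fun _ => ENNReal.ofReal (3.2 * σ ^ 2)) z := by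
    intro z hz
    by_cases hg : GoodCenter Γ f (γ * s) h R σ z
    · refine le_add_right ?_
      obtain ⟨κ, b, hfit⟩ := exists_rigid_fit hP (mul_pos hγ hs) hhR hσ hσh hg
      have hk := hκ z hz hg κ b hfit
      set W := {v | v ∈ S ∧ v ∈ Metric.ball z σ} with hW
      have hWm : MeasurableSet W := hSm.inter measurableSet_ball
      have hint := lintegral_sq_rot_sub_le hP (mul_pos hγ hs) hhR hσ hσh hWm (fun v hv => hv.2)
        (fun v hv => hv.1.2) (δ := 8000000 * (γ * s) * σ) (by positivity)
        (fun v hv => hfit v hv.2 hv.1.2)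
      have hmk := volume_ge_le_of_setLIntegral_le
        (by have := measurable_rot u; fun_prop) (a := (s / 4) ^ 2) (by positivity) hint
      refine (measure_mono ?_).trans (hmk.trans (ENNReal.ofReal_le_ofReal ?_))
      · intro v hv
        refine ⟨hv, ENNReal.ofReal_le_ofReal ?_⟩
        have h1 := hv.1.1.2
        have h2 : s / 4 ≤ |rot u v - κ| := by
          have := abs_sub_abs_le_abs_sub (rot u v) κ
          linarith
        calc (s / 4) ^ 2 ≤ |rot u v - κ| ^ 2 := by gcongr
          _ = _ := sq_abs _
      · rw [div_le_iff₀ (by positivity)]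
        have : 0 ≤ (γ * s * σ) ^ 2 := by positivity
        nlinarith only [this]
    · refine le_add_left ?_
      have hzN : z ∈ N := by
        refine ⟨Metric.ball_subset_ball ?_ hz, hg⟩
        nlinarith only [hr8, hR]
      rw [indicator_of_mem hzN]
      exact (measure_mono fun v hv => hv.2).trans (volume_ball_le_ofReal z hσ.le)
  have hSA : ∀ v ∈ S, Metric.ball v σ ⊆ A := by
    intro v hv
    refine Metric.ball_subset_ball' ?_
    have := hv.1.1
    rw [Metric.mem_ball] at this
    linarith
  have h1 := (le_lintegral_volume_ball_inter hSm hσ.le hSA).trans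
    (setLIntegral_mono' measurableSet_ball hloc)
  rw [lintegral_add_left measurable_const, setLIntegral_const, lintegral_indicator hNm,
    setLIntegral_const] at h1
  have hAv : volume A ≤ ENNReal.ofReal (3.2 * (9 * R) ^ 2) :=
    (measure_mono (Metric.ball_subset_ball (by nlinarith only [hr8, hR]))).trans
      (volume_ball_le_ofReal x (by positivity))
  have h2 : ENNReal.ofReal (3 * σ ^ 2) * volume S ≤ ENNReal.ofReal (3 * σ ^ 2) *
      ENNReal.ofReal ((310000000000000000 * γ ^ 2 + 5462 * ε) * R ^ 2) := by
    refine h1.trans ((add_le_add (mul_le_mul_right hAv _) (mul_le_mul_right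
      ((Measure.restrict_apply_le _ _).trans hNv) _)).trans ?_)
    rw [← ENNReal.ofReal_mul (by positivity), ← ENNReal.ofReal_mul (by positivity),
      ← ENNReal.ofReal_mul (by positivity), ← ENNReal.ofReal_add (by positivity) (by positivity)]
    refine ENNReal.ofReal_le_ofReal ?_
    have e1 : 0 ≤ γ ^ 2 * σ ^ 2 * R ^ 2 := by positivity
    have e2 : 0 ≤ ε * σ ^ 2 * R ^ 2 := by positivity
    nlinarith only [e1, e2]
  rw [ENNReal.mul_le_mul_iff_right (by simpa using hσ.ne') ENNReal.ofReal_ne_top] at h2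
  have hsub : {y | y ∈ Metric.ball x (r * R) ∧ s₁ + s / 4 < |rot u y|} ⊆
      S ∪ {y | y ∈ Metric.ball x (10 * R) ∧ ¬ VeryGoodPt Γ f (γ * s) h R y} := by
    intro y hy
    by_cases hv : VeryGoodPt Γ f (γ * s) h R y
    · exact Or.inl ⟨hy, hv⟩
    · exact Or.inr ⟨Metric.ball_subset_ball (by nlinarith only [hr8, hR]) hy.1, hv⟩
  refine (measure_mono hsub).trans ((measure_union_le _ _).trans ((add_le_add h2 hV).trans ?_))
  rw [← ENNReal.ofReal_add (by positivity) (by positivity)]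
  exact ENNReal.ofReal_le_ofReal (le_of_eq (by ring))

theorem volume_strip_le {d : ℂ} (hd : d ≠ 0) (y z₀ : ℂ) {σ : ℝ} (hσ : 0 < σ) :
    volume {z | z ∈ Metric.ball z₀ σ ∧ |(conj d * (z - y)).im| < σ / 100 * ‖d‖} ≤
      ENNReal.ofReal (0.256 * σ ^ 2) := by
  have hd' : 0 < ‖d‖ := norm_pos_iff.2 hd
  set a : ℂ := ((2 * (σ / 100) / ‖d‖ : ℝ) : ℂ) * (Complex.I * d) with ha
  have him : (conj d * a).im = 2 * (σ / 100) * ‖d‖ := by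
    have : conj d * a = ((2 * (σ / 100) / ‖d‖ * ‖d‖ ^ 2 : ℝ) : ℂ) * Complex.I := by
      rw [ha]
      push_cast
      rw [← Complex.mul_conj']
      ring
    rw [this, Complex.mul_I_im, Complex.ofReal_re]
    field_simp
  have hna : ‖a‖ = σ / 50 := by
    rw [ha, norm_mul, norm_mul, Complex.norm_I, Complex.norm_real, Real.norm_of_nonneg (by positivity)]
    field_simp; norm_num
  have := nat_mul_volume_le_of_disjoint_translates
    (S := {z | z ∈ Metric.ball z₀ σ ∧ |(conj d * (z - y)).im| < σ / 100 * ‖d‖})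
    (B := Metric.ball z₀ (2 * σ)) (measurableSet_ball.inter
      (measurableSet_lt (f := fun z : ℂ => |(conj d * (z - y)).im|)
        (Continuous.measurable (by fun_prop)) measurable_const)) a 50 ?_ ?_
  · have h2 := this.trans (volume_ball_le_ofReal z₀ (by positivity))
    rw [show ENNReal.ofReal (3.2 * (2 * σ) ^ 2) =
      ((50 : ℕ) : ℝ≥0∞) * ENNReal.ofReal (0.256 * σ ^ 2) by
      rw [← ENNReal.ofReal_natCast, ← ENNReal.ofReal_mul (by positivity)]
      congr 1; push_cast; ring] at h2
    exact (ENNReal.mul_le_mul_iff_right (by simp) (by simp)).1 h2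
  · rintro z ⟨_, hz⟩ j hj _ ⟨_, hz'⟩
    have e : (conj d * (z + j * a - y)).im = (conj d * (z - y)).im +
        j * (2 * (σ / 100) * ‖d‖) := by
      rw [← him]
      rw [show conj d * (z + j * a - y) = conj d * (z - y) + j * (conj d * a) by ring,
        Complex.add_im, ← Complex.ofReal_natCast, Complex.im_ofReal_mul]
    rw [e] at hz'
    have h1 := (abs_lt.1 hz).1
    have h2 := (abs_lt.1 hz').2
    have hj1 : (1 : ℝ) ≤ j := by exact_mod_cast hj
    have : 0 < σ / 100 * ‖d‖ := by positivity
    nlinarith only [h1, h2, hj1, this]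
  · rintro z ⟨hz, _⟩ j hj
    rw [Metric.mem_ball] at hz ⊢
    have hj1 : (j : ℝ) ≤ 49 := by exact_mod_cast Nat.le_of_lt_succ hj
    have : dist (z - j * a) z ≤ 49 * (σ / 50) := by
      rw [dist_eq_norm, sub_sub_cancel_left, norm_neg, norm_mul, hna, Complex.norm_natCast]
      gcongr
    linarith [dist_triangle (z - j * a) z z₀]

theorem GoodPt.le_volume_sees {Γ : Set ℂ} {f : ℂ → ℝ≥0∞} (hf : Measurable f) {e h R : ℝ}
    (he : 0 < e) (hR : 0 < R) {y : ℂ} (hy : GoodPt Γ f e h R y)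
    (hy2 : twoHitMeas Γ R y ≤ ENNReal.ofReal (1 / 100)) :
    ENNReal.ofReal (1.4945 * R ^ 2) ≤
      volume {z | z ∈ Metric.ball y R ∧ Sees Γ f (2000 * e) y z} := by
  set N := {v : ℂ | v ∈ Metric.ball 0 1 ∧ ¬ Hit Γ R v y} with hN
  have hNfin : volume N ≠ ⊤ := (lt_of_le_of_lt (measure_mono fun v hv => hv.1)
    (measure_ball_lt_top (x := (0 : ℂ)) (r := 1))).ne
  have hN' : ENNReal.ofReal 1.495 ≤ volume N := by
    have hsub : Metric.ball (0 : ℂ) 1 ⊆ ({v | v ∈ Metric.ball 0 1 ∧ Hit Γ R v y ∧ Hit Γ R (-v) y} ∪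
        N) ∪ (Neg.neg ⁻¹' N) := by
      intro v hv
      by_contra hcon
      simp only [hN, mem_union, mem_preimage, mem_ofPred_eq, not_or, not_and, not_not] at hcon
      refine hcon.1.1 hv (hcon.1.2 hv) (hcon.2 ?_)
      simpa using hv
    have h1 := (ofReal_mul_sq_le_volume_ball 0 zero_le_one).trans ((measure_mono hsub).trans
      ((measure_union_le _ _).trans (add_le_add_left (measure_union_le _ _) _)))
    rw [Measure.measure_preimage_neg] at h1
    have h2 := h1.trans (add_le_add_left (add_le_add_left hy2 _) _)
    rw [← ENNReal.ofReal_toReal hNfin] at h2 ⊢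
    rw [← ENNReal.ofReal_add (by positivity) (by positivity),
      ← ENNReal.ofReal_add (by positivity) (by positivity),
      ENNReal.ofReal_le_ofReal_iff (by positivity)] at h2
    exact ENNReal.ofReal_le_ofReal (by linarith)
  have hseg := lintegral_segment_le hf hy.avg_le hR le_rfl
  have hmk := volume_ge_le_of_setLIntegral_le ?_ (a := 2000 * e) (by positivity) hseg
  · have hsub : (fun v => y + (R : ℂ) * v) '' N ⊆
        {z | z ∈ Metric.ball y R ∧ Sees Γ f (2000 * e) y z} ∪ {z | z ∈ Metric.ball y R ∧
          ENNReal.ofReal (2000 * e) ≤ ∫⁻ t in Icc (0 : ℝ) 1, f (y + t * (z - y))} := by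
      rintro _ ⟨v, ⟨hv, hhit⟩, rfl⟩
      have hvb : y + (R : ℂ) * v ∈ Metric.ball y R := by
        rw [mem_ball_zero_iff] at hv
        rw [Metric.mem_ball, dist_eq_norm, add_sub_cancel_left, norm_mul, Complex.norm_real,
          Real.norm_of_nonneg hR.le]
        nlinarith
      by_cases hl : ENNReal.ofReal (2000 * e) ≤
          ∫⁻ t in Icc (0 : ℝ) 1, f (y + t * ((y + (R : ℂ) * v) - y))
      · exact Or.inr ⟨hvb, hl⟩
      · refine Or.inl ⟨hvb, fun t ht hmem => hhit ⟨t * R, ⟨?_, ?_⟩, ?_⟩, (lt_of_not_ge hl).le⟩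
        · exact mul_nonneg ht.1 hR.le
        · nlinarith [ht.2]
        · convert hmem using 1
          push_cast; ring
    have h1 := (measure_mono hsub).trans ((measure_union_le _ _).trans (add_le_add_right hmk _))
    rw [volume_image_homothety N y hR] at h1
    have h2 := (mul_le_mul_right hN' _).trans h1
    rw [← ENNReal.ofReal_mul (by positivity)] at h2
    refine ENNReal.le_of_add_le_add_right (ENNReal.ofReal_ne_top) (le_trans ?_ h2)
    rw [← ENNReal.ofReal_add (by positivity) (by positivity)]
    refine ENNReal.ofReal_le_ofReal (le_of_eq ?_)
    field_simp; ring
  · refine Measurable.lintegral_prod_right' (f := fun p : ℂ × ℝ => f (y + p.2 * (p.1 - y))) ?_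
    exact hf.comp (by fun_prop)

theorem measurableSet_sees {Γ : Set ℂ} (hΓ : IsClosed Γ) {f : ℂ → ℝ≥0∞} (hf : Measurable f)
    (A : ℝ) : MeasurableSet {p : ℂ × ℂ | Sees Γ f A p.1 p.2} := by
  have h1 : MeasurableSet {p : ℂ × ℂ | ¬ Hit Γ 1 (p.2 - p.1) p.1} :=
    ((measurableSet_hit hΓ 1).preimage (by fun_prop : Measurable fun p : ℂ × ℂ =>
      (p.1, p.2 - p.1))).compl
  have h2 : Measurable fun p : ℂ × ℂ => ∫⁻ t in Icc (0 : ℝ) 1, f (p.1 + t * (p.2 - p.1)) := by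
    refine Measurable.lintegral_prod_right'
      (f := fun q : (ℂ × ℂ) × ℝ => f (q.1.1 + q.2 * (q.1.2 - q.1.1))) ?_
    exact hf.comp (by fun_prop)
  have : {p : ℂ × ℂ | Sees Γ f A p.1 p.2} = {p : ℂ × ℂ | ¬ Hit Γ 1 (p.2 - p.1) p.1} ∩
      {p | ∫⁻ t in Icc (0 : ℝ) 1, f (p.1 + t * (p.2 - p.1)) ≤ ENNReal.ofReal A} := by
    ext p
    simp only [Sees, Hit, mem_ofPred_eq, mem_inter_iff, not_exists, not_and]
  rw [this]
  exact h1.inter (measurableSet_le h2 measurable_const)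

theorem norm_sub_rigid_le {Γ : Set ℂ} {u : ℂ → ℂ} {f : ℂ → ℝ≥0∞} (hP : PlanarData Γ u f)
    {e σ τ L : ℝ} (he : 0 ≤ e) {y y' z b : ℂ} {κ : ℝ} (hτ : 0 ≤ τ)
    (hy : ‖u y - b - κ * Complex.I * y‖ ≤ τ) (hy' : ‖u y' - b - κ * Complex.I * y'‖ ≤ τ)
    (hs : Sees Γ f e y z) (hs' : Sees Γ f e y' z) (hL : ‖z - y‖ ≤ L) (hL' : ‖z - y'‖ ≤ L)
    (hne : z ≠ y) (hdet : σ * ‖z - y‖ ≤ |(conj (z - y) * (z - y')).im|) :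
    ‖u z - b - κ * Complex.I * z‖ * σ ≤ 2 * L * (e * L + τ) := by
  have key : ∀ w, ‖u w - b - κ * Complex.I * w‖ ≤ τ → Sees Γ f e w z → ‖z - w‖ ≤ L →
      |((u z - b - κ * Complex.I * z) * conj (z - w)).re| ≤ (e * L + τ) * ‖z - w‖ := by
    intro w hw hsw hLw
    have h1 := hP.abs_re_le he hsw
    have h2 : |((u w - b - κ * Complex.I * w) * conj (z - w)).re| ≤ τ * ‖z - w‖ := by
      refine (Complex.abs_re_le_norm _).trans ?_
      rw [norm_mul, Complex.norm_conj]
      gcongr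
    have h3 : (κ * Complex.I * (z - w) * conj (z - w)).re = 0 := by
      rw [mul_assoc, Complex.mul_conj, mul_assoc, mul_comm Complex.I, ← mul_assoc,
        ← Complex.ofReal_mul, Complex.mul_I_re, Complex.ofReal_im, neg_zero]
    have h4 : (u z - b - κ * Complex.I * z) * conj (z - w) = (u z - u w) * conj (z - w) +
        (u w - b - κ * Complex.I * w) * conj (z - w) - κ * Complex.I * (z - w) * conj (z - w) := by
      ring
    rw [h4, Complex.sub_re, h3, sub_zero, Complex.add_re]
    refine (abs_add_le _ _).trans ((add_le_add h1 h2).trans ?_)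
    have : e * ‖z - w‖ * ‖z - w‖ ≤ e * L * ‖z - w‖ := by gcongr
    nlinarith only [this]
  have hd := norm_mul_det_le (key y hy hs hL) (key y' hy' hs' hL')
  have hpos : 0 < ‖z - y‖ := norm_pos_iff.2 (sub_ne_zero.2 hne)
  have hL0 : 0 ≤ L := hpos.le.trans hL
  refine le_of_mul_le_mul_right ?_ hpos
  calc ‖u z - b - κ * Complex.I * z‖ * σ * ‖z - y‖ =
      ‖u z - b - κ * Complex.I * z‖ * (σ * ‖z - y‖) := by ring
    _ ≤ ‖u z - b - κ * Complex.I * z‖ * |(conj (z - y) * (z - y')).im| := by gcongr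
    _ ≤ _ := hd
    _ = 2 * ‖z - y'‖ * (e * L + τ) * ‖z - y‖ := by ring
    _ ≤ _ := by gcongr

theorem norm_sub_rigid_le_of_volume_sees {Γ : Set ℂ} {u : ℂ → ℂ} {f : ℂ → ℝ≥0∞}
    (hP : PlanarData Γ u f) {e h R σ κ : ℝ} {n : ℕ} (hn : 0 < n) (he : 0 < e) (hR : 0 < R)
    (hσ : σ = R / (64 * n)) {z₀ b z : ℂ} {A : Set ℂ}
    (hfit : IsFit Γ u f e h R σ z₀ κ b) (hA : A ⊆ Metric.ball z₀ σ)
    (hAV : ∀ y ∈ A, VeryGoodPt Γ f e h R y)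
    (hz : z ∈ Metric.ball z₀ (R + σ))
    (hsee : ENNReal.ofReal (0.3 * σ ^ 2) ≤ volume {y | y ∈ A ∧ Sees Γ f (2000 * e) y z}) :
    ‖u z - b - κ * Complex.I * z‖ ≤ 120000000000 * n ^ 2 * e * σ := by
  have hn' : (1 : ℝ) ≤ n := by exact_mod_cast hn
  have hσ0 : 0 < σ := by rw [hσ]; positivity
  have hRσ : R = 64 * n * σ := by rw [hσ]; field_simp
  have hσR : 64 * σ ≤ R := by rw [hRσ]; nlinarith
  have hdist : ∀ y ∈ A, ‖z - y‖ ≤ 1.1 * R := by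
    intro y hy
    have h1 := hA hy
    rw [Metric.mem_ball] at h1 hz
    rw [← dist_eq_norm]
    linarith [dist_triangle_right z y z₀]
  have hnonempty : {y | y ∈ A ∧ Sees Γ f (2000 * e) y z}.Nonempty := by
    by_contra hcon
    rw [not_nonempty_iff_eq_empty.1 hcon, measure_empty, nonpos_iff_eq_zero,
      ENNReal.ofReal_eq_zero] at hsee
    nlinarith
  obtain ⟨y, hyA, hy⟩ := hnonempty
  by_cases hzy : z = y
  · rw [hzy]
    refine (hfit y (hA hyA) (hAV y hyA)).trans ?_
    have : e * σ ≤ n ^ 2 * (e * σ) :=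
      le_mul_of_one_le_left (by positivity) (one_le_pow₀ hn')
    nlinarith [mul_pos he hσ0]
  obtain ⟨y', ⟨hyA', hy'⟩, hdet⟩ : ∃ y' ∈ {y | y ∈ A ∧ Sees Γ f (2000 * e) y z},
      σ / 100 * ‖z - y‖ ≤ |(conj (z - y) * (z - y')).im| := by
    by_contra! hcon
    have hs := volume_strip_le (sub_ne_zero.2 hzy) z z₀ hσ0
    have h1 := hsee.trans ((measure_mono fun y' hy' => ?_).trans hs)
    · rw [ENNReal.ofReal_le_ofReal_iff (by positivity)] at h1
      nlinarith
    · refine ⟨hA hy'.1, ?_⟩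
      have := hcon y' hy'
      rwa [← abs_neg, ← Complex.neg_im, ← mul_neg, neg_sub] at this
  have key := norm_sub_rigid_le hP (by positivity) (by positivity) (hfit y (hA hyA) (hAV y hyA))
    (hfit y' (hA hyA') (hAV y' hyA')) hy hy' (hdist y hyA) (hdist y' hyA') hzy hdet
  refine le_of_mul_le_mul_right (key.trans ?_) (show (0 : ℝ) < σ / 100 by positivity)
  have e1 : n * (e * σ ^ 2) ≤ n ^ 2 * (e * σ ^ 2) := by
    have : (n : ℝ) ≤ n ^ 2 := by nlinarith
    gcongr
  have e2 : 0 ≤ n ^ 2 * (e * σ ^ 2) := by positivity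
  rw [hRσ]
  nlinarith only [e1, e2]

theorem le_volume_lt_rot {Γ : Set ℂ} {u : ℂ → ℂ} {f : ℂ → ℝ≥0∞}
    (hP : PlanarData Γ u f) {γ s h R σ κ : ℝ} {n : ℕ} (hn : 0 < n) (hγ : 0 < γ) (hs : 0 < s)
    (hγn : n ^ 2 * γ ≤ 1 / 10000000000000) (hR : 0 < R) (hh : h = R / (2 * n))
    (hσ : σ = R / (64 * n)) {z₀ b : ℂ}
    (hV : volume {y | y ∈ Metric.ball z₀ (4 * R) ∧ ¬ VeryGoodPt Γ f (γ * s) h R y} ≤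
      ENNReal.ofReal (1 / 1000 * R ^ 2))
    (hg : GoodCenter Γ f (γ * s) h R σ z₀)
    (htw : ∫⁻ y in Metric.ball z₀ σ, twoHitMeas Γ R y ≤ ENNReal.ofReal (1 / 10000 * σ ^ 2))
    (hfit : IsFit Γ u f (γ * s) h R σ z₀ κ b) (hκ : s ≤ |κ|) :
    ENNReal.ofReal (1 / 2 * R ^ 2) ≤
      volume {y | y ∈ Metric.ball z₀ (2 * R) ∧ s / 2 < |rot u y|} := by
  have hn' : (1 : ℝ) ≤ n := by exact_mod_cast hn
  have hσ0 : 0 < σ := by rw [hσ]; positivity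
  have hRσ : R = 64 * n * σ := by rw [hσ]; field_simp
  have hσR : 64 * σ ≤ R := by rw [hRσ]; nlinarith
  have hσh : σ ≤ h / 32 := by rw [hσ, hh]; apply le_of_eq; field_simp; norm_num
  have hhR : h ≤ R := by rw [hh]; exact div_le_self hR.le (by linarith)
  have he : 0 < γ * s := by positivity
  set e := γ * s with hedef
  have hVm := measurableSet_veryGoodPt hP.isClosed hP.measurable e h R
  have htm := measurable_twoHitMeas hP.isClosed R
  set A := {y | y ∈ Metric.ball z₀ σ ∧ VeryGoodPt Γ f e h R y ∧
    twoHitMeas Γ R y ≤ ENNReal.ofReal (1 / 100)} with hA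
  have hAm : MeasurableSet A :=
    measurableSet_ball.inter (hVm.inter (measurableSet_le htm measurable_const))
  have hAv : ENNReal.ofReal (2.98 * σ ^ 2) ≤ volume A := by
    have hsub : Metric.ball z₀ σ ⊆ (A ∪ {z | z ∈ Metric.ball z₀ (4 * σ) ∧
        ¬ VeryGoodPt Γ f e h R z}) ∪ {y | y ∈ Metric.ball z₀ σ ∧
          ENNReal.ofReal (1 / 100) ≤ twoHitMeas Γ R y} := by
      intro y hy
      by_cases h1 : VeryGoodPt Γ f e h R y
      · by_cases h2 : ENNReal.ofReal (1 / 100) ≤ twoHitMeas Γ R y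
        · exact Or.inr ⟨hy, h2⟩
        · exact Or.inl (Or.inl ⟨hy, h1, (lt_of_not_ge h2).le⟩)
      · exact Or.inl (Or.inr ⟨Metric.ball_subset_ball (by linarith) hy, h1⟩)
    have h1 := (ofReal_mul_sq_le_volume_ball z₀ hσ0.le).trans ((measure_mono hsub).trans
      ((measure_union_le _ _).trans (add_le_add ((measure_union_le _ _).trans
        (add_le_add_right hg _)) (volume_ge_le_of_setLIntegral_le htm (by norm_num) htw))))
    rw [add_assoc, ← ENNReal.ofReal_add (by positivity) (by positivity)] at h1
    refine ENNReal.le_of_add_le_add_right ENNReal.ofReal_ne_top (le_trans ?_ h1)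
    rw [← ENNReal.ofReal_add (by positivity) (by positivity)]
    exact ENNReal.ofReal_le_ofReal (le_of_eq (by ring))
  set Y := {z | z ∈ Metric.ball z₀ (R + σ) ∧ VeryGoodPt Γ f e h R z} with hY
  have hYm : MeasurableSet Y := measurableSet_ball.inter hVm
  have hT1 : ∀ y ∈ A, ENNReal.ofReal (1.49 * R ^ 2) ≤
      volume {z | z ∈ Y ∧ Sees Γ f (2000 * e) y z} := by
    intro y hy
    have h0 := hy.2.1.good.le_volume_sees hP.measurable he hR hy.2.2
    have hsub : {z | z ∈ Metric.ball y R ∧ Sees Γ f (2000 * e) y z} ⊆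
        {z | z ∈ Y ∧ Sees Γ f (2000 * e) y z} ∪
        {y | y ∈ Metric.ball z₀ (4 * R) ∧ ¬ VeryGoodPt Γ f e h R y} := by
      rintro z ⟨hz, hzs⟩
      have hz1 : z ∈ Metric.ball z₀ (R + σ) := by
        have := hy.1
        rw [Metric.mem_ball] at this hz ⊢
        linarith [dist_triangle z y z₀]
      by_cases h1 : VeryGoodPt Γ f e h R z
      · exact Or.inl ⟨⟨hz1, h1⟩, hzs⟩
      · exact Or.inr ⟨Metric.ball_subset_ball (by linarith) hz1, h1⟩
    have h1 := h0.trans ((measure_mono hsub).trans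
      ((measure_union_le _ _).trans (add_le_add_right hV _)))
    refine ENNReal.le_of_add_le_add_right ENNReal.ofReal_ne_top (le_trans ?_ h1)
    rw [← ENNReal.ofReal_add (by positivity) (by positivity)]
    exact ENNReal.ofReal_le_ofReal (by nlinarith)
  have hSm := measurableSet_sees hP.isClosed hP.measurable (2000 * e)
  have hsm : Measurable fun z => volume {y | y ∈ A ∧ Sees Γ f (2000 * e) y z} :=
    measurable_volume_section (P := fun z y => Sees Γ f (2000 * e) y z)
      (hSm.preimage measurable_swap) hAm
  set Z := {z | z ∈ Y ∧ ENNReal.ofReal (0.3 * σ ^ 2) ≤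
    volume {y | y ∈ A ∧ Sees Γ f (2000 * e) y z}} with hZ
  have hZm : MeasurableSet Z := hYm.inter (measurableSet_le measurable_const hsm)
  have hZv : ENNReal.ofReal (1.07 * R ^ 2) ≤ volume Z := by
    have hup : ∀ z ∈ Y, volume {y | y ∈ A ∧ Sees Γ f (2000 * e) y z} ≤
        ENNReal.ofReal (0.3 * σ ^ 2) +
          Z.indicator (fun _ => ENNReal.ofReal (3.2 * σ ^ 2)) z := by
      intro z hz
      by_cases h1 : z ∈ Z
      · refine le_add_left ?_
        rw [indicator_of_mem h1]
        exact (measure_mono fun y hy => hy.1.1).trans (volume_ball_le_ofReal z₀ hσ0.le)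
      · refine le_add_right (lt_of_not_ge fun h2 => h1 ⟨hz, h2⟩).le
    have h1 := setLIntegral_mono' (μ := volume) hAm hT1
    rw [setLIntegral_const, lintegral_volume_section hSm] at h1
    have h2 := h1.trans (setLIntegral_mono' hYm hup)
    rw [lintegral_add_left measurable_const, setLIntegral_const, lintegral_indicator hZm,
      setLIntegral_const] at h2
    have hYv : volume Y ≤ ENNReal.ofReal (3.2 * (R + σ) ^ 2) :=
      (measure_mono fun z hz => hz.1).trans (volume_ball_le_ofReal z₀ (by positivity))
    have h3 := (mul_le_mul_right hAv _).trans (h2.trans (add_le_add (mul_le_mul_right hYv _)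
      (mul_le_mul_right (Measure.restrict_apply_le Y Z) _)))
    rw [← ENNReal.ofReal_mul (by positivity), ← ENNReal.ofReal_mul (by positivity)] at h3
    have h4 : ENNReal.ofReal (3.2 * σ ^ 2) * ENNReal.ofReal (1.07 * R ^ 2) ≤
        ENNReal.ofReal (3.2 * σ ^ 2) * volume Z := by
      refine ENNReal.le_of_add_le_add_left (ENNReal.ofReal_ne_top
        (r := 0.3 * σ ^ 2 * (3.2 * (R + σ) ^ 2))) (le_trans ?_ h3)
      rw [← ENNReal.ofReal_mul (by positivity), ← ENNReal.ofReal_add (by positivity) (by positivity)]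
      refine ENNReal.ofReal_le_ofReal ?_
      have : (R + σ) ^ 2 ≤ (1.016 * R) ^ 2 := by gcongr; linarith
      have := mul_le_mul_of_nonneg_left this (sq_nonneg σ)
      nlinarith only [this, mul_nonneg (sq_nonneg σ) (sq_nonneg R)]
    exact (ENNReal.mul_le_mul_iff_right (ENNReal.ofReal_pos.2 (by positivity)).ne'
      ENNReal.ofReal_ne_top).1 h4
  have hZfit : ∀ z ∈ Z, ‖u z - b - κ * Complex.I * z‖ ≤ 120000000000 * n ^ 2 * e * σ := fun z hz =>
    norm_sub_rigid_le_of_volume_sees hP hn he hR hσ hfit (fun y hy => hy.1)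
      (fun y hy => hy.2.1) hz.1.1 hz.2
  have hrm : MeasurableSet {y | |rot u y| ≤ s / 2} :=
    measurableSet_le (measurable_rot u).abs measurable_const
  set Z' := Z ∩ {y | |rot u y| ≤ s / 2} with hZ'
  have hZ'm : MeasurableSet Z' := hZm.inter hrm
  have hloc : ∀ z ∈ Metric.ball z₀ (2 * R), volume {v | v ∈ Z' ∧ v ∈ Metric.ball z σ} ≤
      ENNReal.ofReal (0.003 * σ ^ 2) := by
    intro z _
    set W := {v | v ∈ Z' ∧ v ∈ Metric.ball z σ} with hW
    have hWm : MeasurableSet W := hZ'm.inter measurableSet_ball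
    have hint := lintegral_sq_rot_sub_le hP he hhR hσ0 hσh hWm (fun v hv => hv.2)
      (fun v hv => hv.1.1.1.2) (by positivity) (fun v hv => hZfit v hv.1.1)
    have hmk := volume_ge_le_of_setLIntegral_le
      (by have := measurable_rot u; fun_prop) (a := (s / 2) ^ 2) (by positivity) hint
    refine (measure_mono ?_).trans (hmk.trans (ENNReal.ofReal_le_ofReal ?_))
    · intro v hv
      refine ⟨hv, ENNReal.ofReal_le_ofReal ?_⟩
      have h1 : |rot u v| ≤ s / 2 := hv.1.2
      have h2 : s / 2 ≤ |rot u v - κ| := by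
        have := abs_sub_abs_le_abs_sub κ (rot u v)
        rw [abs_sub_comm] at this
        linarith
      calc (s / 2) ^ 2 ≤ |rot u v - κ| ^ 2 := by gcongr
        _ = _ := sq_abs _
    · rw [div_le_iff₀ (by positivity)]
      have e1 : 240000 * e * σ + 120000000000 * n ^ 2 * e * σ ≤ 0.0130 * (s * σ) := by
        have : γ ≤ n ^ 2 * γ := le_mul_of_one_le_left hγ.le (one_le_pow₀ hn')
        have h1 : e * σ ≤ n ^ 2 * γ * (s * σ) := by
          rw [hedef]
          nlinarith only [this, mul_le_mul_of_nonneg_right this (mul_pos hs hσ0).le]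
        have h2 : n ^ 2 * γ * (s * σ) ≤ 1 / 10000000000000 * (s * σ) := by gcongr
        have h3 : (n : ℝ) ^ 2 * e * σ = n ^ 2 * γ * (s * σ) := by rw [hedef]; ring
        nlinarith only [h1, h2, h3, mul_pos hs hσ0]
      have e2 : 0 ≤ 240000 * e * σ + 120000000000 * n ^ 2 * e * σ := by positivity
      have e3 := pow_le_pow_left₀ e2 e1 2
      nlinarith only [e3, sq_nonneg (s * σ)]
  have hZ'v : volume Z' ≤ ENNReal.ofReal (0.02 * R ^ 2) := by
    have h1 := (le_lintegral_volume_ball_inter hZ'm hσ0.le (A := Metric.ball z₀ (2 * R))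
      (fun v hv => ?_)).trans (setLIntegral_mono' measurableSet_ball hloc)
    · rw [setLIntegral_const] at h1
      have h2 := h1.trans (mul_le_mul_right (volume_ball_le_ofReal z₀ (by positivity)) _)
      rw [← ENNReal.ofReal_mul (by positivity)] at h2
      have h3 : ENNReal.ofReal (3 * σ ^ 2) * volume Z' ≤
          ENNReal.ofReal (3 * σ ^ 2) * ENNReal.ofReal (0.02 * R ^ 2) := by
        refine h2.trans ?_
        rw [← ENNReal.ofReal_mul (by positivity)]
        refine ENNReal.ofReal_le_ofReal ?_
        nlinarith only [mul_nonneg (sq_nonneg σ) (sq_nonneg R)]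
      exact (ENNReal.mul_le_mul_iff_right (by simpa using hσ0.ne') ENNReal.ofReal_ne_top).1 h3
    · refine Metric.ball_subset_ball' ?_
      have := hv.1.1.1
      rw [Metric.mem_ball] at this
      linarith
  have hsub : Z ⊆ {y | y ∈ Metric.ball z₀ (2 * R) ∧ s / 2 < |rot u y|} ∪ Z' := by
    intro z hz
    by_cases h1 : |rot u z| ≤ s / 2
    · exact Or.inr ⟨hz, h1⟩
    · exact Or.inl ⟨Metric.ball_subset_ball (by linarith) hz.1.1, lt_of_not_ge h1⟩
  have h1 := hZv.trans ((measure_mono hsub).trans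
    ((measure_union_le _ _).trans (add_le_add_right hZ'v _)))
  refine ENNReal.le_of_add_le_add_right ENNReal.ofReal_ne_top (le_trans ?_ h1)
  rw [← ENNReal.ofReal_add (by positivity) (by positivity)]
  exact ENNReal.ofReal_le_ofReal (by nlinarith)

theorem volume_not_veryGoodPt_le_of_small {Γ : Set ℂ} (hΓ : IsClosed Γ) {f : ℂ → ℝ≥0∞}
    (hf : Measurable f) {s R : ℝ} (hs : 0 < s) (hR : 0 < R) {x : ℂ}
    (htwo : ∫⁻ y in Metric.ball x (12 * R), twoHitMeas Γ R y ≤ ENNReal.ofReal (1 / 10 ^ 50 * R ^ 2))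
    (hint : ∫⁻ y in Metric.ball x (12 * R), f y ≤ ENNReal.ofReal (144 / 10 ^ 74 * s * R ^ 2)) :
    volume {y | y ∈ Metric.ball x (10 * R) ∧
      ¬ VeryGoodPt Γ f (1 / 10 ^ 55 * s) (R / (2 * (10 ^ 21 : ℕ))) R y} ≤
      ENNReal.ofReal (1 / 10 ^ 9 * R ^ 2) := by
  have h1 := volume_not_goodPt_le hΓ hf (e := 1 / 10 ^ 55 * s) (n := 10 ^ 21) (by positivity) hR
    (by positivity) rfl (by positivity) (by positivity) htwo hint
  have h2 := volume_not_veryGoodPt_le hR (div_le_self hR.le (by norm_num)) (by positivity) h1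
  refine h2.trans (ENNReal.ofReal_le_ofReal ?_)
  have : 144 / 10 ^ 74 * s / (1 / 10 ^ 55 * s) = 144 / 10 ^ 19 := by field_simp
  rw [this]
  gcongr
  norm_num

theorem volume_two_mul_lt_rot_le {Γ : Set ℂ} {u : ℂ → ℂ} {f : ℂ → ℝ≥0∞} (hP : PlanarData Γ u f)
    {s R : ℝ} (hs : 0 < s) (hR : 0 < R) {x : ℂ}
    (htwo : ∫⁻ y in Metric.ball x (12 * R), twoHitMeas Γ R y ≤ ENNReal.ofReal (1 / 10 ^ 50 * R ^ 2))
    (hint : ∫⁻ y in Metric.ball x (12 * R), f y ≤ ENNReal.ofReal (144 / 10 ^ 74 * s * R ^ 2))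
    (hsmall : volume {y | y ∈ Metric.ball x (8 * R) ∧ s / 2 < |rot u y|} <
      ENNReal.ofReal (1 / 2 * R ^ 2)) :
    volume {y | y ∈ Metric.ball x (5 * R) ∧ 2 * s < |rot u y|} ≤
      ENNReal.ofReal (1 / 2 ^ 14 * R ^ 2) := by
  have hV := volume_not_veryGoodPt_le_of_small hP.isClosed hP.measurable hs hR htwo hint
  have hσ : R / (64 * (10 ^ 21 : ℕ)) ≤ R / (2 * (10 ^ 21 : ℕ)) / 32 := by
    apply le_of_eq; push_cast; ring
  have hE := volume_lt_rot_le hP (σ := R / (64 * (10 ^ 21 : ℕ))) (by positivity) hs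
    (div_le_self hR.le (by norm_num)) (by positivity) hσ (by positivity) (r := 5) (by norm_num) hV
    (s₁ := s) ?_
  · refine (measure_mono ?_).trans (hE.trans (ENNReal.ofReal_le_ofReal ?_))
    · rintro y ⟨hy, hy2⟩
      exact ⟨hy, by linarith⟩
    · gcongr
      norm_num
  · intro z₀ hz₀ hg κ b hfit
    by_contra! hκ
    rw [Metric.mem_ball] at hz₀
    have hV' : volume {y | y ∈ Metric.ball z₀ (4 * R) ∧
        ¬ VeryGoodPt Γ f (1 / 10 ^ 55 * s) (R / (2 * (10 ^ 21 : ℕ))) R y} ≤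
        ENNReal.ofReal (1 / 1000 * R ^ 2) := by
      refine (measure_mono ?_).trans (hV.trans (ENNReal.ofReal_le_ofReal ?_))
      · rintro y ⟨hy, hy2⟩
        exact ⟨Metric.ball_subset_ball' (by linarith) hy, hy2⟩
      · gcongr; norm_num
    refine hsmall.not_ge ((le_volume_lt_rot hP (by positivity) (by positivity) hs (by norm_num) hR
      rfl rfl hV' hg ((lintegral_mono_set ?_).trans (htwo.trans (ENNReal.ofReal_le_ofReal ?_))) hfit
      hκ.le).trans (measure_mono ?_))
    · refine Metric.ball_subset_ball' ?_
      have : R / (64 * (10 ^ 21 : ℕ)) ≤ R := div_le_self hR.le (by norm_num)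
      linarith
    · have e : 1 / 10000 * (R / (64 * (10 ^ 21 : ℕ))) ^ 2 =
        (1 / 10000 * (1 / (64 * (10 ^ 21 : ℕ))) ^ 2) * R ^ 2 := by ring
      rw [e]
      gcongr
      norm_num
    · rintro y ⟨hy, hy2⟩
      exact ⟨Metric.ball_subset_ball' (by linarith) hy, hy2⟩

theorem abs_le_of_isFit {Γ : Set ℂ} {u : ℂ → ℂ} {f : ℂ → ℝ≥0∞} (hP : PlanarData Γ u f)
    {M : ℝ} (hM : ∀ y ∉ Γ, ‖u y‖ ≤ M) {e h R σ κ : ℝ} (hσ : 0 < σ) {z₀ b : ℂ}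
    (hg : GoodCenter Γ f e h R σ z₀) (hfit : IsFit Γ u f e h R σ z₀ κ b) :
    |κ| * (1.2 * σ) ≤ 2 * M + 16000000 * e * σ := by
  have hpt : ∀ w : ℂ, ‖w‖ ≤ 0.7 * σ → ∃ p ∈ Metric.ball (z₀ + w) (σ / 10),
      VeryGoodPt Γ f e h R p ∧ p ∈ Metric.ball z₀ σ := by
    intro w hw
    have hsub : ∀ r, r ≤ 3 * σ → Metric.ball (z₀ + w) r ⊆ Metric.ball z₀ (4 * σ) := fun r hr =>
      Metric.ball_subset_ball' (by rw [dist_eq_norm, add_sub_cancel_left]; linarith)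
    have hbad : volume {z | z ∈ Metric.ball (z₀ + w) (σ / 10) ∧ ¬ VeryGoodPt Γ f e h R z} ≤
        ENNReal.ofReal (1 / 100 * σ ^ 2) := by
      refine (measure_mono ?_).trans hg
      rintro z ⟨hz, hz2⟩
      exact ⟨hsub _ (by linarith) hz, hz2⟩
    obtain ⟨p, hp, hpV, -, -⟩ := exists_mem_ball_of_volume_le (c := z₀ + w) (r := σ / 10)
      (P := VeryGoodPt Γ f e h R) (Q := fun _ => True) (S := fun _ => True)
      (a₁ := 1 / 100 * σ ^ 2) (a₂ := 0) (a₃ := 0)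
      (by positivity) hbad
      (by simp) (by simp) (by positivity) le_rfl le_rfl (by nlinarith)
    refine ⟨p, hp, hpV, Metric.ball_subset_ball' ?_ hp⟩
    rw [dist_eq_norm, add_sub_cancel_left]; linarith
  have hn : ‖((0.7 * σ : ℝ) : ℂ)‖ = 0.7 * σ := by
    rw [Complex.norm_real, Real.norm_of_nonneg (by positivity)]
  obtain ⟨p, hp, hpV, hpb⟩ := hpt (-((0.7 * σ : ℝ) : ℂ)) (by rw [norm_neg, hn])
  obtain ⟨q, hq, hqV, hqb⟩ := hpt ((0.7 * σ : ℝ) : ℂ) hn.le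
  have hΓ : ∀ y, VeryGoodPt Γ f e h R y → ‖u y‖ ≤ M := fun y hy => hM y fun hyΓ => by
    have := hy.good.le
    rw [hP.eq_top y hyΓ] at this
    exact ENNReal.ofReal_ne_top (top_le_iff.1 this)
  have hdist : 1.2 * σ ≤ ‖q - p‖ := by
    rw [Metric.mem_ball, dist_eq_norm] at hp hq
    have h2 : ‖((1.4 * σ : ℝ) : ℂ)‖ = 1.4 * σ := by
      rw [Complex.norm_real, Real.norm_of_nonneg (by positivity)]
    have e : ((1.4 * σ : ℝ) : ℂ) = (q - p) - (q - (z₀ + ((0.7 * σ : ℝ) : ℂ))) +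
        (p - (z₀ + -((0.7 * σ : ℝ) : ℂ))) := by push_cast; ring
    rw [e] at h2
    have := norm_add_le ((q - p) - (q - (z₀ + ((0.7 * σ : ℝ) : ℂ))))
        (p - (z₀ + -((0.7 * σ : ℝ) : ℂ)))
    have := norm_sub_le (q - p) (q - (z₀ + ((0.7 * σ : ℝ) : ℂ)))
    linarith
  have e' : (κ : ℂ) * Complex.I * (q - p) = (u q - u p) - (u q - b - κ * Complex.I * q) +
      (u p - b - κ * Complex.I * p) := by ring
  calc |κ| * (1.2 * σ) ≤ |κ| * ‖q - p‖ := by gcongr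
    _ = ‖(κ : ℂ) * Complex.I * (q - p)‖ := by simp
    _ ≤ (‖u q‖ + ‖u p‖) + ‖u q - b - κ * Complex.I * q‖ + ‖u p - b - κ * Complex.I * p‖ := by
        rw [e']
        refine (norm_add_le _ _).trans (add_le_add_left ((norm_sub_le _ _).trans
          (add_le_add_left (norm_sub_le _ _) _)) _)
    _ ≤ (M + M) + 8000000 * e * σ + 8000000 * e * σ :=
        add_le_add (add_le_add (add_le_add (hΓ q hqV) (hΓ p hpV)) (hfit q hqb hqV))
          (hfit p hpb hpV)
    _ = _ := by ring

theorem volume_half_lt_rot_le_of_large {Γ : Set ℂ} {u : ℂ → ℂ} {f : ℂ → ℝ≥0∞}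
    (hP : PlanarData Γ u f) {M : ℝ} (hM : ∀ y ∉ Γ, ‖u y‖ ≤ M) {s R : ℝ} (hs : 0 < s) (hR : 0 < R)
    {x : ℂ}
    (htwo : ∫⁻ y in Metric.ball x (12 * R), twoHitMeas Γ R y ≤ ENNReal.ofReal (1 / 10 ^ 50 * R ^ 2))
    (hint : ∫⁻ y in Metric.ball x (12 * R), f y ≤ ENNReal.ofReal (144 / 10 ^ 74 * s * R ^ 2))
    (hlarge : 1024 * 10 ^ 21 * M ≤ s * R) :
    volume {y | y ∈ Metric.ball x (8 * R) ∧ s / 2 < |rot u y|} <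
      ENNReal.ofReal (1 / 2 * R ^ 2) := by
  have hV := volume_not_veryGoodPt_le_of_small hP.isClosed hP.measurable hs hR htwo hint
  have hσ : R / (64 * (10 ^ 21 : ℕ)) ≤ R / (2 * (10 ^ 21 : ℕ)) / 32 := by
    apply le_of_eq; push_cast; ring
  have hE := volume_lt_rot_le hP (σ := R / (64 * (10 ^ 21 : ℕ))) (by positivity) hs
    (div_le_self hR.le (by norm_num)) (by positivity) hσ (by positivity) (r := 8) le_rfl hV
    (s₁ := s / 4) ?_
  · refine lt_of_le_of_lt ((measure_mono ?_).trans hE) ?_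
    · rintro y ⟨hy, hy2⟩
      exact ⟨hy, by linarith⟩
    · rw [ENNReal.ofReal_lt_ofReal_iff (by positivity)]
      gcongr
      norm_num
  · intro z₀ hz₀ hg κ b hfit
    have hσ0 : 0 < R / (64 * (10 ^ 21 : ℕ)) := by positivity
    have h := abs_le_of_isFit hP hM hσ0 hg hfit
    set σ := R / (64 * (10 ^ 21 : ℕ)) with hσd
    have hR' : R = 64 * 10 ^ 21 * σ := by rw [hσd]; push_cast; ring
    rw [hR'] at hlarge
    have hM' : 16 * M ≤ s * σ := by linarith
    refine le_of_mul_le_mul_right (h.trans ?_) (show 0 < 1.2 * σ by positivity)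
    have := mul_pos hs hσ0
    norm_num1
    nlinarith only [this, hM']

theorem ae_exists_dyadic_le_volume {S : Set ℂ} (hS : MeasurableSet S) {ρ : ℝ} (hρ : 0 < ρ) :
    ∀ᵐ x, x ∈ S → ∃ j : ℤ, (2 : ℝ) ^ j ≤ ρ ∧
      ENNReal.ofReal (1 / 2 * ((2 : ℝ) ^ j) ^ 2) ≤
        volume {y | y ∈ Metric.ball x (8 * (2 : ℝ) ^ j) ∧ y ∈ S} := by
  filter_upwards [Besicovitch.ae_tendsto_measure_inter_div_of_measurableSet (volume : Measure ℂ) hS]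
    with x hx hxS
  rw [indicator_of_mem hxS, Pi.one_apply] at hx
  have h1 := hx.eventually (lt_mem_nhds (show ((1 : ℝ≥0∞) / 2) < 1 by
    rw [one_div]; exact ENNReal.inv_lt_one.2 ENNReal.one_lt_two))
  rw [eventually_nhdsWithin_iff, Metric.eventually_nhds_iff] at h1
  obtain ⟨δ, hδ, h1⟩ := h1
  have hm : 0 < min (δ / 5) ρ := by positivity
  obtain ⟨k, hk⟩ := exists_pow_lt_of_lt_one hm (show (1 / 2 : ℝ) < 1 by norm_num)
  have e : (2 : ℝ) ^ (-(k : ℤ)) = (1 / 2) ^ k := by simp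
  refine ⟨-k, ?_, ?_⟩
  · rw [e]; exact hk.le.trans (min_le_right _ _)
  · rw [e]
    set R : ℝ := (1 / 2) ^ k with hR
    have hR0 : 0 < R := by positivity
    have h4 : 4 * R < δ := by
      have := hk.trans_le (min_le_left _ _)
      linarith
    have h2 := h1 (y := 4 * R) (by rw [dist_zero_right, Real.norm_of_nonneg (by positivity)]; exact h4)
      (show (0 : ℝ) < 4 * R by positivity)
    have h3 : volume (Metric.closedBall x (4 * R)) ≠ ⊤ := measure_closedBall_lt_top.ne
    have h5 := mul_le_mul_left h2.le (volume (Metric.closedBall x (4 * R)))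
    have h6 : ENNReal.ofReal (1 / 2 * R ^ 2) ≤ 1 / 2 * volume (Metric.closedBall x (4 * R)) := by
      have := (ofReal_mul_sq_le_volume_ball x (show 0 ≤ 4 * R by positivity)).trans
        (measure_mono Metric.ball_subset_closedBall)
      rw [ENNReal.ofReal_mul (by norm_num)]
      refine mul_le_mul' (by simp) (le_trans ?_ this)
      exact ENNReal.ofReal_le_ofReal (by nlinarith)
    rw [ENNReal.div_mul_cancel (Metric.measure_closedBall_pos volume x (by positivity)).ne' h3] at h5
    refine h6.trans (h5.trans (measure_mono ?_))
    rintro z ⟨hz1, hz2⟩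
    exact ⟨Metric.closedBall_subset_ball (by linarith) hz2, hz1⟩

/-- Points where `Γ` is met in two opposite directions from many points at some dyadic scale below
`ρ`. -/
def paidSet (Γ : Set ℂ) (ρ : ℝ) : Set ℂ :=
  {x | ∃ j : ℤ, (2 : ℝ) ^ j ≤ ρ ∧ ENNReal.ofReal (1 / 10 ^ 50 * ((2 : ℝ) ^ j) ^ 2) <
    ∫⁻ y in Metric.ball x (12 * (2 : ℝ) ^ j), twoHitMeas Γ (2 ^ j) y}

/-- Points around which the average of `f` is large at some scale below `ρ`. -/
def largeAvgSet (f : ℂ → ℝ≥0∞) (s ρ : ℝ) : Set ℂ :=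
  {x | ∃ r ∈ Ioo (0 : ℝ) ρ, ENNReal.ofReal (1 / 10 ^ 74 * s * r ^ 2) < ∫⁻ y in Metric.ball x r, f y}

theorem volume_lt_rot_good_lambda {Γ : Set ℂ} {u : ℂ → ℂ} {f : ℂ → ℝ≥0∞}
    (hP : PlanarData Γ u f) {M : ℝ} (hM0 : 0 < M) (hM : ∀ y ∉ Γ, ‖u y‖ ≤ M) {s : ℝ} (hs : 0 < s) :
    volume {y | 2 * s < |rot u y|} ≤ volume (paidSet Γ (10 ^ 26 * M / s)) +
      volume (largeAvgSet f s (10 ^ 28 * M / s)) + 1 / 8 * volume {y | s / 2 < |rot u y|} := by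
  set ρ := 10 ^ 26 * M / s with hρd
  set ρ' := 10 ^ 28 * M / s with hρd'
  have hρ : 0 < ρ := by positivity
  have hρρ' : 100 * ρ = ρ' := by rw [hρd, hρd']; ring
  set S := {y | s / 2 < |rot u y|} with hS
  have hSm : MeasurableSet S := measurableSet_lt measurable_const (measurable_rot u).abs
  set X := {y | (2 * s < |rot u y| ∧ ∃ j : ℤ, (2 : ℝ) ^ j ≤ ρ ∧
      ENNReal.ofReal (1 / 2 * ((2 : ℝ) ^ j) ^ 2) ≤
        volume {z | z ∈ Metric.ball y (8 * (2 : ℝ) ^ j) ∧ z ∈ S}) ∧ y ∉ paidSet Γ ρ ∧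
        y ∉ largeAvgSet f s ρ'} with hX
  have htw : ∀ x ∈ X, ∀ j : ℤ, (2 : ℝ) ^ j ≤ ρ →
      ∫⁻ y in Metric.ball x (12 * (2 : ℝ) ^ j), twoHitMeas Γ (2 ^ j) y ≤
        ENNReal.ofReal (1 / 10 ^ 50 * ((2 : ℝ) ^ j) ^ 2) := by
    intro x hx j hj
    by_contra! hcon
    exact hx.2.1 ⟨j, hj, hcon⟩
  have hav : ∀ x ∈ X, ∀ j : ℤ, (2 : ℝ) ^ j ≤ ρ →
      ∫⁻ y in Metric.ball x (12 * (2 : ℝ) ^ j), f y ≤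
        ENNReal.ofReal (144 / 10 ^ 74 * s * ((2 : ℝ) ^ j) ^ 2) := by
    intro x hx j hj
    by_contra! hcon
    refine hx.2.2 ⟨12 * (2 : ℝ) ^ j, ⟨by positivity, by linarith⟩, ?_⟩
    convert hcon using 2
    ring
  have hmax : ∀ x ∈ X, ∃ j : ℤ, ENNReal.ofReal (1 / 2 * ((2 : ℝ) ^ j) ^ 2) ≤
        volume {z | z ∈ Metric.ball x (8 * (2 : ℝ) ^ j) ∧ z ∈ S} ∧
        s * 2 ^ j ≤ 1024 * 10 ^ 21 * M ∧ ∀ k : ℤ, j < k → (2 : ℝ) ^ k ≤ ρ →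
        volume {z | z ∈ Metric.ball x (8 * (2 : ℝ) ^ k) ∧ z ∈ S} <
          ENNReal.ofReal (1 / 2 * ((2 : ℝ) ^ k) ^ 2) := by
    intro x hx
    obtain ⟨n, hn⟩ := pow_unbounded_of_one_lt ρ (one_lt_two : (1 : ℝ) < 2)
    obtain ⟨j, ⟨hj1, hj2⟩, hj⟩ := Int.exists_greatest_of_bdd (P := fun j : ℤ => (2 : ℝ) ^ j ≤ ρ ∧
      ENNReal.ofReal (1 / 2 * ((2 : ℝ) ^ j) ^ 2) ≤
        volume {z | z ∈ Metric.ball x (8 * (2 : ℝ) ^ j) ∧ z ∈ S})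
      ⟨n, fun z hz => (zpow_le_zpow_iff_right₀ (one_lt_two : (1 : ℝ) < 2)).1
        (hz.1.trans (by exact_mod_cast hn.le))⟩ hx.1.2
    refine ⟨j, hj2, ?_, fun k hjk hk => ?_⟩
    · by_contra! hcon
      exact (volume_half_lt_rot_le_of_large hP hM hs (by positivity) (htw x hx j hj1)
        (hav x hx j hj1) hcon.le).not_ge hj2
    · by_contra! hcon
      exact (hj k ⟨hk, hcon⟩).not_gt hjk
  choose! j hj1 hj2 hj3 using hmax
  obtain ⟨v, hvX, hvc, hvd, hvcov⟩ := exists_countable_disjoint_closedBall X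
    (fun x => 8 * (2 : ℝ) ^ (j x)) (8 * (1024 * 10 ^ 21 * M / s)) (fun y _ => by positivity)
    (fun y hy => by
      have := hj2 y hy
      rw [← le_div_iff₀' hs] at this
      linarith)
  have hloc : ∀ b ∈ v, volume {y | y ∈ Metric.ball b (5 * (2 : ℝ) ^ (j b + 5)) ∧
      2 * s < |rot u y|} ≤ 1 / 8 * volume (Metric.closedBall b (8 * (2 : ℝ) ^ (j b)) ∩ S) := by
    intro b hb
    have e : (2 : ℝ) ^ (j b + 5) = 32 * 2 ^ (j b) := by
      rw [zpow_add₀ two_ne_zero]; norm_num; ring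
    have hle : (2 : ℝ) ^ (j b + 5) ≤ ρ := by
      have := hj2 b (hvX hb)
      rw [e, hρd, le_div_iff₀ hs]
      linarith
    have h1 := volume_two_mul_lt_rot_le hP hs (by positivity) (htw b (hvX hb) _ hle)
      (hav b (hvX hb) _ hle) (hj3 b (hvX hb) _ (by linarith) hle)
    have hsub : {z | z ∈ Metric.ball b (8 * (2 : ℝ) ^ (j b)) ∧ z ∈ S} ⊆
        Metric.closedBall b (8 * (2 : ℝ) ^ (j b)) ∩ S :=
      fun z hz => ⟨Metric.ball_subset_closedBall hz.1, hz.2⟩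
    refine h1.trans (le_trans ?_ (mul_le_mul_right
      ((hj1 b (hvX hb)).trans (measure_mono hsub)) _))
    rw [show (1 : ℝ≥0∞) / 8 = ENNReal.ofReal (1 / 8) by
      rw [ENNReal.ofReal_div_of_pos (by norm_num)]; simp, ← ENNReal.ofReal_mul (by norm_num), e]
    exact ENNReal.ofReal_le_ofReal (le_of_eq (by ring))
  have hXv : volume X ≤ 1 / 8 * volume S := by
    have hsub : X ⊆ ⋃ b ∈ v, {y | y ∈ Metric.ball b (5 * (2 : ℝ) ^ (j b + 5)) ∧
      2 * s < |rot u y|} := by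
      intro a ha
      obtain ⟨b, hb, hd, hr⟩ := hvcov a ha
      refine mem_iUnion₂.2 ⟨b, hb, ?_, ha.1.1⟩
      have e : (2 : ℝ) ^ (j b + 5) = 32 * 2 ^ (j b) := by
        rw [zpow_add₀ two_ne_zero]; norm_num; ring
      have : (0 : ℝ) < 2 ^ (j b) := by positivity
      rw [Metric.mem_ball, e]
      linarith
    have hd' : v.PairwiseDisjoint fun b => Metric.closedBall b (8 * (2 : ℝ) ^ (j b)) ∩ S :=
      fun a ha b hb hab => (hvd ha hb hab).mono inter_subset_left inter_subset_left
    calc volume X ≤ ∑' b : v, volume {y | y ∈ Metric.ball (b : ℂ) (5 * (2 : ℝ) ^ (j b + 5)) ∧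
          2 * s < |rot u y|} := (measure_mono hsub).trans (measure_biUnion_le _ hvc _)
      _ ≤ ∑' b : v, 1 / 8 * volume (Metric.closedBall (b : ℂ) (8 * (2 : ℝ) ^ (j b)) ∩ S) :=
          ENNReal.tsum_le_tsum fun b => hloc b b.2
      _ = 1 / 8 * volume (⋃ b ∈ v, Metric.closedBall b (8 * (2 : ℝ) ^ (j b)) ∩ S) := by
          rw [ENNReal.tsum_mul_left, measure_biUnion hvc hd'
            fun b _ => measurableSet_closedBall.inter hSm]
      _ ≤ _ := mul_le_mul_right (measure_mono (iUnion₂_subset fun b _ => inter_subset_right)) _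
  have hsub : ∀ᵐ y, y ∈ {y | 2 * s < |rot u y|} →
      y ∈ (paidSet Γ ρ ∪ largeAvgSet f s ρ') ∪ X := by
    filter_upwards [ae_exists_dyadic_le_volume hSm hρ] with y hy hys
    by_cases h1 : y ∈ paidSet Γ ρ
    · exact Or.inl (Or.inl h1)
    by_cases h2 : y ∈ largeAvgSet f s ρ'
    · exact Or.inl (Or.inr h2)
    have hys' : 2 * s < |rot u y| := hys
    exact Or.inr ⟨⟨hys, hy (show s / 2 < |rot u y| by linarith)⟩, h1, h2⟩
  exact (measure_mono_ae hsub).trans ((measure_union_le _ _).trans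
    (add_le_add (measure_union_le _ _) hXv))

theorem ENNReal.tsum_int_le_of_add_succ_eq {a b : ℤ → ℝ≥0∞} {B : ℝ≥0∞}
    (hab : ∀ j, a j + b (j + 1) = b j) (hB : ∀ j, b j ≤ B) : ∑' j, a j ≤ B := by
  have key : ∀ (m : ℤ) (n : ℕ), ∑ j ∈ Finset.Ico m (m + n), a j + b (m + n) = b m := by
    intro m n
    induction n with
    | zero => simp
    | succ k ih =>
      rw [← ih, ← hab (m + k)]
      push_cast
      rw [← add_assoc m, ← Finset.insert_Ico_right_eq_Ico_add_one (by linarith),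
        Finset.sum_insert (by simp)]
      ring
  rw [ENNReal.tsum_eq_iSup_sum]
  refine iSup_le fun s => ?_
  obtain ⟨m, n, hs⟩ : ∃ (m : ℤ) (n : ℕ), s ⊆ Finset.Ico m (m + n) := by
    obtain ⟨p, hp⟩ := s.bddBelow
    obtain ⟨q, hq⟩ := s.bddAbove
    refine ⟨p, (q + 1 - p).toNat, fun x hx => ?_⟩
    have h1 := hp hx
    have h2 := hq hx
    rw [Finset.mem_Ico]
    omega
  exact (Finset.sum_le_sum_of_subset hs).trans ((le_self_add.trans (key m n).le).trans (hB m))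

theorem tsum_lintegral_twoHitMeas_le {Γ : Set ℂ} (hΓ : IsClosed Γ) {N : ℝ≥0∞}
    (hN : ∀ j : ℤ, ∫⁻ y, hitMeas Γ (2 ^ j) y ≤ ENNReal.ofReal (2 ^ j) * N) :
    ∑' j : ℤ, ENNReal.ofReal ((2 : ℝ) ^ (-j)) * ∫⁻ y, twoHitMeas Γ (2 ^ j) y ≤ 2 * N := by
  refine ENNReal.tsum_int_le_of_add_succ_eq
    (b := fun j => ENNReal.ofReal ((2 : ℝ) ^ (-j)) * (2 * ∫⁻ y, hitMeas Γ (2 ^ j) y))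
    (fun j => ?_) fun j => ?_
  · rw [← lintegral_twoHitMeas_add hΓ (R := 2 ^ j) (by positivity), mul_add, zpow_add_one₀ two_ne_zero,
      mul_comm _ (2 : ℝ), ← mul_assoc, neg_add, zpow_add₀ two_ne_zero,
      ENNReal.ofReal_mul (by positivity)]
    congr 2
    rw [mul_assoc, show (2 : ℝ≥0∞) = ENNReal.ofReal 2 by simp, ← ENNReal.ofReal_mul (by positivity)]
    norm_num
  · calc _ ≤ ENNReal.ofReal ((2 : ℝ) ^ (-j)) * (2 * (ENNReal.ofReal (2 ^ j) * N)) :=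
          mul_le_mul_right (mul_le_mul_right (hN j) _) _
      _ = (ENNReal.ofReal ((2 : ℝ) ^ (-j)) * ENNReal.ofReal (2 ^ j)) * (2 * N) := by ring
      _ ≤ 2 * N := by
          rw [← ENNReal.ofReal_mul (by positivity), ← zpow_add₀ two_ne_zero]
          simp

theorem volume_lt_lintegral_ball_le (g : ℂ → ℝ≥0∞) {t R : ℝ} (ht : 0 < t) (hR : 0 < R) :
    volume {x | ENNReal.ofReal (t * R ^ 2) < ∫⁻ y in Metric.ball x R, g y} ≤
      ENNReal.ofReal (80 / t) * ∫⁻ y, g y := by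
  have h := volume_le_of_lt_measure_ball (volume.withDensity g) (B := univ) (R := 2 * R)
    (Y := {x | ENNReal.ofReal (t * R ^ 2) < ∫⁻ y in Metric.ball x R, g y}) ht
    (fun x hx => ⟨R, ⟨hR, by linarith⟩, by rwa [withDensity_apply _ measurableSet_ball]⟩)
    fun _ _ => subset_univ _
  rwa [withDensity_apply _ .univ, setLIntegral_univ] at h

theorem lintegral_volume_paidSet_le {Γ : Set ℂ} (hΓ : IsClosed Γ) {K : ℝ} (hK : 0 ≤ K) {N : ℝ≥0∞}
    (hN : ∀ j : ℤ, ∫⁻ y, hitMeas Γ (2 ^ j) y ≤ ENNReal.ofReal (2 ^ j) * N) :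
    ∃ P : ℝ → ℝ≥0∞, Measurable P ∧ (∀ s > 0, volume (paidSet Γ (K / s)) ≤ P s) ∧
      ∫⁻ s in Ioi 0, P s ≤ ENNReal.ofReal (10 ^ 55 * K) * N := by
  set Z : ℤ → Set ℂ := fun j => {x | ENNReal.ofReal (1 / 10 ^ 50 * ((2 : ℝ) ^ j) ^ 2) <
    ∫⁻ y in Metric.ball x (12 * (2 : ℝ) ^ j), twoHitMeas Γ (2 ^ j) y} with hZ
  have hZv : ∀ j, volume (Z j) ≤ ENNReal.ofReal (80 * 144 * 10 ^ 50) *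
      ∫⁻ y, twoHitMeas Γ (2 ^ j) y := by
    intro j
    have := volume_lt_lintegral_ball_le (twoHitMeas Γ (2 ^ j)) (t := 1 / (144 * 10 ^ 50))
      (R := 12 * 2 ^ j) (by positivity) (by positivity)
    convert this using 3
    · congr! 3
      ring
    · norm_num
  refine ⟨fun s => ∑' j : ℤ, (Iic (K / (2 : ℝ) ^ j)).indicator (fun _ => volume (Z j)) s,
    Measurable.tsum fun j => measurable_const.indicator measurableSet_Iic,
    fun s hs => ?_, ?_⟩
  · have : paidSet Γ (K / s) ⊆ ⋃ j : ℤ, {x | s ∈ Iic (K / (2 : ℝ) ^ j) ∧ x ∈ Z j} := by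
      rintro x ⟨j, hj, hx⟩
      refine mem_iUnion.2 ⟨j, ?_, hx⟩
      rw [mem_Iic, le_div_iff₀ (by positivity)]
      rw [le_div_iff₀ hs] at hj
      linarith
    refine (measure_mono this).trans ((measure_iUnion_le _).trans
      (ENNReal.tsum_le_tsum fun j => ?_))
    by_cases h : s ∈ Iic (K / (2 : ℝ) ^ j)
    · simp only [h, true_and, indicator_of_mem]; exact le_rfl
    · simp [h]
  · rw [lintegral_tsum fun j => (measurable_const.indicator measurableSet_Iic).aemeasurable]
    calc ∑' j : ℤ, ∫⁻ s in Ioi 0, (Iic (K / (2 : ℝ) ^ j)).indicator (fun _ => volume (Z j)) s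
        ≤ ∑' j : ℤ, ENNReal.ofReal (80 * 144 * 10 ^ 50 * K) *
          (ENNReal.ofReal ((2 : ℝ) ^ (-j)) * ∫⁻ y, twoHitMeas Γ (2 ^ j) y) := by
          refine ENNReal.tsum_le_tsum fun j => ?_
          rw [lintegral_indicator measurableSet_Iic, Measure.restrict_restrict measurableSet_Iic,
            setLIntegral_const, inter_comm, Ioi_inter_Iic, Real.volume_Ioc, sub_zero]
          refine (mul_le_mul_left (hZv j) _).trans (le_of_eq ?_)
          rw [div_eq_mul_inv, ENNReal.ofReal_mul hK, ENNReal.ofReal_mul (q := K) (by positivity),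
            zpow_neg]
          ring
      _ ≤ ENNReal.ofReal (80 * 144 * 10 ^ 50 * K) * (2 * N) := by
          rw [ENNReal.tsum_mul_left]
          exact mul_le_mul_right (tsum_lintegral_twoHitMeas_le hΓ hN) _
      _ ≤ _ := by
          rw [← mul_assoc, show (2 : ℝ≥0∞) = ENNReal.ofReal 2 by simp,
            ← ENNReal.ofReal_mul (by positivity)]
          refine mul_le_mul_left (ENNReal.ofReal_le_ofReal ?_) _
          nlinarith

theorem volume_largeAvgSet_le {f : ℂ → ℝ≥0∞} (hf : Measurable f) {s ρ : ℝ} (hs : 0 < s) :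
    volume (largeAvgSet f s ρ) ≤ ENNReal.ofReal (10 ^ 152 / s ^ 2) * ∫⁻ y, f y ^ 2 := by
  have hb : 0 < s / (7 * 10 ^ 74) := by positivity
  set b := s / (7 * 10 ^ 74) with hbd
  have hfb : ∀ y, f y ≤ ENNReal.ofReal b + ENNReal.ofReal b⁻¹ * f y ^ 2 := by
    intro y
    rcases le_total (f y) (ENNReal.ofReal b) with h | h
    · exact h.trans le_self_add
    · refine le_trans ?_ le_add_self
      calc f y = ENNReal.ofReal b⁻¹ * ENNReal.ofReal b * f y := by
            rw [← ENNReal.ofReal_mul (by positivity), inv_mul_cancel₀ hb.ne']; simp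
        _ ≤ ENNReal.ofReal b⁻¹ * f y * f y := by gcongr
        _ = _ := by ring
  have h := volume_le_of_lt_measure_ball (volume.withDensity fun y => f y ^ 2) (B := univ)
    (Y := largeAvgSet f s ρ) (t := s ^ 2 / 10 ^ 150) (R := ρ) (by positivity) ?_
    fun _ _ => subset_univ _
  · rw [withDensity_apply _ .univ, setLIntegral_univ] at h
    refine h.trans (mul_le_mul_left (ENNReal.ofReal_le_ofReal ?_) _)
    rw [div_div_eq_mul_div]
    gcongr
    norm_num
  · rintro x ⟨r, hr, hx⟩
    refine ⟨r, hr, ?_⟩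
    rw [withDensity_apply _ measurableSet_ball]
    by_contra! hcon
    refine hx.not_ge ?_
    calc ∫⁻ y in Metric.ball x r, f y
        ≤ ∫⁻ y in Metric.ball x r, (ENNReal.ofReal b + ENNReal.ofReal b⁻¹ * f y ^ 2) :=
          lintegral_mono hfb
      _ = ENNReal.ofReal b * volume (Metric.ball x r) +
          ENNReal.ofReal b⁻¹ * ∫⁻ y in Metric.ball x r, f y ^ 2 := by
          rw [lintegral_add_left measurable_const, lintegral_const_mul _ (hf.pow_const 2),
            setLIntegral_const]
      _ ≤ ENNReal.ofReal b * ENNReal.ofReal (3.2 * r ^ 2) +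
          ENNReal.ofReal b⁻¹ * ENNReal.ofReal (s ^ 2 / 10 ^ 150 * r ^ 2) := by
          gcongr
          exact volume_ball_le_ofReal x hr.1.le
      _ ≤ _ := by
          rw [← ENNReal.ofReal_mul hb.le, ← ENNReal.ofReal_mul (by positivity),
            ← ENNReal.ofReal_add (by positivity) (by positivity)]
          refine ENNReal.ofReal_le_ofReal ?_
          have e : b * (3.2 * r ^ 2) + b⁻¹ * (s ^ 2 / 10 ^ 150 * r ^ 2) =
            s * r ^ 2 * (3.2 / (7 * 10 ^ 74) + 7 * 10 ^ 74 / 10 ^ 150) := by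
            rw [hbd]; field_simp
          rw [e, show 1 / 10 ^ 74 * s * r ^ 2 = s * r ^ 2 * (1 / 10 ^ 74) by ring]
          refine mul_le_mul_of_nonneg_left (by norm_num) (by positivity)

theorem lintegral_Ioi_inv_sq {a : ℝ} (ha : 0 < a) {c : ℝ} (hc : 0 ≤ c) :
    ∫⁻ s in Ioi a, ENNReal.ofReal (c / s ^ 2) = ENNReal.ofReal (c / a) := by
  have e : ∀ s ∈ Ioi a, c / s ^ 2 = c * s ^ (-2 : ℝ) := fun s hs => by
    rw [Real.rpow_neg (ha.trans hs).le, div_eq_mul_inv]; norm_num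
  rw [setLIntegral_congr_fun measurableSet_Ioi fun s hs => congrArg _ (e s hs),
    ← ofReal_integral_eq_lintegral_ofReal
      ((integrableOn_Ioi_rpow_of_lt (by norm_num) ha).const_mul c), integral_const_mul,
    integral_Ioi_rpow_of_lt (by norm_num) ha]
  · congr 1
    rw [show (-2 : ℝ) + 1 = -1 by norm_num, Real.rpow_neg_one]
    field_simp
  · filter_upwards [ae_restrict_mem measurableSet_Ioi] with s hs
    have := (ha.trans hs).le
    positivity

theorem lintegral_abs_rot_le {Γ : Set ℂ} {u : ℂ → ℂ} {f : ℂ → ℝ≥0∞}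
    (hP : PlanarData Γ u f) {M : ℝ} (hM0 : 0 < M) (hM : ∀ y ∉ Γ, ‖u y‖ ≤ M) {D : Set ℂ}
    (hD : ∀ᵐ y, y ∉ D → rot u y = 0) {N : ℝ≥0∞}
    (hN : ∀ j : ℤ, ∫⁻ y, hitMeas Γ (2 ^ j) y ≤ ENNReal.ofReal (2 ^ j) * N)
    (hfin : ∫⁻ y, ENNReal.ofReal |rot u y| ≠ ⊤) {a : ℝ} (ha : 0 < a) :
    ∫⁻ y, ENNReal.ofReal |rot u y| ≤ 4 * (ENNReal.ofReal a * volume D +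
      ENNReal.ofReal (10 ^ 81 * M) * N + ENNReal.ofReal (10 ^ 152 / a) * ∫⁻ y, f y ^ 2) := by
  set W := ∫⁻ y, ENNReal.ofReal |rot u y| with hW
  have hrm := measurable_rot u
  have hL : ENNReal.ofReal (1 / 2) * W = ∫⁻ s in Ioi 0, volume {y | 2 * s < |rot u y|} := by
    rw [hW, ← lintegral_const_mul _ hrm.abs.ennreal_ofReal]
    simp only [← ENNReal.ofReal_mul (show (0 : ℝ) ≤ 1 / 2 by norm_num)]
    rw [lintegral_eq_lintegral_meas_lt _ (.of_forall fun y => by positivity)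
      (hrm.abs.const_mul _).aemeasurable]
    congr! 5 with s y
    constructor <;> intro h <;> linarith
  have hR : ENNReal.ofReal 2 * W = ∫⁻ s in Ioi 0, volume {y | s / 2 < |rot u y|} := by
    rw [hW, ← lintegral_const_mul _ hrm.abs.ennreal_ofReal]
    simp only [← ENNReal.ofReal_mul (show (0 : ℝ) ≤ 2 by norm_num)]
    rw [lintegral_eq_lintegral_meas_lt _ (.of_forall fun y => by positivity)
      (hrm.abs.const_mul _).aemeasurable]
    congr! 5 with s y
    constructor <;> intro h <;> linarith
  obtain ⟨P, hPm, hP1, hP2⟩ := lintegral_volume_paidSet_le hP.isClosed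
    (K := 10 ^ 26 * M) (by positivity) hN
  have hsmall : ∫⁻ s in Ioc 0 a, volume {y | 2 * s < |rot u y|} ≤ ENNReal.ofReal a * volume D := by
    calc _ ≤ ∫⁻ s in Ioc 0 a, volume D := by
          refine setLIntegral_mono' measurableSet_Ioc fun s hs => measure_mono_ae ?_
          filter_upwards [hD] with y hy hys
          by_contra h
          have hys' : 2 * s < |rot u y| := hys
          rw [hy h, abs_zero] at hys'
          linarith [hs.1]
      _ = _ := by rw [setLIntegral_const, Real.volume_Ioc, sub_zero, mul_comm]
  have hlarge : ∫⁻ s in Ioi a, volume {y | 2 * s < |rot u y|} ≤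
      ENNReal.ofReal (10 ^ 55 * (10 ^ 26 * M)) * N +
      (ENNReal.ofReal (10 ^ 152 / a) * ∫⁻ y, f y ^ 2) + 1 / 8 * (ENNReal.ofReal 2 * W) := by
    calc _ ≤ ∫⁻ s in Ioi a, (P s + (ENNReal.ofReal (10 ^ 152 / s ^ 2) * ∫⁻ y, f y ^ 2) +
            1 / 8 * volume {y | s / 2 < |rot u y|}) := by
          refine setLIntegral_mono' measurableSet_Ioi fun s hs => ?_
          have hs0 : 0 < s := ha.trans hs
          refine (volume_lt_rot_good_lambda hP hM0 hM hs0).trans ?_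
          gcongr
          · exact hP1 s hs0
          · exact volume_largeAvgSet_le hP.measurable hs0
      _ = (∫⁻ s in Ioi a, P s) + (∫⁻ s in Ioi a, ENNReal.ofReal (10 ^ 152 / s ^ 2)) *
          (∫⁻ y, f y ^ 2) + 1 / 8 * ∫⁻ s in Ioi a, volume {y | s / 2 < |rot u y|} := by
          have hm : Measurable fun s : ℝ => ENNReal.ofReal (10 ^ 152 / s ^ 2) := by fun_prop
          rw [lintegral_add_left (f := fun s => P s + _) (hPm.add (hm.mul_const _)), lintegral_add_left hPm,
            lintegral_mul_const _ hm, lintegral_const_mul' _ _ (by simp)]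
      _ ≤ _ := by
          rw [lintegral_Ioi_inv_sq ha (by positivity), hR]
          gcongr
          · exact (lintegral_mono_set (Ioi_subset_Ioi ha.le)).trans hP2
  have hsum : ENNReal.ofReal (1 / 2) * W ≤ (ENNReal.ofReal a * volume D +
      ENNReal.ofReal (10 ^ 81 * M) * N + ENNReal.ofReal (10 ^ 152 / a) * ∫⁻ y, f y ^ 2) +
      ENNReal.ofReal (1 / 4) * W := by
    rw [hL, ← Ioc_union_Ioi_eq_Ioi ha.le]
    refine (lintegral_union_le _ _ _).trans ((add_le_add hsmall hlarge).trans (le_of_eq ?_))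
    rw [show (1 : ℝ≥0∞) / 8 = ENNReal.ofReal (1 / 8) by
      rw [ENNReal.ofReal_div_of_pos (by norm_num)]; simp, ← mul_assoc (ENNReal.ofReal (1 / 8)),
      ← ENNReal.ofReal_mul (by norm_num), show (1 : ℝ) / 8 * 2 = 1 / 4 by norm_num,
      show (10 : ℝ) ^ 55 * (10 ^ 26 * M) = 10 ^ 81 * M by ring]
    ring
  have e : ENNReal.ofReal (1 / 2) * W = ENNReal.ofReal (1 / 4) * W + ENNReal.ofReal (1 / 4) * W := by
    rw [← add_mul, ← ENNReal.ofReal_add (by norm_num) (by norm_num)]; norm_num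
  rw [e] at hsum
  have h2 := ENNReal.le_of_add_le_add_right (ENNReal.mul_ne_top ENNReal.ofReal_ne_top hfin) hsum
  calc W = 4 * (ENNReal.ofReal (1 / 4) * W) := by
        rw [show (4 : ℝ≥0∞) = ENNReal.ofReal 4 by simp, ← mul_assoc,
          ← ENNReal.ofReal_mul (by norm_num)]
        norm_num
    _ ≤ _ := mul_le_mul_right h2 _

/-- The embedding of the plane onto the coordinate plane spanned by the `i`-th and `j`-th axes. -/
def planeEmb {d : ℕ} (i j : Fin d) : ℂ →L[ℝ] Ed d :=
  Complex.reCLM.smulRight (EuclideanSpace.single i (1 : ℝ)) +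
    Complex.imCLM.smulRight (EuclideanSpace.single j (1 : ℝ))

/-- The projection onto the `i`-th and `j`-th coordinates. -/
def planeProj {d : ℕ} (i j : Fin d) : Ed d →L[ℝ] ℂ :=
  (EuclideanSpace.proj i : Ed d →L[ℝ] ℝ).smulRight (1 : ℂ) +
    (EuclideanSpace.proj j : Ed d →L[ℝ] ℝ).smulRight Complex.I

theorem planeEmb_apply {d : ℕ} (i j : Fin d) (z : ℂ) : planeEmb i j z =
    z.re • EuclideanSpace.single i (1 : ℝ) + z.im • EuclideanSpace.single j (1 : ℝ) := rfl

theorem planeProj_apply {d : ℕ} (i j : Fin d) (x : Ed d) :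
    planeProj i j x = x i + x j * Complex.I := by
  simp [planeProj]

theorem planeProj_planeEmb {d : ℕ} {i j : Fin d} (hij : i ≠ j) (z : ℂ) :
    planeProj i j (planeEmb i j z) = z := by
  rw [planeProj_apply, planeEmb_apply]
  simp [hij, hij.symm, Complex.re_add_im]

theorem norm_planeEmb {d : ℕ} {i j : Fin d} (hij : i ≠ j) (z : ℂ) :
    ‖planeEmb i j z‖ = ‖z‖ := by
  have h : ‖planeEmb i j z‖ ^ 2 = ‖z‖ ^ 2 := by
    rw [planeEmb_apply, ← real_inner_self_eq_norm_sq, Complex.sq_norm, Complex.normSq_apply,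
      inner_add_left, inner_add_right, inner_add_right]
    simp only [real_inner_smul_left, real_inner_smul_right, EuclideanSpace.inner_single_left]
    simp [hij, hij.symm]
  exact (sq_eq_sq₀ (norm_nonneg _) (norm_nonneg _)).1 h

theorem norm_planeProj_le {d : ℕ} {i j : Fin d} (hij : i ≠ j) (x : Ed d) :
    ‖planeProj i j x‖ ≤ ‖x‖ := by
  rw [planeProj_apply, ← sq_le_sq₀ (norm_nonneg _) (norm_nonneg _), Complex.sq_norm,
    Complex.normSq_add_mul_I, EuclideanSpace.real_norm_sq_eq, ← Finset.sum_pair (f := fun k => x k ^ 2) hij]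
  exact Finset.sum_le_univ_sum_of_nonneg fun k => sq_nonneg _

/-- Base points of the planar slices used to disintegrate the volume. -/
def sliceBase {d : ℕ} (i j : Fin d) : Set (Ed d) := {p | planeProj i j p ∈ Metric.ball (0 : ℂ) 1}

theorem measurableSet_sliceBase {d : ℕ} (i j : Fin d) : MeasurableSet (sliceBase i j) :=
  (planeProj i j).continuous.measurable measurableSet_ball

theorem lintegral_slice {d : ℕ} {i j : Fin d} (hij : i ≠ j) {g : Ed d → ℝ≥0∞}
    (hg : Measurable g) :
    ∫⁻ p in sliceBase i j, ∫⁻ z, g (p + planeEmb i j z) =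
      volume (Metric.ball (0 : ℂ) 1) * ∫⁻ x, g x := by
  have hB := measurableSet_sliceBase i j
  have hι := (planeEmb i j).continuous.measurable
  have hπ := (planeProj i j).continuous.measurable
  rw [lintegral_lintegral_swap (by fun_prop)]
  calc ∫⁻ z, ∫⁻ p in sliceBase i j, g (p + planeEmb i j z)
      = ∫⁻ z, ∫⁻ x, (Metric.ball (0 : ℂ) 1).indicator 1 (planeProj i j x - z) * g x := by
        refine lintegral_congr fun z => ?_
        rw [← lintegral_indicator hB, ← lintegral_sub_right_eq_self _ (planeEmb i j z)]
        refine lintegral_congr fun x => ?_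
        simp only [indicator, sliceBase, mem_ofPred_eq, map_sub, planeProj_planeEmb hij,
          sub_add_cancel, Pi.one_apply]
        split_ifs <;> simp [planeProj_planeEmb hij]
    _ = ∫⁻ x, ∫⁻ z, (Metric.ball (0 : ℂ) 1).indicator 1 (planeProj i j x - z) * g x := by
        refine lintegral_lintegral_swap (Measurable.aemeasurable ?_)
        have h1 : Measurable ((Metric.ball (0 : ℂ) 1).indicator (1 : ℂ → ℝ≥0∞)) :=
          measurable_one.indicator measurableSet_ball
        fun_prop
    _ = _ := by
        rw [← lintegral_const_mul _ hg]
        refine lintegral_congr fun x => ?_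
        have h1 : Measurable ((Metric.ball (0 : ℂ) 1).indicator (1 : ℂ → ℝ≥0∞)) :=
          measurable_one.indicator measurableSet_ball
        rw [lintegral_mul_const _ (by fun_prop),
          lintegral_sub_left_eq_self (fun z => (Metric.ball (0 : ℂ) 1).indicator 1 z),
          lintegral_indicator_one measurableSet_ball]

theorem ae_slice {d : ℕ} {i j : Fin d} (hij : i ≠ j) {P : Ed d → Prop} (hP : ∀ᵐ x, P x) :
    ∀ᵐ p ∂(volume.restrict (sliceBase i j)), ∀ᵐ z, P (p + planeEmb i j z) := by
  have hι := (planeEmb i j).continuous.measurable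
  set S := toMeasurable volume {x | ¬ P x} with hS
  have hSm : MeasurableSet S := measurableSet_toMeasurable _ _
  have hS0 : volume S = 0 := by rw [hS, measure_toMeasurable]; exact hP
  have h := lintegral_slice hij (measurable_one.indicator hSm : Measurable (S.indicator 1))
  rw [lintegral_indicator_one hSm, hS0, mul_zero] at h
  have hm : Measurable (S.indicator (1 : Ed d → ℝ≥0∞)) := measurable_one.indicator hSm
  rw [lintegral_eq_zero_iff (Measurable.lintegral_prod_right'
    (f := fun q : Ed d × ℂ => S.indicator (1 : Ed d → ℝ≥0∞) (q.1 + planeEmb i j q.2))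
    (by fun_prop))] at h
  filter_upwards [h] with p hp
  rw [Pi.zero_apply, lintegral_eq_zero_iff (by fun_prop)] at hp
  filter_upwards [hp] with z hz
  by_contra hcon
  have : p + planeEmb i j z ∈ S := subset_toMeasurable _ _ hcon
  simp [this] at hz

/-- The points from which `Γ` is met before time `h` in direction `w`. -/
def sweep {d : ℕ} (Γ : Set (Ed d)) (h : ℝ) (w : Ed d) : Set (Ed d) :=
  {x | ∃ t ∈ Icc (0 : ℝ) h, x + t • w ∈ Γ}

theorem sweep_union {d : ℕ} (Γ Γ' : Set (Ed d)) (h : ℝ) (w : Ed d) :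
    sweep (Γ ∪ Γ') h w = sweep Γ h w ∪ sweep Γ' h w := by
  ext x
  constructor
  · rintro ⟨t, ht, hx | hx⟩
    exacts [Or.inl ⟨t, ht, hx⟩, Or.inr ⟨t, ht, hx⟩]
  · rintro (⟨t, ht, hx⟩ | ⟨t, ht, hx⟩)
    exacts [⟨t, ht, Or.inl hx⟩, ⟨t, ht, Or.inr hx⟩]

theorem volume_sweep_le_of_subset_closedBall {d : ℕ} {S : Set (Ed d)} {x₀ : Ed d} {δ h : ℝ}
    (hδ : 0 < δ) (hδh : δ ≤ h) (hS : S ⊆ Metric.closedBall x₀ δ) {w : Ed d} (hw : ‖w‖ ≤ 1) :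
    volume (sweep S h w) ≤
      ENNReal.ofReal (2 * h / δ * (2 * δ) ^ d) * volume (Metric.ball (0 : Ed d) 1) := by
  have hsub : sweep S h w ⊆ ⋃ k ∈ Finset.range (⌊h / δ⌋₊ + 1),
      Metric.closedBall (x₀ - (k * δ) • w) (2 * δ) := by
    rintro x ⟨t, ht, hx⟩
    refine mem_iUnion₂.2 ⟨⌊t / δ⌋₊, ?_, ?_⟩
    · rw [Finset.mem_range, Nat.lt_succ_iff]
      exact Nat.floor_mono (by gcongr; exact ht.2)
    · have h1 := Nat.floor_le (show 0 ≤ t / δ from div_nonneg ht.1 hδ.le)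
      have h2 := Nat.lt_floor_add_one (t / δ)
      rw [le_div_iff₀ hδ] at h1
      rw [div_lt_iff₀ hδ] at h2
      have h3 := hS hx
      rw [mem_closedBall_iff_norm] at h3 ⊢
      have e : x - (x₀ - (⌊t / δ⌋₊ * δ) • w) = (x + t • w - x₀) + (⌊t / δ⌋₊ * δ - t) • w := by
        module
      rw [e]
      refine (norm_add_le _ _).trans ?_
      have h4 : ‖((⌊t / δ⌋₊ : ℝ) * δ - t) • w‖ ≤ δ * 1 := by
        rw [norm_smul]
        refine mul_le_mul ?_ hw (norm_nonneg _) hδ.le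
        rw [Real.norm_eq_abs, abs_le]
        constructor <;> linarith
      linarith
  refine (measure_mono hsub).trans ((measure_biUnion_finset_le _ _).trans ?_)
  have hb : ∀ c : Ed d, volume (Metric.closedBall c (2 * δ)) =
      ENNReal.ofReal ((2 * δ) ^ d) * volume (Metric.ball (0 : Ed d) 1) := fun c => by
    rw [Measure.addHaar_closedBall _ _ (by positivity), finrank_euclideanSpace_fin]
  simp only [hb, Finset.sum_const, Finset.card_range, nsmul_eq_mul]
  rw [← mul_assoc]
  have hh : 1 ≤ h / δ := (one_le_div hδ).2 hδh
  have h0 : 0 ≤ 2 * h / δ := by rw [mul_div_assoc]; linarith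
  rw [ENNReal.ofReal_mul h0]
  refine mul_le_mul_left (mul_le_mul_left ?_ _) _
  rw [← ENNReal.ofReal_natCast]
  refine ENNReal.ofReal_le_ofReal ?_
  have := Nat.floor_le (zero_le_one.trans hh)
  push_cast
  rw [mul_div_assoc]
  linarith

theorem volume_sweep_le_of_ediam_le {d : ℕ} (hd : 2 ≤ d) {S : Set (Ed d)} {h : ℝ} (hh : 0 < h)
    (hS : Metric.ediam S ≤ ENNReal.ofReal h) {w : Ed d} (hw : ‖w‖ ≤ 1) :
    volume (sweep S h w) ≤ ENNReal.ofReal h * (2 ^ (d + 1) * volume (Metric.ball (0 : Ed d) 1)) *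
      ⨆ _ : S.Nonempty, Metric.ediam S ^ ((d : ℝ) - 1) := by
  rcases S.eq_empty_or_nonempty with rfl | ⟨x₀, hx₀⟩
  · simp [sweep]
  rw [ciSup_pos ⟨x₀, hx₀⟩]
  have hne : Metric.ediam S ≠ ⊤ := (hS.trans_lt ENNReal.ofReal_lt_top).ne
  set D := (Metric.ediam S).toReal with hD
  have hDe : Metric.ediam S = ENNReal.ofReal D := (ENNReal.ofReal_toReal hne).symm
  have hDh : D ≤ h := (ENNReal.ofReal_le_ofReal_iff hh.le).1 (hDe ▸ hS)
  have hsub : S ⊆ Metric.closedBall x₀ D := fun x hx => by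
    rw [Metric.mem_closedBall, dist_edist]
    exact ENNReal.toReal_mono hne (Metric.edist_le_ediam_of_mem hx hx₀)
  have key : ∀ δ, 0 < δ → D ≤ δ → δ ≤ h → volume (sweep S h w) ≤
      ENNReal.ofReal h * (2 ^ (d + 1) * volume (Metric.ball (0 : Ed d) 1)) *
        ENNReal.ofReal (δ ^ (d - 1)) := by
    intro δ hδ hDδ hδh
    refine (volume_sweep_le_of_subset_closedBall hδ hδh
      (hsub.trans (Metric.closedBall_subset_closedBall hDδ)) hw).trans (le_of_eq ?_)
    have e : 2 * h / δ * (2 * δ) ^ d = h * 2 ^ (d + 1) * δ ^ (d - 1) := by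
      obtain ⟨n, rfl⟩ : ∃ n, d = n + 1 := ⟨d - 1, by omega⟩
      rw [Nat.add_sub_cancel]
      field_simp
      ring
    rw [e, ENNReal.ofReal_mul (by positivity), ENNReal.ofReal_mul hh.le,
      ENNReal.ofReal_pow zero_le_two, ENNReal.ofReal_ofNat]
    ring
  have hexp : Metric.ediam S ^ ((d : ℝ) - 1) = ENNReal.ofReal (D ^ (d - 1)) := by
    rw [hDe, ENNReal.ofReal_pow ENNReal.toReal_nonneg, ← ENNReal.rpow_natCast,
      Nat.cast_sub (by omega), Nat.cast_one]
  rw [hexp]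
  have hD0 : 0 ≤ D := ENNReal.toReal_nonneg
  rcases hD0.eq_or_lt with h0 | h0
  · have hlim : Filter.Tendsto (fun δ : ℝ => ENNReal.ofReal h *
        (2 ^ (d + 1) * volume (Metric.ball (0 : Ed d) 1)) * ENNReal.ofReal (δ ^ (d - 1)))
        (𝓝[>] 0) (𝓝 (ENNReal.ofReal h * (2 ^ (d + 1) * volume (Metric.ball (0 : Ed d) 1)) *
          ENNReal.ofReal (D ^ (d - 1)))) := by
      refine ENNReal.Tendsto.const_mul ?_ (Or.inr ?_)
      · rw [← h0]
        exact (ENNReal.continuous_ofReal.comp (continuous_pow _)).continuousAt.mono_left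
          nhdsWithin_le_nhds
      · exact ENNReal.mul_ne_top ENNReal.ofReal_ne_top
          (ENNReal.mul_ne_top (by simp) measure_ball_lt_top.ne)
    refine ge_of_tendsto hlim ?_
    filter_upwards [Ioo_mem_nhdsGT hh] with δ hδ
    exact key δ hδ.1 (h0 ▸ hδ.1.le) hδ.2.le
  · exact key D h0 le_rfl hDh

theorem volume_sweep_le_hausdorffMeasure {d : ℕ} (hd : 2 ≤ d) (Γ : Set (Ed d)) {h : ℝ}
    (hh : 0 < h) {w : Ed d} (hw : ‖w‖ ≤ 1) :
    volume (sweep Γ h w) ≤ ENNReal.ofReal h *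
      (2 ^ (d + 1) * volume (Metric.ball (0 : Ed d) 1)) * μH[(d : ℝ) - 1] Γ := by
  set c := ENNReal.ofReal h * (2 ^ (d + 1) * volume (Metric.ball (0 : Ed d) 1)) with hc
  have hc0 : c ≠ 0 := mul_ne_zero (by simpa using hh)
    (mul_ne_zero (by simp) (Metric.measure_ball_pos _ _ one_pos).ne')
  have hct : c ≠ ⊤ := ENNReal.mul_ne_top ENNReal.ofReal_ne_top
    (ENNReal.mul_ne_top (by simp) measure_ball_lt_top.ne)
  rw [← ENNReal.div_le_iff' hc0 hct, Measure.hausdorffMeasure_apply]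
  refine le_iSup₂_of_le (ENNReal.ofReal h) (by simpa using hh)
    (le_iInf fun t => le_iInf fun hcov => le_iInf fun ht => ?_)
  rw [ENNReal.div_le_iff' hc0 hct, ← ENNReal.tsum_mul_left]
  have hsub : sweep Γ h w ⊆ ⋃ n, sweep (t n) h w := by
    rintro x ⟨s, hs, hx⟩
    obtain ⟨n, hn⟩ := mem_iUnion.1 (hcov hx)
    exact mem_iUnion.2 ⟨n, s, hs, hn⟩
  exact (measure_mono hsub).trans ((measure_iUnion_le _).trans
    (ENNReal.tsum_le_tsum fun n => volume_sweep_le_of_ediam_le hd hh (ht n) hw))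

theorem volume_box {d : ℕ} (A B : Fin d → ℝ) :
    volume {x : Ed d | ∀ m, x m ∈ Icc (A m) (B m)} = ∏ m, ENNReal.ofReal (B m - A m) := by
  rw [← Real.volume_Icc_pi, ← (EuclideanSpace.volume_preserving_symm_measurableEquiv_toLp
    (Fin d)).measure_preimage measurableSet_Icc.nullMeasurableSet]
  congr 1
  ext x
  simp [Pi.le_def, forall_and]

theorem isOpen_cube {d : ℕ} (a : Ed d) (l : ℝ) : IsOpen (cube a l) := by
  simp only [cube, Set.ofPred_forall]
  exact isOpen_iInter_of_finite fun i =>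
    isOpen_Ioo.preimage (EuclideanSpace.proj i : Ed d →L[ℝ] ℝ).continuous

theorem convex_cube {d : ℕ} (a : Ed d) (l : ℝ) : Convex ℝ (cube a l) := by
  simp only [cube, Set.ofPred_forall]
  exact convex_iInter fun i =>
    (convex_Ioo _ _).linear_preimage (EuclideanSpace.proj i : Ed d →L[ℝ] ℝ).toLinearMap

theorem closure_cube_subset {d : ℕ} (a : Ed d) (l : ℝ) :
    closure (cube a l) ⊆ {x | ∀ m, x m ∈ Icc (a m) (a m + l)} := by
  refine closure_minimal (fun x hx m => Ioo_subset_Icc_self (hx m)) ?_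
  simp only [Set.ofPred_forall]
  exact isClosed_iInter fun i =>
    isClosed_Icc.preimage (EuclideanSpace.proj i : Ed d →L[ℝ] ℝ).continuous

theorem volume_sweep_frontier_cube_le {d : ℕ} (a : Ed d) {l : ℝ} (hl : 0 < l) {h : ℝ}
    (hh : 0 < h) (hh1 : h ≤ 1) {w : Ed d} (hw : ‖w‖ ≤ 1) :
    volume (sweep (frontier (cube a l)) h w) ≤
      ENNReal.ofReal h * ENNReal.ofReal (4 * d * (l + 2) ^ (d - 1)) := by
  set bx : Fin d → ℝ → Set (Ed d) := fun k c => {x | ∀ m, x m ∈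
    Icc (if m = k then c - h else a m - 1) (if m = k then c + h else a m + l + 1)} with hbx
  have hv : ∀ k c, volume (bx k c) = ENNReal.ofReal (2 * h * (l + 2) ^ (d - 1)) := by
    intro k c
    rw [hbx, volume_box, ← Finset.mul_prod_erase _ _ (Finset.mem_univ k),
      ENNReal.ofReal_mul (by positivity), ENNReal.ofReal_pow (by positivity)]
    congr 1
    · simp only [if_true]; congr 1; ring
    · rw [Finset.prod_congr rfl (g := fun _ => ENNReal.ofReal (l + 2)), Finset.prod_const,
        Finset.card_erase_of_mem (Finset.mem_univ k), Finset.card_univ, Fintype.card_fin]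
      intro m hm
      rw [if_neg (Finset.ne_of_mem_erase hm), if_neg (Finset.ne_of_mem_erase hm)]
      congr 1; ring
  have hsub : sweep (frontier (cube a l)) h w ⊆ ⋃ k, (bx k (a k) ∪ bx k (a k + l)) := by
    rintro x ⟨t, ht, hx⟩
    rw [(isOpen_cube a l).frontier_eq] at hx
    have hcl := closure_cube_subset a l hx.1
    have hw' : ∀ m, |t * w m| ≤ h := fun m => by
      rw [abs_mul, abs_of_nonneg ht.1]
      have h1 : |w m| ≤ 1 := (PiLp.norm_apply_le w m).trans hw
      nlinarith [ht.1, ht.2, abs_nonneg (w m)]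
    have hcoord : ∀ m, (x + t • w) m = x m + t * w m := fun m => by simp
    obtain ⟨k, hk⟩ : ∃ k, (x + t • w) k ∉ Ioo (a k) (a k + l) := by
      by_contra! hcon
      exact hx.2 hcon
    have hmem : ∀ c, (x + t • w) k = c → x ∈ bx k c := by
      intro c hc m
      have h1 := abs_le.1 (hw' m)
      have h2 := hcl m
      rw [hcoord, mem_Icc] at h2
      split_ifs with hm
      · subst hm
        rw [hcoord] at hc
        constructor <;> linarith
      · constructor <;> linarith
    refine mem_iUnion.2 ⟨k, ?_⟩
    have h2 := hcl k
    rcases h2.1.eq_or_lt with h3 | h3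
    · exact Or.inl (hmem _ h3.symm)
    · rcases h2.2.eq_or_lt with h4 | h4
      · exact Or.inr (hmem _ h4)
      · exact absurd ⟨h3, h4⟩ hk
  calc _ ≤ ∑ k : Fin d, volume (bx k (a k) ∪ bx k (a k + l)) :=
        (measure_mono hsub).trans (measure_iUnion_fintype_le _ _)
    _ ≤ ∑ k : Fin d, ENNReal.ofReal (4 * h * (l + 2) ^ (d - 1)) := by
        refine Finset.sum_le_sum fun k _ => (measure_union_le _ _).trans (le_of_eq ?_)
        rw [hv, hv, ← ENNReal.ofReal_add (by positivity) (by positivity)]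
        congr 1; ring
    _ = _ := by
        rw [Finset.sum_const, Finset.card_univ, Fintype.card_fin, nsmul_eq_mul,
          ← ENNReal.ofReal_natCast, ← ENNReal.ofReal_mul (by positivity),
          ← ENNReal.ofReal_mul (by positivity)]
        congr 1; ring

theorem isClosed_sweep_planeEmb {d : ℕ} (i j : Fin d) {Γ : Set (Ed d)} (hΓ : IsClosed Γ) (h : ℝ) :
    IsClosed {q : Ed d × ℂ | q.1 ∈ sweep Γ h (planeEmb i j q.2)} := by
  have hc : IsClosed {r : (Ed d × ℂ) × Icc (0 : ℝ) h |
      r.1.1 + (r.2 : ℝ) • planeEmb i j r.1.2 ∈ Γ} := hΓ.preimage (by fun_prop)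
  convert isClosedMap_fst_of_compactSpace _ hc using 1
  ext q
  constructor
  · rintro ⟨t, ht, hq⟩
    exact ⟨(q, ⟨t, ht⟩), hq, rfl⟩
  · rintro ⟨⟨q', t⟩, hq, rfl⟩
    exact ⟨t, t.2, hq⟩

theorem lintegral_hitMeas_two_mul_le {Γ : Set ℂ} (hΓ : IsClosed Γ) {R : ℝ} (hR : 0 ≤ R) :
    ∫⁻ y, hitMeas Γ (2 * R) y ≤ 2 * ∫⁻ y, hitMeas Γ R y :=
  le_add_self.trans (lintegral_twoHitMeas_add hΓ hR).le

theorem lintegral_hitMeas_zpow_le {Γ : Set ℂ} (hΓ : IsClosed Γ) {N : ℝ≥0∞}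
    (hN : ∀ n : ℕ, ENNReal.ofReal (2 ^ n) * ∫⁻ y, hitMeas Γ ((2 ^ n)⁻¹) y ≤ N) (j : ℤ) :
    ∫⁻ y, hitMeas Γ (2 ^ j) y ≤ ENNReal.ofReal (2 ^ j) * N := by
  rcases Int.le_total j 0 with hj | hj
  · obtain ⟨n, rfl⟩ : ∃ n : ℕ, j = -n := ⟨j.natAbs, by omega⟩
    rw [zpow_neg, zpow_natCast]
    calc ∫⁻ y, hitMeas Γ ((2 ^ n)⁻¹) y
        = ENNReal.ofReal ((2 ^ n)⁻¹) * (ENNReal.ofReal (2 ^ n) *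
          ∫⁻ y, hitMeas Γ ((2 ^ n)⁻¹) y) := by
          rw [← mul_assoc, ← ENNReal.ofReal_mul (by positivity), inv_mul_cancel₀ (by positivity),
            ENNReal.ofReal_one, one_mul]
      _ ≤ _ := mul_le_mul_right (hN n) _
  · obtain ⟨n, rfl⟩ : ∃ n : ℕ, j = n := ⟨j.toNat, by omega⟩
    rw [zpow_natCast]
    clear hj
    induction n with
    | zero => simpa using hN 0
    | succ k ih =>
      rw [pow_succ', ENNReal.ofReal_mul zero_le_two, ENNReal.ofReal_ofNat, mul_assoc]
      exact (lintegral_hitMeas_two_mul_le hΓ (by positivity)).trans (mul_le_mul_right ih _)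

theorem exists_slice_hitMeas_bound {d : ℕ} {i j : Fin d} (hij : i ≠ j) {Γ : Set (Ed d)}
    (hΓ : IsClosed Γ) {B : ℝ≥0∞} (hB : ∀ h : ℝ, 0 < h → h ≤ 1 → ∀ w : Ed d, ‖w‖ ≤ 1 →
      volume (sweep Γ h w) ≤ ENNReal.ofReal h * B) :
    ∃ N : Ed d → ℝ≥0∞, Measurable N ∧
      (∀ p, ∀ k : ℤ, ∫⁻ y, hitMeas ((fun z => p + planeEmb i j z) ⁻¹' Γ) (2 ^ k) y ≤
        ENNReal.ofReal (2 ^ k) * N p) ∧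
      ∫⁻ p in sliceBase i j, N p ≤ volume (Metric.ball (0 : ℂ) 1) *
        (volume (Metric.ball (0 : ℂ) 1) * B) := by
  have hcl : ∀ p, IsClosed ((fun z => p + planeEmb i j z) ⁻¹' Γ) := fun p =>
    hΓ.preimage (by fun_prop)
  set G : ℝ → Ed d → ℝ≥0∞ := fun h x =>
    (volume.restrict (Metric.ball (0 : ℂ) 1)) {v | x ∈ sweep Γ h (planeEmb i j v)} with hG
  have hGm : ∀ h, Measurable (G h) := fun h =>
    measurable_measure_prodMk_left (isClosed_sweep_planeEmb i j hΓ h).measurableSet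
  have hGe : ∀ p h y, hitMeas ((fun z => p + planeEmb i j z) ⁻¹' Γ) h y =
      G h (p + planeEmb i j y) := by
    intro p h y
    rw [hG]
    simp only
    rw [Measure.restrict_apply' measurableSet_ball, hitMeas]
    congr 1
    ext v
    simp only [mem_ofPred_eq, mem_inter_iff, Hit, sweep, mem_preimage, map_add]
    rw [and_comm]
    simp only [← Complex.real_smul, map_smul, add_assoc]
  have hGi : ∀ h, 0 < h → h ≤ 1 → ∫⁻ x, G h x ≤
      ENNReal.ofReal h * (volume (Metric.ball (0 : ℂ) 1) * B) := by
    intro h h0 h1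
    have hs := (isClosed_sweep_planeEmb i j hΓ h).measurableSet
    rw [hG]
    have e1 := Measure.prod_apply (μ := (volume : Measure (Ed d)))
      (ν := volume.restrict (Metric.ball (0 : ℂ) 1)) hs
    have e2 := Measure.prod_apply_symm (μ := (volume : Measure (Ed d)))
      (ν := volume.restrict (Metric.ball (0 : ℂ) 1)) hs
    refine (e1.symm.trans e2).le.trans ?_
    calc _ ≤ ∫⁻ v in Metric.ball (0 : ℂ) 1, ENNReal.ofReal h * B := by
          refine setLIntegral_mono' measurableSet_ball fun v hv => ?_
          refine hB h h0 h1 (planeEmb i j v) ?_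
          rw [norm_planeEmb hij]
          exact (mem_ball_zero_iff.1 hv).le
      _ = _ := by rw [setLIntegral_const]; ring
  set ψ : ℕ → Ed d → ℝ≥0∞ := fun n p => ENNReal.ofReal (2 ^ n) *
    ∫⁻ y, hitMeas ((fun z => p + planeEmb i j z) ⁻¹' Γ) ((2 ^ n)⁻¹) y with hψ
  have hψm : ∀ n, Measurable (ψ n) := by
    intro n
    rw [hψ]
    simp only [hGe]
    have h1 := hGm ((2 ^ n)⁻¹)
    have hι := (planeEmb i j).continuous.measurable
    exact (Measurable.lintegral_prod_right'
      (f := fun q : Ed d × ℂ => G ((2 ^ n)⁻¹) (q.1 + planeEmb i j q.2)) (by fun_prop)).const_mul _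
  have hψmono : Monotone ψ := by
    refine monotone_nat_of_le_succ fun n p => ?_
    have h1 := lintegral_hitMeas_two_mul_le (hcl p) (R := (2 ^ (n + 1))⁻¹) (by positivity)
    rw [show (2 : ℝ) * (2 ^ (n + 1))⁻¹ = (2 ^ n)⁻¹ by rw [pow_succ']; field_simp] at h1
    refine (mul_le_mul_right h1 _).trans (le_of_eq ?_)
    rw [hψ]
    simp only
    rw [pow_succ (2 : ℝ) n, ENNReal.ofReal_mul (p := 2 ^ n) (by positivity), ENNReal.ofReal_ofNat,
      mul_assoc]
  refine ⟨fun p => ⨆ n, ψ n p, Measurable.iSup hψm, fun p k =>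
    lintegral_hitMeas_zpow_le (hcl p) (fun n => le_iSup (fun n => ψ n p) n) k, ?_⟩
  rw [lintegral_iSup hψm hψmono]
  refine iSup_le fun n => ?_
  have hι := (planeEmb i j).continuous.measurable
  rw [hψ]
  simp only [hGe]
  rw [lintegral_const_mul' _ _ ENNReal.ofReal_ne_top, lintegral_slice hij (hGm _)]
  refine (mul_le_mul_right (mul_le_mul_right (hGi _ (by positivity) ?_) _) _).trans (le_of_eq ?_)
  · exact inv_le_one_of_one_le₀ (one_le_pow₀ one_le_two)
  · rw [mul_left_comm, ← mul_assoc (ENNReal.ofReal _), ← ENNReal.ofReal_mul (by positivity),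
      mul_inv_cancel₀ (by positivity), ENNReal.ofReal_one, one_mul]

/-- The restriction of the components `i` and `j` of `u` to the coordinate plane through `p`. -/
def planarSlice {d : ℕ} (i j : Fin d) (u : Ed d → Ed d) (p : Ed d) (z : ℂ) : ℂ :=
  planeProj i j (u (p + planeEmb i j z))

/-- The skew part of the gradient. -/
def spinD {d : ℕ} (u : Ed d → Ed d) (i j : Fin d) (x : Ed d) : ℝ :=
  (mgradD u x j i - mgradD u x i j) / 2

open Classical in
/-- The norm of the symmetrized gradient, set to `⊤` on `Γ` and where `u` is not differentiable. -/
def strainDensity {d : ℕ} (Γ : Set (Ed d)) (u : Ed d → Ed d) (x : Ed d) : ℝ≥0∞ :=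
  if x ∈ Γ ∨ ¬ DifferentiableAt ℝ u x then ⊤ else ENNReal.ofReal (matNormD (symGradD u x))

theorem measurable_mgradD {d : ℕ} (u : Ed d → Ed d) (i j : Fin d) :
    Measurable fun x => mgradD u x i j :=
  (EuclideanSpace.proj i : Ed d →L[ℝ] ℝ).continuous.measurable.comp
    (measurable_fderiv_apply_const ℝ u (EuclideanSpace.single j (1 : ℝ)))

theorem measurable_spinD {d : ℕ} (u : Ed d → Ed d) (i j : Fin d) : Measurable (spinD u i j) :=
  ((measurable_mgradD u j i).sub (measurable_mgradD u i j)).div_const 2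

theorem measurable_matNormD_mgradD {d : ℕ} (u : Ed d → Ed d) :
    Measurable fun x => matNormD (mgradD u x) :=
  (Finset.measurable_sum _ fun i _ => Finset.measurable_sum _ fun j _ =>
    (measurable_mgradD u i j).pow_const 2).sqrt

theorem measurable_matNormD_symGradD {d : ℕ} (u : Ed d → Ed d) :
    Measurable fun x => matNormD (symGradD u x) :=
  (Finset.measurable_sum _ fun i _ => Finset.measurable_sum _ fun j _ =>
    (((measurable_mgradD u i j).add (measurable_mgradD u j i)).div_const 2).pow_const 2).sqrt

theorem measurable_strainDensity {d : ℕ} {Γ : Set (Ed d)} (hΓ : IsClosed Γ) (u : Ed d → Ed d) :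
    Measurable (strainDensity Γ u) := by
  refine Measurable.ite (hΓ.measurableSet.union
    (measurableSet_of_differentiableAt ℝ u).compl) measurable_const ?_
  exact (measurable_matNormD_symGradD u).ennreal_ofReal

theorem strainDensity_ne_top {d : ℕ} {Γ : Set (Ed d)} {u : Ed d → Ed d} {x : Ed d}
    (h : strainDensity Γ u x ≠ ⊤) : x ∉ Γ ∧ DifferentiableAt ℝ u x ∧
      strainDensity Γ u x = ENNReal.ofReal (matNormD (symGradD u x)) := by
  unfold strainDensity at h ⊢
  split_ifs at h ⊢ with h1
  · exact absurd rfl h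
  · push Not at h1
    exact ⟨h1.1, h1.2, rfl⟩

theorem strainDensity_eq {d : ℕ} {Γ : Set (Ed d)} {u : Ed d → Ed d} {x : Ed d}
    (h1 : x ∉ Γ) (h2 : DifferentiableAt ℝ u x) :
    strainDensity Γ u x = ENNReal.ofReal (matNormD (symGradD u x)) := by
  rw [strainDensity, if_neg]
  push Not
  exact ⟨h1, h2⟩

theorem hasFDerivAt_planarSlice {d : ℕ} (i j : Fin d) {u : Ed d → Ed d} {p : Ed d} {z : ℂ}
    (h : DifferentiableAt ℝ u (p + planeEmb i j z)) :
    HasFDerivAt (planarSlice i j u p)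
      ((planeProj i j).comp ((fderiv ℝ u (p + planeEmb i j z)).comp (planeEmb i j))) z :=
  (planeProj i j).hasFDerivAt.comp z
    (h.hasFDerivAt.comp z ((planeEmb i j).hasFDerivAt.const_add p))

theorem fderiv_planarSlice {d : ℕ} (i j : Fin d) {u : Ed d → Ed d} {p : Ed d} {z : ℂ}
    (h : DifferentiableAt ℝ u (p + planeEmb i j z)) (ζ : ℂ) :
    fderiv ℝ (planarSlice i j u p) z ζ =
      ⟨ζ.re * mgradD u (p + planeEmb i j z) i i + ζ.im * mgradD u (p + planeEmb i j z) i j,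
        ζ.re * mgradD u (p + planeEmb i j z) j i + ζ.im * mgradD u (p + planeEmb i j z) j j⟩ := by
  rw [(hasFDerivAt_planarSlice i j h).fderiv]
  simp only [ContinuousLinearMap.comp_apply, planeProj_apply, planeEmb_apply, map_add, map_smul]
  apply Complex.ext <;> simp [mgradD]

theorem rot_planarSlice {d : ℕ} (i j : Fin d) {u : Ed d → Ed d} {p : Ed d} {z : ℂ}
    (h : DifferentiableAt ℝ u (p + planeEmb i j z)) :
    rot (planarSlice i j u p) z = spinD u i j (p + planeEmb i j z) := by
  rw [rot, fderiv_planarSlice i j h, fderiv_planarSlice i j h, spinD]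
  simp

theorem abs_quadraticForm_le_matNormD {d : ℕ} {i j : Fin d} (hij : i ≠ j)
    (S : Matrix (Fin d) (Fin d) ℝ) (hS : S i j = S j i) (x y : ℝ) :
    |S i i * x ^ 2 + 2 * S i j * (x * y) + S j j * y ^ 2| ≤ matNormD S * (x ^ 2 + y ^ 2) := by
  have h1 : S i i ^ 2 + 2 * S i j ^ 2 + S j j ^ 2 ≤ ∑ a, ∑ b, S a b ^ 2 := by
    have h2 : ∀ a, S a i ^ 2 + S a j ^ 2 ≤ ∑ b, S a b ^ 2 := fun a => by
      rw [← Finset.sum_pair (f := fun b => S a b ^ 2) hij]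
      exact Finset.sum_le_univ_sum_of_nonneg fun k => sq_nonneg _
    have h3 : (∑ b, S i b ^ 2) + ∑ b, S j b ^ 2 ≤ ∑ a, ∑ b, S a b ^ 2 := by
      rw [← Finset.sum_pair (f := fun a => ∑ b, S a b ^ 2) hij]
      exact Finset.sum_le_univ_sum_of_nonneg fun k => Finset.sum_nonneg fun b _ => sq_nonneg _
    have := h2 i
    have := h2 j
    rw [← hS] at this
    linarith
  have h0 : 0 ≤ matNormD S := Real.sqrt_nonneg _
  refine abs_le_of_sq_le_sq ?_ (by positivity)
  have h4 : matNormD S ^ 2 = ∑ a, ∑ b, S a b ^ 2 :=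
    Real.sq_sqrt (Finset.sum_nonneg fun a _ => Finset.sum_nonneg fun b _ => sq_nonneg _)
  rw [mul_pow, h4]
  refine le_trans ?_ (mul_le_mul_of_nonneg_right h1 (sq_nonneg _))
  nlinarith only [sq_nonneg (S i i * (x * y) - S i j * x ^ 2), sq_nonneg (S j j * (x * y) - S i j * y ^ 2),
    sq_nonneg (S i i * y ^ 2 - S j j * x ^ 2), sq_nonneg (S i j * x ^ 2 - S i i * (x * y)),
    sq_nonneg (S i j * (x ^ 2 - y ^ 2)), sq_nonneg (S i i * (x * y)), sq_nonneg (S i i * y ^ 2),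
    sq_nonneg (S j j * (x * y)), sq_nonneg (S j j * x ^ 2)]

theorem planarData_slice {d : ℕ} {i j : Fin d} (hij : i ≠ j) {Γ : Set (Ed d)} (hΓ : IsClosed Γ)
    {u : Ed d → Ed d}
    (hu : ∀ x ∉ Γ, ∃ t ∈ 𝓝 x, ∃ L : ℝ≥0, LipschitzOnWith L u t) (p : Ed d) :
    PlanarData ((fun z => p + planeEmb i j z) ⁻¹' Γ) (planarSlice i j u p)
      (fun z => strainDensity Γ u (p + planeEmb i j z)) where
  isClosed := hΓ.preimage (by fun_prop)
  lip y hy := by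
    obtain ⟨t, ht, L, hL⟩ := hu _ hy
    have hcont : Continuous fun z => p + planeEmb i j z := by fun_prop
    have hlip : LipschitzWith ‖planeEmb i j‖₊ fun z => p + planeEmb i j z := fun z w => by
      rw [edist_add_left]
      exact (planeEmb i j).lipschitz z w
    exact ⟨(fun z => p + planeEmb i j z) ⁻¹' t, hcont.continuousAt ht, _,
      (planeProj i j).lipschitz.comp_lipschitzOnWith (hL.comp hlip.lipschitzOnWith fun z hz => hz)⟩
  measurable := (measurable_strainDensity hΓ u).comp
    (by fun_prop : Continuous fun z => p + planeEmb i j z).measurable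
  eq_top y hy := if_pos (Or.inl hy)
  differentiableAt y hy :=
    (hasFDerivAt_planarSlice i j (strainDensity_ne_top hy).2.1).differentiableAt
  strain_le y hy ζ := by
    obtain ⟨-, h1, h2⟩ := strainDensity_ne_top hy
    rw [h2, ENNReal.toReal_ofReal
      (show 0 ≤ matNormD (symGradD u (p + planeEmb i j y)) from Real.sqrt_nonneg _),
      fderiv_planarSlice i j h1, Complex.sq_norm,
      Complex.normSq_apply]
    have h3 := abs_quadraticForm_le_matNormD hij (symGradD u (p + planeEmb i j y))
      (by simp only [symGradD]; ring) ζ.re ζ.im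
    convert h3 using 2
    · simp only [symGradD, Complex.mul_re, Complex.conj_re, Complex.conj_im]
      ring
    · ring

theorem lintegral_abs_spinD_le {d : ℕ} {i j : Fin d} (hij : i ≠ j) {Γ : Set (Ed d)}
    (hΓ : IsClosed Γ) {u : Ed d → Ed d}
    (hu : ∀ x ∉ Γ, ∃ t ∈ 𝓝 x, ∃ L : ℝ≥0, LipschitzOnWith L u t)
    (hdiff : ∀ᵐ x, DifferentiableAt ℝ u x) {M : ℝ} (hM0 : 0 < M) (hM : ∀ x ∉ Γ, ‖u x‖ ≤ M)
    {D : Set (Ed d)} (hDm : MeasurableSet D) (hD : ∀ᵐ x, x ∉ D → spinD u i j x = 0) {B : ℝ≥0∞}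
    (hB : ∀ h : ℝ, 0 < h → h ≤ 1 → ∀ w : Ed d, ‖w‖ ≤ 1 →
      volume (sweep Γ h w) ≤ ENNReal.ofReal h * B)
    (hfin : ∫⁻ x, ENNReal.ofReal |spinD u i j x| ≠ ⊤) {a : ℝ} (ha : 0 < a) :
    ∫⁻ x, ENNReal.ofReal |spinD u i j x| ≤ 4 * (ENNReal.ofReal a * volume D +
      ENNReal.ofReal (10 ^ 82 * M) * B +
      ENNReal.ofReal (10 ^ 152 / a) * ∫⁻ x, strainDensity Γ u x ^ 2) := by
  set V := volume (Metric.ball (0 : ℂ) 1) with hV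
  have hV0 : V ≠ 0 := (Metric.measure_ball_pos _ _ one_pos).ne'
  have hVt : V ≠ ⊤ := measure_ball_lt_top.ne
  obtain ⟨N, hNm, hN, hNi⟩ := exists_slice_hitMeas_bound hij hΓ hB
  have hsm : Measurable fun x => ENNReal.ofReal |spinD u i j x| :=
    (measurable_spinD u i j).abs.ennreal_ofReal
  have hfm := (measurable_strainDensity hΓ u).pow_const 2
  have hDi : Measurable (D.indicator (1 : Ed d → ℝ≥0∞)) := measurable_one.indicator hDm
  have hι := (planeEmb i j).continuous.measurable
  have hslice_m : ∀ g : Ed d → ℝ≥0∞, Measurable g →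
      Measurable fun p => ∫⁻ z, g (p + planeEmb i j z) := fun g hg =>
    Measurable.lintegral_prod_right' (f := fun q : Ed d × ℂ => g (q.1 + planeEmb i j q.2))
      (by fun_prop)
  have hfinp : ∀ᵐ p ∂(volume.restrict (sliceBase i j)),
      ∫⁻ z, ENNReal.ofReal |spinD u i j (p + planeEmb i j z)| < ⊤ := by
    refine ae_lt_top (hslice_m _ hsm) ?_
    rw [lintegral_slice hij hsm]
    exact ENNReal.mul_ne_top hVt hfin
  refine (ENNReal.mul_le_mul_iff_right hV0 hVt).1 ?_
  calc V * ∫⁻ x, ENNReal.ofReal |spinD u i j x|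
      = ∫⁻ p in sliceBase i j, ∫⁻ z, ENNReal.ofReal |spinD u i j (p + planeEmb i j z)| :=
        (lintegral_slice hij hsm).symm
    _ ≤ ∫⁻ p in sliceBase i j, 4 * (ENNReal.ofReal a *
          (∫⁻ z, D.indicator 1 (p + planeEmb i j z)) + ENNReal.ofReal (10 ^ 81 * M) * N p +
          ENNReal.ofReal (10 ^ 152 / a) * ∫⁻ z, strainDensity Γ u (p + planeEmb i j z) ^ 2) := by
        refine lintegral_mono_ae ?_
        filter_upwards [ae_slice hij hdiff, ae_slice hij hD, hfinp] with p h1 h2 h3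
        have h4 : ∀ᵐ z, rot (planarSlice i j u p) z = spinD u i j (p + planeEmb i j z) := by
          filter_upwards [h1] with z hz using rot_planarSlice i j hz
        have h5 : ∫⁻ z, ENNReal.ofReal |spinD u i j (p + planeEmb i j z)| =
            ∫⁻ z, ENNReal.ofReal |rot (planarSlice i j u p) z| :=
          lintegral_congr_ae (h4.mono fun z hz => by simp only [hz])
        rw [h5] at h3 ⊢
        have hpre : Measurable fun z => p + planeEmb i j z := by fun_prop
        have h6 : ∫⁻ z, D.indicator 1 (p + planeEmb i j z) =
            volume ((fun z => p + planeEmb i j z) ⁻¹' D) := by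
          rw [← lintegral_indicator_one (hpre hDm)]; rfl
        rw [h6]
        refine lintegral_abs_rot_le (planarData_slice hij hΓ hu p) hM0
          (fun y hy => (norm_planeProj_le hij _).trans (hM _ hy)) ?_ (hN p) h3.ne ha
        filter_upwards [h2, h4] with z hz2 hz4 hz
        rw [hz4, hz2 hz]
    _ = 4 * (ENNReal.ofReal a * (V * volume D) +
          ENNReal.ofReal (10 ^ 81 * M) * (∫⁻ p in sliceBase i j, N p) +
          ENNReal.ofReal (10 ^ 152 / a) * (V * ∫⁻ x, strainDensity Γ u x ^ 2)) := by
        have m1 := (hslice_m _ hDi).const_mul (ENNReal.ofReal a)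
        have m2 := hNm.const_mul (ENNReal.ofReal (10 ^ 81 * M))
        rw [lintegral_const_mul' _ _ (by simp),
          lintegral_add_left (f := fun p => ENNReal.ofReal a * _ + ENNReal.ofReal _ * N p)
            (m1.add m2), lintegral_add_left m1, lintegral_const_mul' _ _ ENNReal.ofReal_ne_top,
          lintegral_const_mul' _ _ ENNReal.ofReal_ne_top,
          lintegral_const_mul' _ _ ENNReal.ofReal_ne_top, lintegral_slice hij hDi,
          lintegral_slice hij hfm, lintegral_indicator_one hDm]
    _ ≤ 4 * (ENNReal.ofReal a * (V * volume D) +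
          ENNReal.ofReal (10 ^ 81 * M) * (V * (ENNReal.ofReal 10 * B)) +
          ENNReal.ofReal (10 ^ 152 / a) * (V * ∫⁻ x, strainDensity Γ u x ^ 2)) := by
        have hV10 : V ≤ ENNReal.ofReal 10 := (volume_ball_le_ofReal 0 zero_le_one).trans
          (ENNReal.ofReal_le_ofReal (by norm_num))
        gcongr
        exact hNi.trans (by gcongr)
    _ = _ := by
        rw [show (10 : ℝ) ^ 82 * M = 10 ^ 81 * M * 10 by ring,
          ENNReal.ofReal_mul (q := 10) (by positivity)]
        ring

theorem FinSimplexUnion.isClosed {d : ℕ} {Γ : Set (Ed d)} (h : FinSimplexUnion d Γ) :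
    IsClosed Γ := by
  obtain ⟨n, f, -, rfl⟩ := h
  exact isClosed_iUnion_of_finite fun k => (finite_range (f k)).isClosed_convexHull ℝ

theorem FinSimplexUnion.volume_eq_zero {d : ℕ} (hd : 0 < d) {Γ : Set (Ed d)}
    (h : FinSimplexUnion d Γ) : volume Γ = 0 := by
  obtain ⟨n, f, -, rfl⟩ := h
  refine measure_iUnion_null fun k => ?_
  refine measure_mono_null (convexHull_subset_affineSpan _)
    (Measure.addHaar_affineSubspace _ _ fun htop => ?_)
  have h1 := congrArg AffineSubspace.direction htop
  rw [direction_affineSpan, AffineSubspace.direction_top] at h1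
  have h2 := finrank_vectorSpan_range_le ℝ (f k) (n := d - 1) (by simp; omega)
  rw [h1, finrank_top, finrank_euclideanSpace_fin] at h2
  omega

theorem ae_differentiableAt_of_locally_lipschitz {d : ℕ} {u : Ed d → Ed d} {U : Set (Ed d)}
    (hu : ∀ x ∈ U, ∃ t ∈ 𝓝 x, ∃ L : ℝ≥0, LipschitzOnWith L u t) :
    ∀ᵐ x, x ∈ U → DifferentiableAt ℝ u x := by
  have h : volume {x | x ∈ U ∧ ¬ DifferentiableAt ℝ u x} = 0 := by
    refine measure_null_of_locally_null _ fun x hx => ?_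
    obtain ⟨t, ht, L, hL⟩ := hu x hx.1
    refine ⟨{x | x ∈ U ∧ ¬ DifferentiableAt ℝ u x} ∩ interior t,
      inter_mem_nhdsWithin _ (interior_mem_nhds.2 ht), ?_⟩
    refine measure_mono_null ?_ (ae_iff.1 (hL.ae_differentiableWithinAt_of_mem (μ := volume)))
    rintro y ⟨⟨-, hy'⟩, hy⟩ hd
    exact hy' ((hd (interior_subset hy)).differentiableAt (mem_interior_iff_mem_nhds.1 hy))
  rw [ae_iff]
  simpa using h

theorem norm_le_toReal_eLpNorm_top {d : ℕ} {u : Ed d → Ed d} {Q U : Set (Ed d)} (hU : IsOpen U)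
    (hUQ : U ⊆ Q) (hu : ContinuousOn u U) (hfin : eLpNorm u ⊤ (volume.restrict Q) ≠ ⊤) :
    ∀ x ∈ U, ‖u x‖ ≤ (eLpNorm u ⊤ (volume.restrict Q)).toReal := by
  intro x hx
  by_contra! hlt
  set M := (eLpNorm u ⊤ (volume.restrict Q)).toReal with hM
  have hV : IsOpen (U ∩ {y | M < ‖u y‖}) :=
    (hu.norm).isOpen_inter_preimage hU isOpen_Ioi
  have hpos : 0 < volume (U ∩ {y | M < ‖u y‖}) := hV.measure_pos _ ⟨x, hx, hlt⟩
  have h1 : ∀ᵐ y ∂(volume.restrict Q), ‖u y‖ₑ ≤ eLpNorm u ⊤ (volume.restrict Q) := by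
    rw [eLpNorm_exponent_top]
    exact ae_le_eLpNormEssSup
  have h2 : (volume.restrict (U ∩ {y | M < ‖u y‖})) (U ∩ {y | M < ‖u y‖}) = 0 := by
    have h3 := ae_mono (Measure.restrict_mono (inter_subset_left.trans hUQ) le_rfl :
      volume.restrict (U ∩ {y | M < ‖u y‖}) ≤ volume.restrict Q) h1
    refine measure_mono_null (show _ ⊆ {y | ¬ ‖u y‖ₑ ≤ eLpNorm u ⊤ (volume.restrict Q)} from
      fun y hy hy' => ?_) (ae_iff.1 h3)
    have h4 := ENNReal.toReal_mono hfin hy'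
    rw [toReal_enorm] at h4
    exact absurd hy.2 (not_lt.2 h4)
  rw [Measure.restrict_apply_self] at h2
  exact hpos.ne' h2

theorem matNormD_eq_norm {d : ℕ} (A : Matrix (Fin d) (Fin d) ℝ) :
    matNormD A = ‖(WithLp.toLp 2 fun p : Fin d × Fin d => A p.1 p.2)‖ := by
  rw [EuclideanSpace.norm_eq, Fintype.sum_prod_type]
  simp [matNormD]

theorem matNormD_add_le {d : ℕ} (A B : Matrix (Fin d) (Fin d) ℝ) :
    matNormD (A + B) ≤ matNormD A + matNormD B := by
  rw [matNormD_eq_norm, matNormD_eq_norm, matNormD_eq_norm]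
  exact norm_add_le (WithLp.toLp 2 fun p : Fin d × Fin d => A p.1 p.2)
    (WithLp.toLp 2 fun p : Fin d × Fin d => B p.1 p.2)

theorem matNormD_le_sum_abs {d : ℕ} (A : Matrix (Fin d) (Fin d) ℝ) :
    matNormD A ≤ ∑ p : Fin d × Fin d, |A p.1 p.2| := by
  rw [matNormD_eq_norm, EuclideanSpace.norm_eq]
  refine Real.sqrt_le_iff.2 ⟨by positivity, ?_⟩
  exact Finset.sum_sq_le_sq_sum_of_nonneg fun p _ => norm_nonneg _

theorem matNormD_mgradD_le {d : ℕ} (u : Ed d → Ed d) (x : Ed d) :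
    matNormD (mgradD u x) ≤
      matNormD (symGradD u x) + ∑ p : Fin d × Fin d, |spinD u p.1 p.2 x| := by
  have h1 : mgradD u x = symGradD u x + Matrix.of fun i j => spinD u j i x := by
    ext i j
    simp only [Matrix.add_apply, Matrix.of_apply, symGradD, spinD]
    ring
  rw [h1]
  refine (matNormD_add_le _ _).trans (add_le_add_right ((matNormD_le_sum_abs _).trans
    (le_of_eq ?_)) _)
  exact (Equiv.prodComm _ _).sum_comp fun p : Fin d × Fin d => |spinD u p.1 p.2 x|

theorem abs_mgradD_le {d : ℕ} (u : Ed d → Ed d) (x : Ed d) (i j : Fin d) :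
    |mgradD u x i j| ≤ matNormD (mgradD u x) := by
  rw [matNormD_eq_norm]
  exact PiLp.norm_apply_le (WithLp.toLp 2 fun p : Fin d × Fin d => mgradD u x p.1 p.2) (i, j)

theorem abs_spinD_le {d : ℕ} (u : Ed d → Ed d) (i j : Fin d) (x : Ed d) :
    |spinD u i j x| ≤ matNormD (mgradD u x) := by
  have h1 := abs_le.1 (abs_mgradD_le u x i j)
  have h2 := abs_le.1 (abs_mgradD_le u x j i)
  rw [spinD, abs_le]
  constructor <;> linarith [h1.1, h1.2, h2.1, h2.2]

theorem mgradD_congr {d : ℕ} {u v : Ed d → Ed d} {x : Ed d} (h : u =ᶠ[𝓝 x] v) :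
    mgradD u x = mgradD v x := by
  ext i j
  simp only [mgradD, h.fderiv_eq]

theorem volume_cube_le {d : ℕ} (a : Ed d) (l : ℝ) :
    volume (cube a l) ≤ ENNReal.ofReal l ^ d := by
  refine (measure_mono (subset_closure.trans (closure_cube_subset a l))).trans ?_
  have h := volume_box a.ofLp fun m => a m + l
  simp only [add_sub_cancel_left, Finset.prod_const, Finset.card_univ, Fintype.card_fin] at h
  exact h.le

theorem indicator_eventuallyEq_self {d : ℕ} {Q : Set (Ed d)} (hQ : IsOpen Q) (u : Ed d → Ed d)
    {x : Ed d} (hx : x ∈ Q) : Q.indicator u =ᶠ[𝓝 x] u := by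
  filter_upwards [hQ.mem_nhds hx] with y hy using indicator_of_mem hy u

theorem indicator_eventuallyEq_zero {d : ℕ} {Q : Set (Ed d)} (u : Ed d → Ed d)
    {x : Ed d} (hx : x ∉ closure Q) : Q.indicator u =ᶠ[𝓝 x] fun _ => 0 := by
  filter_upwards [isClosed_closure.isOpen_compl.mem_nhds hx] with y hy
  exact indicator_of_notMem (fun h => hy (subset_closure h)) u

theorem mgradD_eq_zero {d : ℕ} {u : Ed d → Ed d} {x : Ed d} (h : u =ᶠ[𝓝 x] fun _ => 0) :
    mgradD u x = 0 := by
  rw [mgradD_congr h]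
  ext i j
  simp [mgradD]

theorem exists_lipschitzOnWith_indicator {d : ℕ} {Q Γ : Set (Ed d)} (hQ : IsOpen Q)
    {u : Ed d → Ed d} (hu : ∀ x ∈ Q \ Γ, ∃ t ∈ 𝓝 x, ∃ L : ℝ≥0, LipschitzOnWith L u t)
    (x : Ed d) (hx : x ∉ Γ ∪ frontier Q) :
    ∃ t ∈ 𝓝 x, ∃ L : ℝ≥0, LipschitzOnWith L (Q.indicator u) t := by
  rw [mem_union, not_or] at hx
  by_cases hxQ : x ∈ Q
  · obtain ⟨t, ht, L, hL⟩ := hu x ⟨hxQ, hx.1⟩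
    refine ⟨t ∩ Q, Filter.inter_mem ht (hQ.mem_nhds hxQ), L, fun y hy z hz => ?_⟩
    rw [indicator_of_mem hy.2, indicator_of_mem hz.2]
    exact hL hy.1 hz.1
  · have hxc : x ∉ closure Q := fun h => hx.2 ⟨h, fun h' => hxQ (interior_subset h')⟩
    refine ⟨_, isClosed_closure.isOpen_compl.mem_nhds hxc, 0, fun y hy z hz => ?_⟩
    rw [indicator_of_notMem fun h => hy (subset_closure h),
      indicator_of_notMem fun h => hz (subset_closure h)]
    simp

theorem matNormD_nonneg {d : ℕ} (A : Matrix (Fin d) (Fin d) ℝ) : 0 ≤ matNormD A :=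
  Real.sqrt_nonneg _

theorem eLpNorm_two_sq {α : Type*} [MeasurableSpace α] (μ : Measure α) {f : α → ℝ}
    (hf : ∀ x, 0 ≤ f x) : eLpNorm f 2 μ ^ 2 = ∫⁻ x, ENNReal.ofReal (f x) ^ 2 ∂μ := by
  have h := eLpNorm_nnreal_pow_eq_lintegral (f := f) (μ := μ) (p := 2) two_ne_zero
  have h2 : ((2 : ℝ≥0) : ℝ) = (2 : ℕ) := rfl
  rw [h2, ENNReal.rpow_natCast] at h
  refine Eq.trans h (lintegral_congr fun x => ?_)
  rw [ENNReal.rpow_natCast, Real.enorm_of_nonneg (hf x)]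

theorem lintegral_abs_spinD_cube_le {d : ℕ} (hd : 2 ≤ d) {i j : Fin d} (hij : i ≠ j) (a : Ed d)
    {l : ℝ} (hl : 0 < l) {u : Ed d → Ed d} {Γ : Set (Ed d)} (hu : IsWd d (cube a l) u Γ)
    {M : ℝ} (hM0 : 0 < M) (hM : ∀ x ∈ cube a l \ Γ, ‖u x‖ ≤ M)
    (hF : eLpNorm (fun x => matNormD (symGradD u x)) 2 (volume.restrict (cube a l)) ≠ ⊤) :
    ∫⁻ x in cube a l, ENNReal.ofReal |spinD u i j x| ≤
      4 * ((eLpNorm (fun x => matNormD (symGradD u x)) 2 (volume.restrict (cube a l)) +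
          ENNReal.ofReal M) * ENNReal.ofReal l ^ d +
        ENNReal.ofReal (10 ^ 82) * ENNReal.ofReal M *
          (2 ^ (d + 1) * volume (Metric.ball (0 : Ed d) 1) * μH[(d : ℝ) - 1] Γ +
            ENNReal.ofReal (4 * d * (l + 2) ^ (d - 1))) +
        ENNReal.ofReal (10 ^ 152) *
          eLpNorm (fun x => matNormD (symGradD u x)) 2 (volume.restrict (cube a l))) := by
  obtain ⟨-, hΓ, hlip, K, hK⟩ := hu
  set Q := cube a l with hQ
  set F := eLpNorm (fun x => matNormD (symGradD u x)) 2 (volume.restrict Q) with hFdef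
  have hQo : IsOpen Q := isOpen_cube a l
  have hQm : MeasurableSet Q := hQo.measurableSet
  have hΓ0 : ∀ᵐ x, x ∉ Γ := measure_eq_zero_iff_ae_notMem.1 (hΓ.volume_eq_zero (by omega))
  have hfr0 : ∀ᵐ x, x ∉ frontier Q :=
    measure_eq_zero_iff_ae_notMem.1 ((convex_cube a l).addHaar_frontier volume)
  have hout : ∀ x, x ∉ Q → x ∉ frontier Q → x ∉ closure Q := fun x h1 h2 h3 =>
    h2 ⟨h3, fun h4 => h1 (interior_subset h4)⟩
  set v := Q.indicator u with hv
  have hgrad : ∀ x ∈ Q, mgradD v x = mgradD u x := fun x hx =>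
    mgradD_congr (indicator_eventuallyEq_self hQo u hx)
  have hgrad0 : ∀ x, x ∉ Q → x ∉ frontier Q → mgradD v x = 0 := fun x h1 h2 =>
    mgradD_eq_zero (indicator_eventuallyEq_zero u (hout x h1 h2))
  have hspin : (fun x => ENNReal.ofReal |spinD v i j x|) =ᵐ[volume]
      Q.indicator fun x => ENNReal.ofReal |spinD u i j x| := by
    filter_upwards [hfr0] with x hx
    by_cases hxQ : x ∈ Q
    · simp only [indicator_of_mem hxQ, spinD, hgrad x hxQ]
    · simp [indicator_of_notMem hxQ, spinD, hgrad0 x hxQ hx]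
  have hspinint : ∫⁻ x, ENNReal.ofReal |spinD v i j x| =
      ∫⁻ x in Q, ENNReal.ofReal |spinD u i j x| := by
    rw [lintegral_congr_ae hspin, lintegral_indicator hQm]
  have hdiff : ∀ᵐ x, DifferentiableAt ℝ v x := by
    filter_upwards [hΓ0, hfr0, ae_differentiableAt_of_locally_lipschitz
      (U := (Γ ∪ frontier Q)ᶜ) fun x hx => exists_lipschitzOnWith_indicator hQo hlip x hx]
      with x h1 h2 h3
    exact h3 fun h => h.elim h1 h2
  have hstrain : ∫⁻ x, strainDensity (Γ ∪ frontier Q) v x ^ 2 = F ^ 2 := by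
    rw [hFdef, eLpNorm_two_sq _ fun x => matNormD_nonneg _, ← lintegral_indicator hQm]
    refine lintegral_congr_ae ?_
    filter_upwards [hΓ0, hfr0, hdiff] with x h1 h2 h3
    rw [strainDensity_eq (fun h => h.elim h1 h2) h3]
    by_cases hxQ : x ∈ Q
    · have h4 : symGradD v x = symGradD u x := by
        ext k m
        simp only [symGradD, hgrad x hxQ]
      rw [h4, indicator_of_mem hxQ]
    · simp [indicator_of_notMem hxQ, symGradD, hgrad0 x hxQ h2, matNormD]
  have hvol : volume Q ≤ ENNReal.ofReal l ^ d := volume_cube_le a l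
  have hvolt : volume Q ≠ ⊤ := ne_top_of_le_ne_top (by finiteness) hvol
  have hfin : ∫⁻ x, ENNReal.ofReal |spinD v i j x| ≠ ⊤ := by
    rw [hspinint]
    have h1 : ∫⁻ x in Q, ENNReal.ofReal |spinD u i j x| ≤ ∫⁻ x in Q, ENNReal.ofReal K := by
      refine lintegral_mono_ae ?_
      filter_upwards [ae_restrict_mem hQm, ae_restrict_of_ae hΓ0, ae_restrict_of_ae hK]
        with x h1 h2 h3
      exact ENNReal.ofReal_le_ofReal ((abs_spinD_le u i j x).trans (h3 ⟨h1, h2⟩))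
    refine ne_top_of_le_ne_top ?_ h1
    rw [setLIntegral_const]
    finiteness
  set B := 2 ^ (d + 1) * volume (Metric.ball (0 : Ed d) 1) * μH[(d : ℝ) - 1] Γ +
    ENNReal.ofReal (4 * d * (l + 2) ^ (d - 1)) with hB
  have hsweep : ∀ h : ℝ, 0 < h → h ≤ 1 → ∀ w : Ed d, ‖w‖ ≤ 1 →
      volume (sweep (Γ ∪ frontier Q) h w) ≤ ENNReal.ofReal h * B := by
    intro h hh hh1 w hw
    rw [sweep_union, hB, mul_add, ← mul_assoc]
    exact (measure_union_le _ _).trans (add_le_add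
      (volume_sweep_le_hausdorffMeasure hd Γ hh hw)
      (volume_sweep_frontier_cube_le a hl hh hh1 hw))
  have hbound : ∀ x ∉ Γ ∪ frontier Q, ‖v x‖ ≤ M := by
    intro x hx
    by_cases hxQ : x ∈ Q
    · rw [hv, indicator_of_mem hxQ]
      exact hM x ⟨hxQ, fun h => hx (Or.inl h)⟩
    · rw [hv, indicator_of_notMem hxQ, norm_zero]
      exact hM0.le
  have hspin0 : ∀ᵐ x, x ∉ Q → spinD v i j x = 0 := by
    filter_upwards [hfr0] with x hx hxQ
    simp [spinD, hgrad0 x hxQ hx]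
  have hα : 0 < F.toReal + M := by positivity
  have key := lintegral_abs_spinD_le hij (hΓ.isClosed.union isClosed_frontier)
    (exists_lipschitzOnWith_indicator hQo hlip) hdiff hM0 hbound hQm
    hspin0 hsweep hfin hα
  rw [hspinint, hstrain] at key
  refine key.trans ?_
  have h1 : ENNReal.ofReal (F.toReal + M) = F + ENNReal.ofReal M := by
    rw [ENNReal.ofReal_add ENNReal.toReal_nonneg hM0.le, ENNReal.ofReal_toReal hF]
  have h2 : ENNReal.ofReal (10 ^ 152 / (F.toReal + M)) * F ^ 2 ≤ ENNReal.ofReal (10 ^ 152) * F := by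
    conv_lhs => rw [← ENNReal.ofReal_toReal hF]
    conv_rhs => rw [← ENNReal.ofReal_toReal hF]
    rw [← ENNReal.ofReal_pow ENNReal.toReal_nonneg, ← ENNReal.ofReal_mul (by positivity),
      ← ENNReal.ofReal_mul (by positivity)]
    refine ENNReal.ofReal_le_ofReal ?_
    rw [ENNReal.toReal_ofReal ENNReal.toReal_nonneg, div_mul_eq_mul_div, div_le_iff₀ hα, mul_assoc]
    have := mul_nonneg (ENNReal.toReal_nonneg (a := F)) hM0.le
    nlinarith only [this]
  rw [h1, ENNReal.ofReal_mul (by positivity)]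
  gcongr

theorem lintegral_matNormD_mgradD_cube_le {d : ℕ} (hd : 2 ≤ d) (a : Ed d) {l : ℝ} (hl : 0 < l) :
    ∃ C : ℝ≥0∞, C ≠ ⊤ ∧ ∀ (u : Ed d → Ed d) (Γ : Set (Ed d)), IsWd d (cube a l) u Γ →
      ∀ M : ℝ, 0 < M → (∀ x ∈ cube a l \ Γ, ‖u x‖ ≤ M) →
      eLpNorm (fun x => matNormD (symGradD u x)) 2 (volume.restrict (cube a l)) ≠ ⊤ →
      ∫⁻ x in cube a l, ENNReal.ofReal (matNormD (mgradD u x)) ≤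
        C * eLpNorm (fun x => matNormD (symGradD u x)) 2 (volume.restrict (cube a l)) +
          C * ENNReal.ofReal M * (μH[(d : ℝ) - 1] Γ + 1) := by
  set V := ENNReal.ofReal l ^ d with hV
  set P := ENNReal.ofReal (10 ^ 82) with hP
  set R := ENNReal.ofReal (10 ^ 152) with hR
  set c₁ := 2 ^ (d + 1) * volume (Metric.ball (0 : Ed d) 1) with hc₁
  set c₂ := ENNReal.ofReal (4 * d * (l + 2) ^ (d - 1)) with hc₂
  set n : ℝ≥0∞ := ((Fintype.card (Fin d × Fin d) : ℕ) : ℝ≥0∞) with hn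
  have hV1 : V ^ (1 / 2 : ℝ) ≠ ⊤ := ENNReal.rpow_ne_top_of_nonneg (by norm_num) (by finiteness)
  have hc₁t : c₁ ≠ ⊤ := ENNReal.mul_ne_top (by finiteness) measure_ball_lt_top.ne
  refine ⟨V ^ (1 / 2 : ℝ) + n * (4 * (V + P * (c₁ + c₂) + R)), by finiteness, ?_⟩
  intro u Γ hu M hM0 hM hF
  set F := eLpNorm (fun x => matNormD (symGradD u x)) 2 (volume.restrict (cube a l)) with hFdef
  set m := ENNReal.ofReal M
  set H := μH[(d : ℝ) - 1] Γ
  have hspin : ∀ p : Fin d × Fin d, ∫⁻ x in cube a l, ENNReal.ofReal |spinD u p.1 p.2 x| ≤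
      4 * ((F + m) * V + P * m * (c₁ * H + c₂) + R * F) := by
    rintro ⟨i, j⟩
    rcases eq_or_ne i j with rfl | hij
    · simp [spinD]
    · exact lintegral_abs_spinD_cube_le hd hij a hl hu hM0 hM hF
  have hsym : ∫⁻ x in cube a l, ENNReal.ofReal (matNormD (symGradD u x)) ≤
      V ^ (1 / 2 : ℝ) * F := by
    have h1 := eLpNorm_le_eLpNorm_mul_rpow_measure_univ (p := 1) (q := 2)
      (μ := volume.restrict (cube a l)) (f := fun x => matNormD (symGradD u x)) (by norm_num)
      (measurable_matNormD_symGradD u).aestronglyMeasurable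
    rw [eLpNorm_one_eq_lintegral_enorm, Measure.restrict_apply_univ] at h1
    have h2 : (1 / ENNReal.toReal 1 - 1 / ENNReal.toReal 2 : ℝ) = 1 / 2 := by norm_num
    rw [h2, mul_comm] at h1
    calc _ = ∫⁻ x in cube a l, ‖matNormD (symGradD u x)‖ₑ :=
          lintegral_congr fun x => (Real.enorm_of_nonneg (matNormD_nonneg _)).symm
      _ ≤ _ := h1
      _ ≤ _ := by gcongr; exact volume_cube_le a l
  calc ∫⁻ x in cube a l, ENNReal.ofReal (matNormD (mgradD u x))
      ≤ ∫⁻ x in cube a l, (ENNReal.ofReal (matNormD (symGradD u x)) +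
          ∑ p : Fin d × Fin d, ENNReal.ofReal |spinD u p.1 p.2 x|) := by
        refine lintegral_mono fun x => ?_
        rw [← ENNReal.ofReal_sum_of_nonneg fun p _ => abs_nonneg _,
          ← ENNReal.ofReal_add (matNormD_nonneg _) (Finset.sum_nonneg fun p _ => abs_nonneg _)]
        exact ENNReal.ofReal_le_ofReal (matNormD_mgradD_le u x)
    _ = (∫⁻ x in cube a l, ENNReal.ofReal (matNormD (symGradD u x))) +
          ∑ p : Fin d × Fin d, ∫⁻ x in cube a l, ENNReal.ofReal |spinD u p.1 p.2 x| := by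
        rw [lintegral_add_left (measurable_matNormD_symGradD u).ennreal_ofReal,
          lintegral_finsetSum _ fun p _ => (measurable_spinD u p.1 p.2).abs.ennreal_ofReal]
    _ ≤ V ^ (1 / 2 : ℝ) * F +
          ∑ p : Fin d × Fin d, 4 * ((F + m) * V + P * m * (c₁ * H + c₂) + R * F) :=
        add_le_add hsym (Finset.sum_le_sum fun p _ => hspin p)
    _ = V ^ (1 / 2 : ℝ) * F + n * (4 * ((F + m) * V + P * m * (c₁ * H + c₂) + R * F)) := by
        rw [Finset.sum_const, Finset.card_univ, nsmul_eq_mul]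
    _ ≤ V ^ (1 / 2 : ℝ) * F + n * (4 * ((F + m * (H + 1)) * V +
          P * (F + m * (H + 1)) * (c₁ + c₂) + R * (F + m * (H + 1)))) +
          V ^ (1 / 2 : ℝ) * m * (H + 1) := by
        refine le_add_right ?_
        have h1 : m ≤ m * (H + 1) := le_mul_of_one_le_right' le_add_self
        have h2 : c₁ * H + c₂ ≤ (H + 1) * (c₁ + c₂) := by
          calc c₁ * H + c₂ ≤ c₁ * (H + 1) + c₂ * (H + 1) := by
                gcongr
                · exact le_self_add
                · exact le_mul_of_one_le_right' le_add_self
            _ = _ := by ring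
        have h3 : P * m * (c₁ * H + c₂) ≤ P * (F + m * (H + 1)) * (c₁ + c₂) := by
          calc P * m * (c₁ * H + c₂) ≤ P * m * ((H + 1) * (c₁ + c₂)) := by gcongr
            _ = P * (m * (H + 1)) * (c₁ + c₂) := by ring
            _ ≤ _ := by gcongr; exact le_add_self
        gcongr
        exact le_self_add
    _ = _ := by ring

/-- **Embedding inequality for configurations with regular jump set**
(core estimate of Theorem 2.5). -/
theorem embedding_inequality_regular (d : ℕ) (hd : 2 ≤ d) (a : Ed d) (l : ℝ) (hl : 0 < l) :
    ∃ C : ℝ, 0 < C ∧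
      ∀ (u : Ed d → Ed d) (Γ : Set (Ed d)), IsWd d (cube a l) u Γ →
        ∫⁻ x in cube a l, ENNReal.ofReal (matNormD (mgradD u x)) ≤
          ENNReal.ofReal C *
              eLpNorm (fun x => matNormD (symGradD u x)) 2 (volume.restrict (cube a l)) +
            ENNReal.ofReal C * eLpNorm u ⊤ (volume.restrict (cube a l)) *
              (μH[(d : ℝ) - 1] Γ + 1) := by
  obtain ⟨C, hC, hbound⟩ := lintegral_matNormD_mgradD_cube_le hd a hl
  have hC0 : 0 < C.toReal + 1 := by positivity
  refine ⟨C.toReal + 1, hC0, fun u Γ hu => ?_⟩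
  have hCle : C ≤ ENNReal.ofReal (C.toReal + 1) := by
    conv_lhs => rw [← ENNReal.ofReal_toReal hC]
    exact ENNReal.ofReal_le_ofReal (by linarith)
  by_cases hF : eLpNorm (fun x => matNormD (symGradD u x)) 2 (volume.restrict (cube a l)) = ⊤
  · rw [hF, ENNReal.mul_top (ENNReal.ofReal_pos.2 hC0).ne', top_add]
    exact le_top
  have hQo := isOpen_cube a l
  have hsup : eLpNorm u ⊤ (volume.restrict (cube a l)) ≠ ⊤ := by
    obtain ⟨M, hM⟩ := hu.1
    refine ((eLpNormEssSup_le_of_ae_bound (C := M) ?_).trans_lt ENNReal.ofReal_lt_top).ne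
    filter_upwards [ae_restrict_mem hQo.measurableSet] with x hx using hM x hx
  have hU : IsOpen (cube a l \ Γ) := hQo.sdiff hu.2.1.isClosed
  have hM := norm_le_toReal_eLpNorm_top hU sdiff_subset (fun x hx => by
    obtain ⟨t, ht, L, hL⟩ := hu.2.2.1 x hx
    exact (hL.continuousOn.continuousAt ht).continuousWithinAt) hsup
  rcases ENNReal.toReal_nonneg.lt_or_eq with hM0 | hM0
  · refine (hbound u Γ hu _ hM0 hM hF).trans ?_
    rw [ENNReal.ofReal_toReal hsup]
    gcongr
  · rw [← hM0] at hM
    have hΓ0 : ∀ᵐ x, x ∉ Γ :=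
      measure_eq_zero_iff_ae_notMem.1 (hu.2.1.volume_eq_zero (by omega))
    have hzero : ∫⁻ x in cube a l, ENNReal.ofReal (matNormD (mgradD u x)) = 0 := by
      rw [lintegral_eq_zero_iff (measurable_matNormD_mgradD u).ennreal_ofReal]
      filter_upwards [ae_restrict_mem hQo.measurableSet, ae_restrict_of_ae hΓ0] with x hx hxΓ
      have h1 : u =ᶠ[𝓝 x] fun _ => 0 := by
        filter_upwards [hU.mem_nhds ⟨hx, hxΓ⟩] with y hy using norm_le_zero_iff.1 (hM y hy)
      simp [mgradD_eq_zero h1, matNormD]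
    rw [hzero]
    exact zero_le
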